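/- Let f be a loxodromic automorphism of ℂ² and let γ : 𝔻 → ℂ² be a transversal to J⁺, with associated Julia slice E_γ = 𝔻 ∩ ∂(γ⁻¹(K⁺)). If E_γ is a Jordan arc, i.e., E_γ = η([0,1]) for some injective continuous map η : [0,1] → ℂ, then the 1-dimensional Hausdorff measure of E_γ is infinite. -/

import Mathlib

open Function Set Filter Topology

noncomputable section

/-- A polynomial map of `ℂ²`. -/
def IsPolyMap (F : ℂ × ℂ → ℂ × ℂ) : Prop :=
  ∃ P Q : MvPolynomial (Fin 2) ℂ, ∀ z : ℂ × ℂ,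
    F z = (MvPolynomial.eval ![z.1, z.2] P, MvPolynomial.eval ![z.1, z.2] Q)

/-- A polynomial automorphism of `ℂ²`. -/
def IsPolyAuto (F : ℂ × ℂ → ℂ × ℂ) : Prop :=
  IsPolyMap F ∧ ∃ G : ℂ × ℂ → ℂ × ℂ, IsPolyMap G ∧
    (∀ z, G (F z) = z) ∧ (∀ z, F (G z) = z)

/-- A generalized Hénon map. -/
def IsHenon (h : ℂ × ℂ → ℂ × ℂ) : Prop :=
  ∃ (p : Polynomial ℂ) (a : ℂ), a ≠ 0 ∧ 2 ≤ p.natDegree ∧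
    ∀ z : ℂ × ℂ, h z = (Polynomial.eval z.1 p - a * z.2, z.1)

/-- A loxodromic automorphism of `ℂ²`. -/
def IsLoxodromic (f : ℂ × ℂ → ℂ × ℂ) : Prop :=
  IsPolyAuto f ∧
  ∃ (u uinv : ℂ × ℂ → ℂ × ℂ) (hs : List (ℂ × ℂ → ℂ × ℂ)),
    IsPolyAuto u ∧ (∀ z, uinv (u z) = z) ∧ (∀ z, u (uinv z) = z) ∧
    hs ≠ [] ∧ (∀ h ∈ hs, IsHenon h) ∧
    ∀ z, f z = uinv (hs.foldr (fun h acc => h ∘ acc) id (u z))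

/-- The set of points with bounded forward orbit. -/
def Kplus (f : ℂ × ℂ → ℂ × ℂ) : Set (ℂ × ℂ) :=
  {z | ∃ C : ℝ, ∀ n : ℕ, ‖f^[n] z‖ ≤ C}

/-- `lam` is an eigenvalue of the continuous linear map `T`. -/
def IsEigenvalue (T : (ℂ × ℂ) →L[ℂ] ℂ × ℂ) (lam : ℂ) : Prop :=
  ∃ v : ℂ × ℂ, v ≠ 0 ∧ T v = lam • v

/-- `p` is a saddle periodic point of period `n` with stable multiplier `ls`
and unstable multiplier `lu`. -/
def IsSaddle (f : ℂ × ℂ → ℂ × ℂ) (p : ℂ × ℂ) (n : ℕ) (ls lu : ℂ) : Prop :=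
  1 ≤ n ∧ f^[n] p = p ∧
  IsEigenvalue (fderiv ℂ (f^[n]) p) ls ∧ IsEigenvalue (fderiv ℂ (f^[n]) p) lu ∧
  ‖ls‖ < 1 ∧ 1 < ‖lu‖

/-- Coordinatewise complex conjugation `σ(x,y) = (x̄, ȳ)`. -/
def conjMap (z : ℂ × ℂ) : ℂ × ℂ := (starRingEnd ℂ z.1, starRingEnd ℂ z.2)

/-- The open unit disk in `ℂ`. -/
def unitDisk : Set ℂ := Metric.ball 0 1

/-- `γ` is a transversal to `J⁺`. -/
def IsTransversal (f : ℂ × ℂ → ℂ × ℂ) (γ : ℂ → ℂ × ℂ) : Prop :=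
  Set.InjOn γ unitDisk ∧ DifferentiableOn ℂ γ unitDisk ∧
  (∃ z ∈ unitDisk, γ z ∈ Kplus f) ∧ ¬ (∀ z ∈ unitDisk, γ z ∈ Kplus f)

/-- The Julia slice associated to a transversal. -/
def juliaSlice (f : ℂ × ℂ → ℂ × ℂ) (γ : ℂ → ℂ × ℂ) : Set ℂ :=
  unitDisk ∩ frontier {z | z ∈ unitDisk ∧ γ z ∈ Kplus f}

/-- An unstable parametrization of a saddle periodic point. -/
def IsUnstableParam (f : ℂ × ℂ → ℂ × ℂ) (n : ℕ) (lu : ℂ) (p : ℂ × ℂ) (ψ : ℂ → ℂ × ℂ) : Prop :=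
  Function.Injective ψ ∧ Differentiable ℂ ψ ∧ ψ 0 = p ∧
  ∀ ζ : ℂ, f^[n] (ψ ζ) = ψ (lu * ζ)

/-- `S` is contained in a proper real-analytic subvariety of `ℂ²`. -/
def ContainedInProperRealAnalyticSubvariety (S : Set (ℂ × ℂ)) : Prop :=
  ∃ V : Set (ℂ × ℂ), IsClosed V ∧ V ≠ Set.univ ∧ S ⊆ V ∧
    ∀ x ∈ V, ∃ (U : Set (ℂ × ℂ)) (g : ℂ × ℂ → ℝ),
      IsOpen U ∧ x ∈ U ∧ (∀ y ∈ U, AnalyticAt ℝ g y) ∧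
      (∃ y ∈ U, g y ≠ 0) ∧ ∀ y ∈ V ∩ U, g y = 0

open InnerProductSpace

/-- Ultrafilter version of Montel's theorem on a ball. -/
theorem jl_montel {ι : Type*} (𝓕 : Ultrafilter ι) (F : ι → ℂ → ℂ) (f : ℂ → ℂ) (c : ℂ) (r B : ℝ)
    (hr : 0 < r)
    (h : ∀ᶠ i in (𝓕 : Filter ι), DifferentiableOn ℂ (F i) (Metric.ball c r) ∧
      ∀ z ∈ Metric.ball c r, ‖F i z‖ ≤ B)
    (hp : ∀ z ∈ Metric.ball c r, Tendsto (fun i => F i z) 𝓕 (𝓝 (f z))) :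
    TendstoLocallyUniformlyOn F f 𝓕 (Metric.ball c (r/2)) ∧
      DifferentiableOn ℂ f (Metric.ball c (r/2)) := by
  have hsub : Metric.ball c (r/2) ⊆ Metric.ball c r := Metric.ball_subset_ball (by linarith)
  have hder : ∀ᶠ i in (𝓕 : Filter ι), ∀ z ∈ Metric.ball c (r/2), ∀ w ∈ Metric.ball c (r/2),
      ‖F i z - F i w‖ ≤ (B / (r/2)) * ‖z - w‖ := by
    filter_upwards [h] with i hi z hz w hw
    have hd : ∀ x ∈ Metric.ball c (r/2), ‖deriv (F i) x‖ ≤ B / (r/2) := by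
      intro x hx
      have hx' : dist x c < r/2 := hx
      have hsx : Metric.ball x (r/2) ⊆ Metric.ball c r := by
        intro y hy
        have hy' : dist y x < r/2 := hy
        have := dist_triangle y x c
        show dist y c < r
        linarith
      by_contra hcon
      push Not at hcon
      -- use radius slightly smaller
      have key : ∀ s, 0 < s → s < r/2 → ‖deriv (F i) x‖ ≤ B / s := by
        intro s hs0 hs
        apply Complex.norm_deriv_le_of_forall_mem_sphere_norm_le hs0
        · apply DifferentiableOn.diffContOnCl
          rw [closure_ball _ hs0.ne']
          exact hi.1.mono ((Metric.closedBall_subset_ball hs).trans hsx)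
        · intro y hy
          apply hi.2
          apply hsx
          exact Metric.sphere_subset_closedBall.trans (Metric.closedBall_subset_ball hs) hy
      have hlim : Tendsto (fun s : ℝ => B / s) (𝓝[<] (r/2)) (𝓝 (B / (r/2))) := by
        apply tendsto_nhdsWithin_of_tendsto_nhds
        exact tendsto_const_nhds.div tendsto_id (by positivity)
      have := ge_of_tendsto hlim (b := ‖deriv (F i) x‖) (by
        filter_upwards [Ioo_mem_nhdsLT (show (0:ℝ) < r/2 by linarith)] with s hs
        exact key s hs.1 hs.2)
      linarith
    have := (convex_ball c (r/2)).norm_image_sub_le_of_norm_deriv_le (𝕜 := ℂ) (f := F i)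
      (fun x hx => (hi.1.mono hsub).differentiableAt (Metric.isOpen_ball.mem_nhds hx)) hd hw hz
    exact this
  have hB : 0 ≤ B / (r/2) := by
    obtain ⟨i, hi⟩ := h.exists
    have := (norm_nonneg _).trans (hi.2 c (Metric.mem_ball_self hr))
    positivity
  set L := B / (r/2) with hL
  have hfl : ∀ z ∈ Metric.ball c (r/2), ∀ w ∈ Metric.ball c (r/2),
      ‖f z - f w‖ ≤ L * ‖z - w‖ := by
    intro z hz w hw
    have ht := ((hp z (hsub hz)).sub (hp w (hsub hw))).norm
    refine le_of_tendsto ht ?_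
    filter_upwards [hder] with i hi
    exact hi z hz w hw
  have hlu : TendstoLocallyUniformlyOn F f 𝓕 (Metric.ball c (r/2)) := by
    rw [Metric.tendstoLocallyUniformlyOn_iff]
    intro ε hε x hx
    set ρ := ε / (3 * (L + 1)) with hρ
    have hρ0 : 0 < ρ := by positivity
    have hLρ : L * ρ ≤ ε / 3 := by
      rw [hρ]
      have : L * (ε / (3 * (L + 1))) = (ε/3) * (L / (L+1)) := by field_simp
      rw [this]
      have : L / (L+1) ≤ 1 := by rw [div_le_one (by positivity)]; linarith
      nlinarith
    refine ⟨Metric.ball x ρ ∩ Metric.ball c (r/2), ?_, ?_⟩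
    · exact mem_nhdsWithin.2 ⟨Metric.ball x ρ, Metric.isOpen_ball, Metric.mem_ball_self hρ0, subset_rfl⟩
    · have h1 := (Metric.tendsto_nhds.1 (hp x (hsub hx))) (ε/3) (by positivity)
      filter_upwards [h1, hder] with i hi1 hi2 y hy
      have e1 := hfl y hy.2 x hx
      have e2 := hi2 x hx y hy.2
      have hyx : ‖y - x‖ < ρ := by rw [← dist_eq_norm]; exact hy.1
      have hxy : ‖x - y‖ < ρ := by rw [norm_sub_rev]; exact hyx
      rw [dist_eq_norm] at hi1 ⊢
      have : f y - F i y = (f y - f x) - (F i x - f x) + (F i x - F i y) := by ring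
      rw [this]
      have e3 : L * ‖y - x‖ ≤ L * ρ := by gcongr
      have e4 : L * ‖x - y‖ ≤ L * ρ := by gcongr
      calc _ ≤ ‖(f y - f x) - (F i x - f x)‖ + ‖F i x - F i y‖ := norm_add_le _ _
        _ ≤ ‖f y - f x‖ + ‖F i x - f x‖ + ‖F i x - F i y‖ := by gcongr; exact norm_sub_le _ _
        _ < ε := by linarith
  refine ⟨hlu, hlu.differentiableOn ?_ Metric.isOpen_ball⟩
  filter_upwards [h] with i hi using hi.1.mono hsub

/-- Bounded sequences converge along ultrafilters. -/
theorem jl_ultra_lim {ι : Type*} (𝓕 : Ultrafilter ι) (x : ι → ℂ) (B : ℝ)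
    (h : ∀ᶠ i in (𝓕 : Filter ι), ‖x i‖ ≤ B) : ∃ a, Tendsto x 𝓕 (𝓝 a) := by
  have hK : IsCompact (Metric.closedBall (0:ℂ) B) := isCompact_closedBall _ _
  obtain ⟨a, -, ha⟩ := hK.ultrafilter_le_nhds (𝓕.map x) (by
    rw [le_principal_iff]
    show ∀ᶠ i in (𝓕 : Filter ι), x i ∈ Metric.closedBall (0:ℂ) B
    simpa using h)
  exact ⟨a, ha⟩

/-- Borel–Carathéodory on a ball centred at `c`. -/
theorem jl_bc {F : ℂ → ℂ} {c : ℂ} {r M : ℝ} (hr : 0 < r) (hM : 0 < M)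
    (hF : DifferentiableOn ℂ F (Metric.ball c r))
    (hre : ∀ z ∈ Metric.ball c r, (F z).re - (F c).re ≤ M) :
    ∀ z ∈ Metric.closedBall c (r/2), ‖F z - F c‖ ≤ 2 * M := by
  intro z hz
  have hz' : ‖z - c‖ ≤ r/2 := by simpa [dist_eq_norm] using hz
  have h := Complex.borelCaratheodory_zero (f := fun w => F (c + w) - F c) (M := M) (R := r)
    (z := z - c) hM ?_ ?_ hr ?_ (by simp)
  · simp only [add_sub_cancel] at h
    refine h.trans ?_
    rw [div_le_iff₀ (by linarith)]
    nlinarith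
  · apply DifferentiableOn.sub_const
    apply hF.comp (by fun_prop)
    intro w hw
    simpa [dist_eq_norm] using hw
  · intro w hw
    have := hre (c + w) (by simpa [dist_eq_norm] using hw)
    simpa using this
  · simp; linarith

/-- derivative bound. -/
theorem jl_deriv_bound {F : ℂ → ℂ} {c : ℂ} {r M : ℝ} (hr : 0 < r) (hM : 0 ≤ M)
    (hF : DifferentiableOn ℂ F (Metric.ball c r))
    (hre : ∀ z ∈ Metric.ball c r, (F z).re - (F c).re ≤ M) :
    ‖deriv F c‖ ≤ 4 * M / r := by
  have key : ∀ M', M < M' → ‖deriv F c‖ ≤ 4 * M' / r := by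
    intro M' hM'
    have h := jl_bc hr (hM.trans_lt hM') hF (fun z hz => (hre z hz).trans hM'.le)
    have h2 := Complex.norm_deriv_le_of_forall_mem_sphere_norm_le (f := fun z => F z - F c)
      (c := c) (R := r/2) (C := 2 * M') (by linarith) ?_ ?_
    · rw [deriv_sub_const] at h2
      refine h2.trans (le_of_eq ?_)
      field_simp
      ring
    · apply DifferentiableOn.diffContOnCl
      rw [closure_ball _ (by positivity)]
      exact (hF.mono (Metric.closedBall_subset_ball (by linarith))).sub_const _
    · intro z hz
      exact h z (Metric.sphere_subset_closedBall hz)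
  have hlim : Tendsto (fun s : ℝ => 4 * s / r) (𝓝[>] M) (𝓝 (4 * M / r)) := by
    apply tendsto_nhdsWithin_of_tendsto_nhds
    exact (tendsto_const_nhds.mul tendsto_id).div_const _
  exact ge_of_tendsto hlim (by filter_upwards [self_mem_nhdsWithin] with s hs using key s hs)


/-- Pointwise bounded limits of harmonic functions are harmonic. -/
theorem jl_harm_lim {ι : Type*} (𝓕 : Ultrafilter ι) (u : ι → ℂ → ℝ) (U : ℂ → ℝ) (c : ℂ) (r B : ℝ)
    (hr : 0 < r)
    (h : ∀ᶠ i in (𝓕 : Filter ι), HarmonicOnNhd (u i) (Metric.ball c r) ∧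
      ∀ z ∈ Metric.ball c r, |u i z| ≤ B)
    (hp : ∀ z ∈ Metric.ball c r, Tendsto (fun i => u i z) 𝓕 (𝓝 (U z))) :
    HarmonicAt U c := by
  have hB : 0 ≤ B := by
    obtain ⟨i, hi⟩ := h.exists
    exact (abs_nonneg _).trans (hi.2 c (Metric.mem_ball_self hr))
  have hex : ∀ i, ∃ F : ℂ → ℂ, HarmonicOnNhd (u i) (Metric.ball c r) →
      DifferentiableOn ℂ F (Metric.ball c r) ∧ ∀ z ∈ Metric.ball c r, (F z).re = u i z := by
    intro i
    by_cases hi : HarmonicOnNhd (u i) (Metric.ball c r)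
    · obtain ⟨F, hF, hF2⟩ := hi.exists_analyticOnNhd_ball_re_eq
      exact ⟨F, fun _ => ⟨hF.differentiableOn, fun z hz => hF2 hz⟩⟩
    · exact ⟨0, fun h => absurd h hi⟩
  choose F hF using hex
  set H : ι → ℂ → ℂ := fun i z => F i z - F i c with hH
  have hb : ∀ᶠ i in (𝓕 : Filter ι), DifferentiableOn ℂ (H i) (Metric.ball c (r/2)) ∧
      ∀ z ∈ Metric.ball c (r/2), ‖H i z‖ ≤ 2 * (2 * B + 1) := by
    filter_upwards [h] with i hi
    obtain ⟨h1, h2⟩ := hF i hi.1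
    refine ⟨(h1.mono (Metric.ball_subset_ball (by linarith))).sub_const _, fun z hz => ?_⟩
    refine jl_bc hr (by positivity) h1 (fun w hw => ?_) z (Metric.ball_subset_closedBall hz)
    rw [h2 w hw, h2 c (Metric.mem_ball_self hr)]
    have a1 := abs_le.1 (hi.2 w hw)
    have a2 := abs_le.1 (hi.2 c (Metric.mem_ball_self hr))
    linarith
  have hlim : ∀ z, ∃ a, z ∈ Metric.ball c (r/2) → Tendsto (fun i => H i z) 𝓕 (𝓝 a) := by
    intro z
    by_cases hz : z ∈ Metric.ball c (r/2)
    · obtain ⟨a, ha⟩ := jl_ultra_lim 𝓕 (fun i => H i z) (2 * (2 * B + 1))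
        (by filter_upwards [hb] with i hi using hi.2 z hz)
      exact ⟨a, fun _ => ha⟩
    · exact ⟨0, fun h => absurd h hz⟩
  choose f hf using hlim
  obtain ⟨-, hd⟩ := jl_montel 𝓕 H f c (r/2) _ (by linarith) hb hf
  have hcm : c ∈ Metric.ball c (r/2/2) := Metric.mem_ball_self (by linarith)
  have han : AnalyticAt ℂ f c := hd.analyticAt (Metric.isOpen_ball.mem_nhds hcm)
  have hfan : AnalyticAt ℂ (fun z => f z + (U c : ℂ)) c := han.add analyticAt_const
  have heq : (fun z => (f z + (U c : ℂ)).re) =ᶠ[𝓝 c] U := by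
    filter_upwards [Metric.isOpen_ball.mem_nhds hcm] with z hz
    have hz2 : z ∈ Metric.ball c (r/2) := Metric.ball_subset_ball (by linarith) hz
    have hz3 : z ∈ Metric.ball c r := Metric.ball_subset_ball (by linarith) hz2
    have t1 : Tendsto (fun i => (H i z).re) 𝓕 (𝓝 (f z).re) :=
      (Complex.continuous_re.tendsto _).comp (hf z hz2)
    have t2 : Tendsto (fun i => u i z - u i c) 𝓕 (𝓝 (U z - U c)) :=
      (hp z hz3).sub (hp c (Metric.mem_ball_self hr))
    have t3 : (fun i => (H i z).re) =ᶠ[𝓕] (fun i => u i z - u i c) := by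
      filter_upwards [h] with i hi
      obtain ⟨h1, h2⟩ := hF i hi.1
      simp [hH, h2 z hz3, h2 c (Metric.mem_ball_self hr)]
    have := tendsto_nhds_unique (t1.congr' t3) t2
    simp [this]
  exact (harmonicAt_congr_nhds heq).1 hfan.harmonicAt_re

/-- Maximum principle. -/
theorem jl_harm_max {S : Set ℂ} (hS : IsOpen S) (hb : Bornology.IsBounded S) {w : ℂ → ℝ}
    (hc : ContinuousOn w (closure S)) (hh : HarmonicOnNhd w S) (C : ℝ)
    (hfr : ∀ z ∈ frontier S, w z ≤ C) : ∀ z ∈ S, w z ≤ C := by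
  intro z hz
  have hK : IsCompact (closure S) := hb.isCompact_closure
  obtain ⟨z0, hz0, hmax⟩ := hK.exists_isMaxOn ⟨z, subset_closure hz⟩ hc
  by_contra hcon
  push Not at hcon
  have hz0C : C < w z0 := hcon.trans_le (hmax (subset_closure hz))
  set T := closure S ∩ w ⁻¹' {w z0} with hT
  have hTc : IsCompact T := by
    apply hK.of_isClosed_subset _ inter_subset_left
    exact hc.preimage_isClosed_of_isClosed isClosed_closure isClosed_singleton
  obtain ⟨z1, hz1, hmax1⟩ := hTc.exists_isMaxOn ⟨z0, hz0, rfl⟩ Complex.continuous_re.continuousOn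
  have hw1 : w z1 = w z0 := hz1.2
  have hz1S : z1 ∈ S := by
    by_contra hn
    have : z1 ∈ frontier S := by
      rw [hS.frontier_eq]; exact ⟨hz1.1, hn⟩
    have := hfr z1 this
    linarith
  obtain ⟨r, hr, hrS⟩ := Metric.isOpen_iff.1 hS z1 hz1S
  obtain ⟨F, hF, hF2⟩ := (hh.mono hrS).exists_analyticOnNhd_ball_re_eq
  have hmem : Metric.ball z1 r ∈ 𝓝 z1 := Metric.ball_mem_nhds z1 hr
  have hn : ∀ y ∈ Metric.ball z1 r, ‖Complex.exp (F y)‖ = Real.exp (w y) := by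
    intro y hy
    rw [Complex.norm_exp]
    exact congrArg Real.exp (hF2 hy)
  have hev := Complex.norm_eventually_eq_of_isLocalMax (f := fun y => Complex.exp (F y)) (c := z1)
    (by filter_upwards [hmem] with y hy using (hF y hy).differentiableAt.cexp)
    (by
      filter_upwards [hmem] with y hy
      simp only [comp]
      rw [hn y hy, hn z1 (Metric.mem_ball_self hr), hw1]
      exact Real.exp_le_exp.2 (hmax (subset_closure (hrS hy))))
  have hev2 : ∀ᶠ y in 𝓝 z1, w y = w z1 := by
    filter_upwards [hev, hmem] with y h1 h2
    rw [hn y h2, hn z1 (Metric.mem_ball_self hr)] at h1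
    exact Real.exp_injective h1
  obtain ⟨ε, hε, hε2⟩ := Metric.eventually_nhds_iff.1 (hev2.and hmem)
  have hd : dist (z1 + ((ε/2 : ℝ) : ℂ)) z1 < ε := by
    simp [dist_eq_norm, abs_of_pos hε]
    linarith
  obtain ⟨h1, h2⟩ := hε2 hd
  have : (z1 + ((ε/2 : ℝ) : ℂ)).re ≤ z1.re :=
    hmax1 (show z1 + ((ε/2 : ℝ) : ℂ) ∈ T from ⟨subset_closure (hrS h2), by
      show w _ = w z0
      rw [h1, hw1]⟩)
  simp at this
  linarith


/-- The real part of the principal power. -/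
def jl_pw (α : ℝ) (w : ℂ) : ℝ := (Complex.exp (α * Complex.log w)).re

theorem jl_pw_eq (α : ℝ) {w : ℂ} (hw : w ≠ 0) :
    jl_pw α w = ‖w‖ ^ α * Real.cos (α * w.arg) := by
  have : (0:ℝ) < ‖w‖ := norm_pos_iff.2 hw
  rw [jl_pw, Complex.exp_re, Real.rpow_def_of_pos this]
  simp [Complex.log_re, Complex.log_im, mul_comm]

theorem jl_pw_analytic (α : ℝ) {w : ℂ} (hw : w ∈ Complex.slitPlane) :
    AnalyticAt ℂ (fun z => Complex.exp (α * Complex.log z)) w :=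
  (analyticAt_const.mul (analyticAt_clog hw)).cexp

theorem jl_pw_harm (α : ℝ) (a b : ℂ) {z : ℂ} (hw : a + b * z ∈ Complex.slitPlane) :
    HarmonicAt (fun z => jl_pw α (a + b * z)) z := by
  have h1 : AnalyticAt ℂ (fun z : ℂ => a + b * z) z := by fun_prop
  exact (AnalyticAt.comp (g := fun z => Complex.exp (α * Complex.log z))
    (f := fun z : ℂ => a + b * z) (jl_pw_analytic α hw) h1).harmonicAt_re

theorem jl_harm_cont {u : ℂ → ℝ} {z : ℂ} (h : HarmonicAt u z) : ContinuousAt u z :=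
  h.1.continuousAt

theorem jl_PL {S : Set ℂ} (hS : IsOpen S) (hSH : ∀ z ∈ S, 0 < z.im) {w : ℂ → ℝ}
    (hc : ContinuousOn w (closure S)) (hh : HarmonicOnNhd w S) (C : ℝ)
    (hg : ∀ z ∈ S, w z ≤ C * √(1 + ‖z‖)) (hfr : ∀ z ∈ frontier S, w z ≤ 0) :
    ∀ z ∈ S, w z ≤ 0 := by
  have hcl : ∀ z ∈ closure S, 0 ≤ z.im := by
    have : IsClosed {z : ℂ | 0 ≤ z.im} := isClosed_le continuous_const Complex.continuous_im
    exact fun z hz => closure_minimal (fun z hz => (hSH z hz).le) this hz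
  have hg' : ∀ z ∈ closure S, w z ≤ |C| * √(1 + ‖z‖) := by
    intro z hz
    refine le_on_closure (f := w) (g := fun z => |C| * √(1 + ‖z‖)) (s := S) ?_ hc (by fun_prop) hz
    intro z hz
    refine (hg z hz).trans ?_
    gcongr
    exact le_abs_self C
  set b : ℂ → ℝ := fun z => jl_pw (3/4) (1 + (-Complex.I) * z) with hb
  have hre : ∀ z : ℂ, (1 + (-Complex.I) * z).re = 1 + z.im := by intro z; simp
  have him : ∀ z : ℂ, (1 + (-Complex.I) * z).im = - z.re := by intro z; simp
  have hsl : ∀ z : ℂ, 0 ≤ z.im → 1 + (-Complex.I) * z ∈ Complex.slitPlane := by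
    intro z hz
    left
    rw [hre]; linarith
  set c : ℝ := Real.cos (3/8 * Real.pi) with hcdef
  have hc0 : 0 < c := Real.cos_pos_of_mem_Ioo ⟨by linarith [Real.pi_pos], by linarith [Real.pi_pos]⟩
  have hbl : ∀ z : ℂ, 0 ≤ z.im → ‖1 + (-Complex.I) * z‖ ^ (3/4 : ℝ) * c ≤ b z := by
    intro z hz
    rw [hb]
    simp only
    rw [jl_pw_eq _ (Complex.slitPlane_ne_zero (hsl z hz))]
    gcongr
    have ha : |(1 + (-Complex.I) * z).arg| ≤ Real.pi / 2 := by
      rw [Complex.abs_arg_le_pi_div_two_iff, hre]; linarith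
    rw [← Real.cos_abs (3/4 * _), hcdef]
    apply Real.cos_le_cos_of_nonneg_of_le_pi (abs_nonneg _) (by linarith [Real.pi_pos])
    rw [abs_mul, abs_of_pos (by norm_num : (0:ℝ) < 3/4)]
    linarith
  have hbh : ∀ z : ℂ, 0 ≤ z.im → HarmonicAt b z := fun z hz => jl_pw_harm _ _ _ (hsl z hz)
  have hnorm : ∀ z : ℂ, 0 ≤ z.im → (1 + ‖z‖) / 2 ≤ ‖1 + (-Complex.I) * z‖ := by
    intro z hz
    apply le_of_sq_le_sq _ (norm_nonneg _)
    have h1 : ‖1 + (-Complex.I) * z‖ ^ 2 = (1 + z.im)^2 + z.re^2 := by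
      rw [← Complex.normSq_eq_norm_sq, Complex.normSq_apply, hre, him]; ring
    have h2 : ‖z‖^2 = z.re^2 + z.im^2 := by
      rw [← Complex.normSq_eq_norm_sq, Complex.normSq_apply]; ring
    nlinarith [sq_nonneg (‖z‖ - 1)]
  intro z0 hz0
  have key : ∀ ε : ℝ, 0 < ε → w z0 ≤ ε * b z0 := by
    intro ε hε
    set t : ℝ := max (8 * |C| / (ε * c)) (‖z0‖ + 2) with ht
    have ht2 : ‖z0‖ + 2 ≤ t := le_max_right _ _
    have ht0 : 2 ≤ t := by linarith [norm_nonneg z0]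
    have ht1 : 8 * |C| ≤ t * (ε * c) := by
      rw [← div_le_iff₀ (by positivity)]; exact le_max_left _ _
    set ρ : ℝ := t^4 - 1 with hρ
    have hρz : ‖z0‖ < ρ := by
      have : t ≤ t^4 := le_self_pow₀ (by linarith) (by norm_num)
      linarith
    have hmain := jl_harm_max (S := S ∩ Metric.ball 0 ρ) (hS.inter Metric.isOpen_ball)
      (Metric.isBounded_ball.subset inter_subset_right) (w := fun z => w z - ε * b z) ?_ ?_ 0 ?_ z0
      ⟨hz0, by simpa using hρz⟩
    · simpa using hmain
    · apply ContinuousOn.sub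
      · exact hc.mono (closure_mono inter_subset_left)
      · intro z hz
        have hz' := hcl z (closure_mono inter_subset_left hz)
        exact ((jl_harm_cont (hbh z hz')).const_mul ε (f := b) |>.continuousWithinAt)
    · intro z hz
      have h1 := hh z hz.1
      have h2 := (hbh z (hSH z hz.1).le).const_smul (c := ε)
      exact h1.sub h2
    · intro z hz
      rw [(hS.inter Metric.isOpen_ball).frontier_eq] at hz
      obtain ⟨hz1, hz2⟩ := hz
      have hzc : z ∈ closure S := closure_mono inter_subset_left hz1
      have hzi := hcl z hzc
      have hb0 : 0 ≤ b z := le_trans (by positivity) (hbl z hzi)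
      by_cases hlt : ‖z‖ < ρ
      · have hzS : z ∉ S := fun h => hz2 ⟨h, by simpa using hlt⟩
        have := hfr z (by rw [hS.frontier_eq]; exact ⟨hzc, hzS⟩)
        nlinarith
      · have hle : ‖z‖ ≤ ρ := by
          have : z ∈ Metric.closedBall (0:ℂ) ρ :=
            closure_minimal Metric.ball_subset_closedBall Metric.isClosed_closedBall
              (closure_mono inter_subset_right hz1)
          simpa using this
        have heq : ‖z‖ = ρ := le_antisymm hle (not_lt.1 hlt)
        have h1 := hg' z hzc
        have h2 := hbl z hzi
        have h3 := hnorm z hzi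
        have e1 : 1 + ‖z‖ = t^4 := by rw [heq, hρ]; ring
        have e2 : √(1 + ‖z‖) = t^2 := by
          rw [e1, show t^4 = (t^2)^2 by ring, Real.sqrt_sq (by positivity)]
        have e3 : (t/2)^3 ≤ ‖1 + (-Complex.I) * z‖ ^ (3/4 : ℝ) := by
          have : ((t/2)^4) ^ (3/4 : ℝ) = (t/2)^3 := by
            rw [← Real.rpow_natCast, ← Real.rpow_natCast, ← Real.rpow_mul (by positivity)]
            norm_num
          rw [← this]
          apply Real.rpow_le_rpow (by positivity) _ (by norm_num)
          refine le_trans ?_ h3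
          rw [e1]
          have : 0 ≤ t^4 := by positivity
          nlinarith
        rw [e2] at h1
        have e4 : (t/2)^3 * c ≤ b z := le_trans (by gcongr) h2
        have e5 : ε * ((t/2)^3 * c) ≤ ε * b z := by gcongr
        have e6 : |C| * t^2 ≤ ε * ((t/2)^3 * c) := by
          have : ε * ((t/2)^3 * c) = t^2 * (t * (ε * c)) / 8 := by ring
          rw [this]
          have : 0 ≤ t^2 := by positivity
          nlinarith
        linarith
  have hlim : Tendsto (fun ε : ℝ => ε * b z0) (𝓝[>] 0) (𝓝 (0 * b z0)) := by
    apply tendsto_nhdsWithin_of_tendsto_nhds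
    exact tendsto_id.mul_const _
  have := ge_of_tendsto hlim (by filter_upwards [self_mem_nhdsWithin] with s hs using key s hs)
  simpa using this


theorem jl_bdry {U : ℂ → ℝ} (hUc : Continuous U) (hUh : ∀ z : ℂ, 0 < z.im → HarmonicAt U z)
    (hU0 : ∀ t : ℝ, U t = 0) {t ρ M : ℝ} (hρ : 0 < ρ) (hM : 0 ≤ M)
    (hUM : ∀ z : ℂ, 0 ≤ z.im → ‖z - t‖ ≤ ρ → U z ≤ M) {y : ℝ} (hy : 0 < y) (hyρ : y < ρ) :
    U (t + y * Complex.I) ≤ 2 * M * y / ρ := by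
  set b : ℂ → ℝ := fun ζ => 1/ρ - (Complex.I / (ζ - t + ρ * Complex.I)).re with hb
  have hne : ∀ ζ : ℂ, 0 ≤ ζ.im → ζ - t + ρ * Complex.I ≠ 0 := by
    intro ζ hζ h
    have := congrArg Complex.im h
    simp at this
    linarith
  have hbv : ∀ ζ : ℂ, b ζ = 1/ρ - (ζ.im + ρ) / ((ζ.re - t)^2 + (ζ.im + ρ)^2) := by
    intro ζ
    simp only [hb, Complex.div_re, Complex.normSq_apply]
    simp
    ring
  have hbn : ∀ ζ : ℂ, ‖ζ - t‖^2 = (ζ.re - t)^2 + ζ.im^2 := by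
    intro ζ
    rw [← Complex.normSq_eq_norm_sq, Complex.normSq_apply]; simp; ring
  have hb0 : ∀ ζ : ℂ, 0 ≤ ζ.im → 0 ≤ b ζ := by
    intro ζ hζ
    rw [hbv, sub_nonneg, div_le_div_iff₀ (by positivity) hρ]
    nlinarith [sq_nonneg (ζ.re - t), mul_nonneg hζ hρ.le]
  have hb1 : ∀ ζ : ℂ, 0 ≤ ζ.im → ‖ζ - t‖ = ρ → b ζ = 1/(2*ρ) := by
    intro ζ hζ h
    have := hbn ζ
    rw [h] at this
    have e : (ζ.re - t)^2 + (ζ.im + ρ)^2 = 2 * ρ * (ζ.im + ρ) := by nlinarith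
    rw [hbv, e]
    have : ζ.im + ρ ≠ 0 := by positivity
    field_simp
    ring
  have hbh : ∀ z : ℂ, 0 ≤ z.im → HarmonicAt b z := by
    intro z hz
    have : AnalyticAt ℂ (fun ζ : ℂ => (1/ρ : ℝ) - Complex.I / (ζ - t + ρ * Complex.I)) z :=
      analyticAt_const.sub (analyticAt_const.div (by fun_prop) (hne z hz))
    have h2 := this.harmonicAt_re
    convert h2 using 1
    funext ζ
    rw [Complex.sub_re, Complex.ofReal_re]
  set S : Set ℂ := {z | 0 < z.im} ∩ Metric.ball (t:ℂ) ρ with hS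
  have hSo : IsOpen S := (isOpen_lt continuous_const Complex.continuous_im).inter Metric.isOpen_ball
  have hScl : ∀ z ∈ closure S, 0 ≤ z.im ∧ ‖z - t‖ ≤ ρ := by
    have hcl : IsClosed {z : ℂ | 0 ≤ z.im ∧ ‖z - t‖ ≤ ρ} :=
      (isClosed_le continuous_const Complex.continuous_im).inter
        (isClosed_le (f := fun z : ℂ => ‖z - t‖) (by fun_prop) continuous_const)
    intro z hz
    refine closure_minimal ?_ hcl hz
    rintro z ⟨h1, h2⟩
    rw [Metric.mem_ball, dist_eq_norm] at h2
    exact ⟨h1.le, h2.le⟩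
  have hmain := jl_harm_max hSo (Metric.isBounded_ball.subset inter_subset_right)
    (w := fun z => U z - (2 * ρ * M) * b z) ?_ ?_ 0 ?_ (t + y * Complex.I) ?_
  · have e : b (t + y * Complex.I) = y / (ρ * (y + ρ)) := by
      rw [hbv]
      simp
      field_simp
      ring
    simp only [e] at hmain
    have : 2 * ρ * M * (y / (ρ * (y + ρ))) ≤ 2 * M * y / ρ := by
      rw [show 2 * ρ * M * (y / (ρ * (y + ρ))) = 2 * M * y / (y + ρ) by field_simp]
      gcongr
      linarith
    linarith
  · apply ContinuousOn.sub hUc.continuousOn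
    intro z hz
    exact ((jl_harm_cont (hbh z (hScl z hz).1)).const_mul _ (f := b) |>.continuousWithinAt)
  · intro z hz
    exact (hUh z hz.1).sub ((hbh z (le_of_lt hz.1)).const_smul (c := 2 * ρ * M))
  · intro z hz
    rw [hSo.frontier_eq] at hz
    obtain ⟨h1, h2⟩ := hScl z hz.1
    by_cases h0 : 0 < z.im
    · have h3 : ‖z - t‖ = ρ := by
        refine le_antisymm h2 (not_lt.1 fun h => hz.2 ⟨h0, ?_⟩)
        rwa [Metric.mem_ball, dist_eq_norm]
      rw [hb1 z h1 h3]
      have := hUM z h1 h2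
      field_simp
      linarith
    · have h3 : z.im = 0 := le_antisymm (not_lt.1 h0) h1
      have h4 : z = (z.re : ℂ) := by apply Complex.ext <;> simp [h3]
      have h5 : U z = 0 := by rw [h4]; exact hU0 _
      have h6 := hb0 z h1
      have : 0 ≤ 2 * ρ * M * b z := by positivity
      linarith
  · refine ⟨by simpa using hy, ?_⟩
    simp [dist_eq_norm, abs_of_pos hy, hyρ]

theorem jl_harm_local {U : ℂ → ℝ} {c : ℂ} (h : HarmonicAt U c) :
    ∃ F : ℂ → ℂ, AnalyticAt ℂ F c ∧ ∀ᶠ z in 𝓝 c, (F z).re = U z := by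
  obtain ⟨r, hr, hrU⟩ := Metric.eventually_nhds_iff_ball.1 h.eventually
  obtain ⟨F, hF, hF2⟩ := HarmonicOnNhd.exists_analyticOnNhd_ball_re_eq (f := U) (z := c) (R := r)
    (fun z hz => hrU z hz)
  refine ⟨F, hF c (Metric.mem_ball_self hr), ?_⟩
  filter_upwards [Metric.ball_mem_nhds c hr] with z hz using hF2 hz

theorem jl_harm_comp {U : ℂ → ℝ} {g : ℂ → ℂ} {z : ℂ} (h : HarmonicAt U (g z))
    (hg : AnalyticAt ℂ g z) : HarmonicAt (fun w => U (g w)) z := by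
  obtain ⟨F, hF, hF2⟩ := jl_harm_local h
  have h1 : AnalyticAt ℂ (fun w => F (g w)) z := AnalyticAt.comp hF hg
  refine (harmonicAt_congr_nhds ?_).1 h1.harmonicAt_re
  exact hg.continuousAt.eventually hF2

theorem jl_linear {U : ℂ → ℝ} (hUc : Continuous U) (hUn : ∀ z, 0 ≤ U z)
    (hUh : ∀ z : ℂ, 0 < z.im → HarmonicAt U z)
    (hU0 : ∀ t : ℝ, U t = 0) (C : ℝ) (hC : ∀ z, U z ≤ C * ((1 + ‖z‖) * √(1 + ‖z‖))) :
    ∃ a, 0 ≤ a ∧ ∀ z : ℂ, 0 ≤ z.im → U z = a * z.im := by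
  have hC0 : 0 ≤ C := by
    have h1 := hC 0
    have h2 := hUn 0
    simp at h1
    linarith
  have hb : ∀ z : ℂ, 0 < z.im → U z ≤ 8 * C * √(1 + ‖z‖) * z.im := by
    intro z hz
    have hρ : (0:ℝ) < 1 + ‖z‖ := by positivity
    have h := jl_bdry hUc hUh hU0 (t := z.re) (ρ := 1 + ‖z‖)
      (M := C * ((2 * (1 + ‖z‖)) * (2 * √(1 + ‖z‖)))) hρ (by positivity) ?_ hz
      (by linarith [(le_abs_self _).trans (Complex.abs_im_le_norm z)])
    · rw [Complex.re_add_im] at h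
      refine h.trans (le_of_eq ?_)
      field_simp
      ring
    · intro w hw1 hw2
      have h1 : ‖w‖ ≤ 1 + 2 * ‖z‖ := by
        have e1 : ‖w‖ ≤ ‖w - z.re‖ + ‖(z.re : ℂ)‖ := by
          have := norm_add_le (w - z.re) (z.re : ℂ)
          simpa using this
        have e2 : ‖(z.re : ℂ)‖ ≤ ‖z‖ := by
          rw [Complex.norm_real]; exact Complex.abs_re_le_norm z
        linarith
      have h2 : 1 + ‖w‖ ≤ 2 * (1 + ‖z‖) := by linarith
      have h3 : √(1 + ‖w‖) ≤ 2 * √(1 + ‖z‖) := by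
        rw [show (2:ℝ) = √4 by rw [show (4:ℝ) = 2^2 by norm_num]; simp, ← Real.sqrt_mul (by norm_num)]
        apply Real.sqrt_le_sqrt
        linarith
      refine (hC w).trans ?_
      gcongr
  have hgrad : ∀ z : ℂ, 0 < z.im → ∃ d : ℝ, |d| ≤ 32 * C * √(1 + ‖z‖) ∧
      HasDerivAt (fun s : ℝ => U (z + s)) d 0 := by
    intro z hz
    have hball : ∀ w ∈ Metric.ball z z.im, 0 < w.im := by
      intro w hw
      rw [Metric.mem_ball, dist_eq_norm] at hw
      have := (Complex.abs_im_le_norm (w - z)).trans_lt hw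
      rw [Complex.sub_im, abs_lt] at this
      linarith
    obtain ⟨F, hF, hF2⟩ := HarmonicOnNhd.exists_analyticOnNhd_ball_re_eq (f := U) (z := z)
      (R := z.im) (fun w hw => hUh w (hball w hw))
    have hzm := Metric.mem_ball_self (x := z) hz
    have hd := jl_deriv_bound (F := fun w => - F w) (c := z) hz (hUn z)
      hF.differentiableOn.neg (by
        intro w hw
        have e1 : (F w).re = U w := hF2 hw
        have e2 : (F z).re = U z := hF2 hzm
        simp only [Complex.neg_re, e1, e2]
        linarith [hUn w])
    have hFd := (hF z hzm).differentiableAt.hasDerivAt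
    refine ⟨(deriv F z).re, ?_, ?_⟩
    · have e : deriv (fun w => - F w) z = - deriv F z := by
        exact hFd.fun_neg.deriv
      rw [e, norm_neg] at hd
      refine (Complex.abs_re_le_norm _).trans (hd.trans ?_)
      rw [div_le_iff₀ hz]
      nlinarith [hb z hz]
    · have h1 : HasDerivAt (fun s : ℂ => F (z + s)) (deriv F z) ((0:ℝ) : ℂ) := by
        have := HasDerivAt.comp_const_add (𝕜 := ℂ) z ((0:ℝ) : ℂ) (f := F) (f' := deriv F z)
          (by simpa using hFd)
        exact this
      have h2 := h1.real_of_complex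
      refine h2.congr_of_eventuallyEq ?_
      have : ContinuousAt (fun s : ℝ => z + (s:ℂ)) 0 := by fun_prop
      have hnb : Metric.ball z z.im ∈ 𝓝 (z + ((0:ℝ):ℂ)) := by
        simpa using Metric.ball_mem_nhds z hz
      filter_upwards [this.eventually hnb] with s hs
      exact (hF2 hs).symm
  have hlip : ∀ t : ℝ, ∀ z : ℂ, 0 < z.im →
      U (z + t) - U z ≤ (32 * C * √(1 + |t|) * |t|) * √(1 + ‖z‖) := by
    intro t z hz
    have hder : ∀ x : ℝ, ∃ d : ℝ, |d| ≤ 32 * C * √(1 + ‖z + x‖) ∧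
      HasDerivAt (fun s : ℝ => U (z + s)) d x := by
      intro x
      obtain ⟨d, hd, hd2⟩ := hgrad (z + x) (by simpa using hz)
      refine ⟨d, hd, ?_⟩
      have h3 := HasDerivAt.comp_sub_const (𝕜 := ℝ) x x (f := fun s : ℝ => U (z + x + s)) (f' := d)
        (by simpa using hd2)
      have e : (fun s : ℝ => U (z + s)) = fun s : ℝ => U (z + x + ((s - x : ℝ) : ℂ)) := by
        funext s
        congr 1
        push_cast
        ring
      rw [e]
      exact h3
    choose d hd hd2 using hder
    have := (convex_uIcc 0 t).norm_image_sub_le_of_norm_hasDerivWithin_le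
      (f := fun s : ℝ => U (z + s)) (f' := d) (C := 32 * C * √(1 + |t|) * √(1 + ‖z‖))
      (x := 0) (y := t) (fun x _ => (hd2 x).hasDerivWithinAt) (by
        intro x hx
        refine (hd x).trans ?_
        rw [mul_assoc (32 * C), ← Real.sqrt_mul (by positivity)]
        gcongr
        have : |x| ≤ |t| := by
          have := abs_sub_left_of_mem_uIcc hx
          simpa using this
        have h2 := norm_add_le z (x:ℂ)
        rw [Complex.norm_real, Real.norm_eq_abs] at h2
        nlinarith [abs_nonneg t, norm_nonneg z]) (by simp) (by simp)
    simp only [sub_zero, Complex.ofReal_zero, add_zero, Real.norm_eq_abs] at this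
    refine (le_abs_self _).trans (this.trans (le_of_eq ?_))
    ring
  have hSo : IsOpen {z : ℂ | 0 < z.im} := isOpen_lt continuous_const Complex.continuous_im
  have hle : ∀ t : ℝ, ∀ z : ℂ, 0 < z.im → U (z + t) ≤ U z := by
    intro t z hz
    have := jl_PL (S := {z : ℂ | 0 < z.im}) hSo (fun z hz => hz) (w := fun z => U (z + t) - U z)
      (by fun_prop) ?_ _ (hlip t) ?_ z hz
    · linarith
    · intro w hw
      exact (jl_harm_comp (g := fun w => w + t) (hUh (w + t) (by simpa using hw)) (by fun_prop)).sub
        (hUh w hw)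
    · intro w hw
      have h0 : w.im = 0 := by
        have := Complex.frontier_setOfPred_lt_im 0
        rw [this] at hw
        exact hw
      have h4 : w = (w.re : ℂ) := by apply Complex.ext <;> simp [h0]
      rw [h4, ← Complex.ofReal_add, hU0, hU0]
      simp
  have htr : ∀ z : ℂ, 0 ≤ z.im → U z = U (z.im * Complex.I) := by
    intro z hz
    rcases hz.eq_or_lt with h0 | h0
    · have h4 : z = (z.re : ℂ) := by apply Complex.ext <;> simp [← h0]
      rw [← h0, h4, hU0]
      have := hU0 0
      simpa using this.symm
    · apply le_antisymm
      · have := hle z.re (z.im * Complex.I) (by simpa using h0)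
        rwa [add_comm, Complex.re_add_im] at this
      · have := hle (-z.re) z h0
        have e : z + ((-z.re : ℝ) : ℂ) = z.im * Complex.I := by
          apply Complex.ext <;> simp
        rwa [e] at this
  have hstrip : ∀ Y y : ℝ, 0 < y → y < Y → U (y * Complex.I) = U (Y * Complex.I) / Y * y := by
    intro Y y hy hyY
    have hY : 0 < Y := hy.trans hyY
    set S : Set ℂ := {z : ℂ | 0 < z.im} ∩ {z : ℂ | z.im < Y} with hS
    have hSo2 : IsOpen S := hSo.inter (isOpen_lt Complex.continuous_im continuous_const)
    have hScl : ∀ z ∈ closure S, 0 ≤ z.im ∧ z.im ≤ Y := by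
      intro z hz
      have hcl : IsClosed {z : ℂ | 0 ≤ z.im ∧ z.im ≤ Y} :=
        (isClosed_le continuous_const Complex.continuous_im).inter
        (isClosed_le Complex.continuous_im continuous_const)
      have hsub : S ⊆ {z : ℂ | 0 ≤ z.im ∧ z.im ≤ Y} :=
        fun z (hz : z ∈ S) => ⟨le_of_lt hz.1, le_of_lt hz.2⟩
      exact closure_minimal hsub hcl hz
    have hbd : ∃ B : ℝ, 0 ≤ B ∧ ∀ z ∈ closure S, U z ≤ B := by
      obtain ⟨B, hB⟩ := (isCompact_Icc (a := (0:ℝ)) (b := Y)).exists_bound_of_continuousOn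
        (f := fun y : ℝ => U (y * Complex.I)) (by fun_prop)
      refine ⟨B, (norm_nonneg _).trans (hB 0 ⟨le_rfl, hY.le⟩), fun z hz => ?_⟩
      rw [htr z (hScl z hz).1]
      exact (le_abs_self _).trans (hB _ (hScl z hz))
    obtain ⟨B, hB0, hB⟩ := hbd
    set q := U (Y * Complex.I) / Y with hq
    have hq0 : 0 ≤ q := div_nonneg (hUn _) hY.le
    have himh : ∀ z, HarmonicAt (fun z : ℂ => q * z.im) z := by
      intro z
      have : AnalyticAt ℂ (fun z : ℂ => (-Complex.I * q) * z) z := by fun_prop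
      have := this.harmonicAt_re
      convert this using 2
      simp
    have hfr : ∀ z ∈ frontier S, U z = q * z.im := by
      intro z hz
      rw [hSo2.frontier_eq] at hz
      obtain ⟨h1, h2⟩ := hScl z hz.1
      rw [htr z h1]
      rcases h1.eq_or_lt with h0 | h0
      · rw [← h0]
        have := hU0 0
        simpa using this
      · have : z.im = Y := le_antisymm h2 (not_lt.1 fun h => hz.2 ⟨h0, h⟩)
        rw [this, hq]
        field_simp
    have hmem : (y * Complex.I : ℂ) ∈ S := ⟨by simpa using hy, by simpa using hyY⟩
    have hs1 : ∀ z : ℂ, 1 ≤ √(1 + ‖z‖) := fun z => by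
      rw [Real.one_le_sqrt]; linarith [norm_nonneg z]
    have p1 := jl_PL hSo2 (fun z hz => hz.1) (w := fun z => U z - q * z.im) (by fun_prop)
      (fun z hz => (hUh z hz.1).sub (himh z)) B (by
        intro z hz
        have := hB z (subset_closure hz)
        have h2 : 0 ≤ q * z.im := mul_nonneg hq0 hz.1.le
        nlinarith [hs1 z]) (fun z hz => by rw [hfr z hz]; simp) _ hmem
    have p2 := jl_PL hSo2 (fun z hz => hz.1) (w := fun z => q * z.im - U z) (by fun_prop)
      (fun z hz => (himh z).sub (hUh z hz.1)) (q * Y) (by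
        intro z hz
        have := hUn z
        have h2 : q * z.im ≤ q * Y := mul_le_mul_of_nonneg_left (le_of_lt hz.2) hq0
        have h3 : 0 ≤ q * Y := mul_nonneg hq0 hY.le
        nlinarith [hs1 z]) (fun z hz => by rw [hfr z hz]; simp) _ hmem
    simp at p1 p2
    linarith
  refine ⟨U Complex.I, hUn _, fun z hz => ?_⟩
  rw [htr z hz]
  rcases hz.eq_or_lt with h0 | h0
  · rw [← h0]
    have := hU0 0
    simpa using this
  · rcases lt_trichotomy z.im 1 with h1 | h1 | h1
    · have := hstrip 1 z.im h0 h1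
      simpa using this
    · rw [h1]; simp
    · have := hstrip z.im 1 one_pos h1
      simp at this
      rw [this]
      field_simp


/-- Quantitative escape estimates for one generalized Hénon map. -/
structure JlGood (p : Polynomial ℂ) (δ : ℂ) (R K : ℝ) : Prop where
  R1 : 1 ≤ R
  K0 : 0 ≤ K
  deg : 2 ≤ p.natDegree
  δ0 : δ ≠ 0
  back : ∀ x : ℂ, R ≤ ‖x‖ → (2 + 2 * ‖δ‖) * ‖x‖ ≤ ‖p.eval x‖
  logx : ∀ x y : ℂ, R ≤ ‖x‖ → ‖y‖ ≤ ‖x‖ →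
    |Real.log ‖p.eval x - δ * y‖ - p.natDegree * Real.log ‖x‖ - Real.log ‖p.leadingCoeff‖| ≤ K / ‖x‖
  lead : |Real.log ‖p.leadingCoeff‖| ≤ K
  small : ∀ x y : ℂ, ‖x‖ ≤ R → ‖y‖ ≤ R → Real.posLog ‖p.eval x - δ * y‖ ≤ K
  dR : p.natDegree * Real.log R ≤ K

theorem JlGood.grow {p : Polynomial ℂ} {δ : ℂ} {R K : ℝ} (h : JlGood p δ R K) {x y : ℂ}
    (hx : R ≤ ‖x‖) (hy : ‖y‖ ≤ ‖x‖) : 2 * ‖x‖ ≤ ‖p.eval x - δ * y‖ := by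
  have h1 := h.back x hx
  have h2 := norm_sub_norm_le (p.eval x) (δ * y)
  rw [norm_mul] at h2
  have h3 : ‖δ‖ * ‖y‖ ≤ ‖δ‖ * ‖x‖ := by gcongr
  nlinarith [mul_nonneg (norm_nonneg δ) (norm_nonneg x)]

theorem jl_poly_lead (p : Polynomial ℂ) : ∃ B : ℝ, 0 ≤ B ∧ ∀ x : ℂ, 1 ≤ ‖x‖ →
    ‖p.eval x - p.leadingCoeff * x ^ p.natDegree‖ * ‖x‖ ≤ B * ‖x‖ ^ p.natDegree := by
  refine ⟨∑ i ∈ Finset.range p.natDegree, ‖p.coeff i‖, by positivity, fun x hx => ?_⟩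
  have : p.eval x - p.leadingCoeff * x ^ p.natDegree
      = ∑ i ∈ Finset.range p.natDegree, p.coeff i * x ^ i := by
    rw [Polynomial.eval_eq_sum_range, Finset.sum_range_succ]
    rw [Polynomial.coeff_natDegree]
    ring
  rw [this, Finset.sum_mul]
  refine le_trans (mul_le_mul_of_nonneg_right (norm_sum_le _ _) (norm_nonneg x)) ?_
  rw [Finset.sum_mul]
  refine Finset.sum_le_sum fun i hi => ?_
  rw [norm_mul, norm_pow, mul_assoc, ← pow_succ]
  gcongr
  exact Finset.mem_range.1 hi

theorem jl_good_exists (p : Polynomial ℂ) (δ : ℂ) (hd : 2 ≤ p.natDegree) (hδ : δ ≠ 0) :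
    ∀ᶠ R in (atTop : Filter ℝ), ∀ᶠ K in (atTop : Filter ℝ), JlGood p δ R K := by
  obtain ⟨B, hB0, hB⟩ := jl_poly_lead p
  have hp0 : p ≠ 0 := by rintro rfl; simp at hd
  have hc : 0 < ‖p.leadingCoeff‖ := by simpa using hp0
  set c := ‖p.leadingCoeff‖ with hcdef
  set d := p.natDegree with hddef
  filter_upwards [eventually_ge_atTop 1, eventually_ge_atTop (2 * (B + ‖δ‖) / c),
    eventually_ge_atTop (4 * (1 + ‖δ‖) / c)] with R hR1 hR2 hR3
  obtain ⟨M, hM⟩ := (isCompact_closedBall (0:ℂ) R).exists_bound_of_continuousOn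
    (f := fun x => p.eval x) (by fun_prop)
  filter_upwards [eventually_ge_atTop 0, eventually_ge_atTop (2 * (B + ‖δ‖) / c),
    eventually_ge_atTop |Real.log c|, eventually_ge_atTop (d * Real.log R),
    eventually_ge_atTop (Real.posLog (M + ‖δ‖ * R))] with K hK0 hK1 hK2 hK3 hK4
  have hxd : ∀ x : ℂ, R ≤ ‖x‖ → ‖x‖ * ‖x‖ ≤ ‖x‖ ^ d := by
    intro x hx
    rw [← sq]
    exact pow_le_pow_right₀ (hR1.trans hx) hd
  have hR2' : 2 * (B + ‖δ‖) ≤ R * c := (div_le_iff₀ hc).1 hR2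
  have hR3' : 4 * (1 + ‖δ‖) ≤ R * c := (div_le_iff₀ hc).1 hR3
  have hmain : ∀ x y : ℂ, R ≤ ‖x‖ → ‖y‖ ≤ ‖x‖ →
      ‖p.eval x - δ * y - p.leadingCoeff * x ^ d‖ * ‖x‖ ≤ (B + ‖δ‖) * ‖x‖ ^ d := by
    intro x y hx hy
    have h1 := hB x (hR1.trans hx)
    have : p.eval x - δ * y - p.leadingCoeff * x ^ d =
      (p.eval x - p.leadingCoeff * x ^ d) - δ * y := by ring
    rw [this]
    have h2 := norm_sub_le (p.eval x - p.leadingCoeff * x ^ d) (δ * y)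
    rw [norm_mul] at h2
    have h3 : ‖δ‖ * ‖y‖ * ‖x‖ ≤ ‖δ‖ * (‖x‖ ^ d) := by
      rw [mul_assoc]
      gcongr
      refine le_trans ?_ (hxd x hx)
      gcongr
    have h4 := mul_le_mul_of_nonneg_right h2 (norm_nonneg x)
    nlinarith
  refine ⟨hR1, hK0, hd, hδ, ?_, ?_, hK2, ?_, hK3⟩
  · intro x hx
    have hx0 : 0 < ‖x‖ := by linarith
    have h1 := hmain x 0 hx (by simp)
    simp only [mul_zero, sub_zero] at h1
    have h2 := norm_sub_norm_le (p.leadingCoeff * x ^ d) (p.eval x)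
    rw [norm_sub_rev, norm_mul, norm_pow, ← hcdef] at h2
    have h5 : (B + ‖δ‖) * ‖x‖ ^ d ≤ (c / 2 * ‖x‖ ^ d) * ‖x‖ := by
      have : (B + ‖δ‖) ≤ c / 2 * ‖x‖ := by nlinarith
      calc _ ≤ (c / 2 * ‖x‖) * ‖x‖ ^ d := by gcongr
        _ = _ := by ring
    have h6 := le_of_mul_le_mul_right (h1.trans h5) hx0
    have h7 := hxd x hx
    have h8 : c / 2 * (‖x‖ * ‖x‖) ≤ c / 2 * ‖x‖ ^ d := by gcongr
    have h9 : (2 + 2 * ‖δ‖) ≤ c / 2 * ‖x‖ := by nlinarith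
    have h10 := mul_le_mul_of_nonneg_right h9 hx0.le
    linarith
  · intro x y hx hy
    have hx0 : 0 < ‖x‖ := by linarith
    have h1 := hmain x y hx hy
    set z := p.eval x - δ * y with hz
    have hxne : x ≠ 0 := norm_pos_iff.1 hx0
    have hl0 : p.leadingCoeff ≠ 0 := by simpa using hp0
    set q := p.leadingCoeff * x ^ d with hq
    have hqn : ‖q‖ = c * ‖x‖ ^ d := by rw [hq, norm_mul, norm_pow]
    have hq0 : 0 < ‖q‖ := by rw [hqn]; positivity
    set t := ‖z‖ / ‖q‖ with ht
    have ht1 : |t - 1| ≤ (B + ‖δ‖) / c / ‖x‖ := by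
      have e : t - 1 = (‖z‖ - ‖q‖) / ‖q‖ := by rw [ht]; field_simp
      rw [e, abs_div, abs_of_pos hq0, div_le_iff₀ hq0]
      refine (abs_norm_sub_norm_le z q).trans ?_
      rw [hqn]
      rw [show (B + ‖δ‖) / c / ‖x‖ * (c * ‖x‖ ^ d) = (B + ‖δ‖) * ‖x‖ ^ d / ‖x‖ by field_simp]
      rw [le_div_iff₀ hx0]
      exact h1
    have ht2 : (B + ‖δ‖) / c / ‖x‖ ≤ 1/2 := by
      rw [div_div, div_le_iff₀ (by positivity)]
      nlinarith
    have ht3 := abs_le.1 (ht1.trans ht2)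
    have ht0 : 0 < t := by linarith [ht3.1]
    have hz0 : ‖z‖ = t * ‖q‖ := by rw [ht]; field_simp
    have e : Real.log ‖z‖ - d * Real.log ‖x‖ - Real.log c = Real.log t := by
      rw [hz0, Real.log_mul ht0.ne' hq0.ne', hqn, Real.log_mul hc.ne' (by positivity), Real.log_pow]
      ring
    rw [e]
    have hlog : |Real.log t| ≤ 2 * |t - 1| := by
      rw [abs_le]
      have a1 := Real.log_le_sub_one_of_pos ht0
      have a2 := Real.one_sub_inv_le_log_of_pos ht0
      have a3 : -(2 * |t - 1|) ≤ 1 - t⁻¹ := by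
        have : 1 - t⁻¹ = (t - 1) / t := by field_simp
        rw [this, le_div_iff₀ ht0]
        have := neg_abs_le (t - 1)
        nlinarith [abs_nonneg (t-1)]
      constructor
      · linarith
      · linarith [le_abs_self (t-1), abs_nonneg (t-1)]
    refine hlog.trans ?_
    calc 2 * |t - 1| ≤ 2 * ((B + ‖δ‖) / c / ‖x‖) := by gcongr
      _ = (2 * (B + ‖δ‖) / c) / ‖x‖ := by ring
      _ ≤ K / ‖x‖ := by gcongr
  · intro x y hx hy
    refine le_trans ?_ hK4
    have h1 := hM x (by simpa using hx)
    apply Real.posLog_le_posLog (by simp)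
    refine (norm_sub_le _ _).trans ?_
    rw [norm_mul]
    gcongr


/-- Scalar orbits of a sequence of Hénon maps, lying in the forward invariant region. -/
structure JlOrb (p : ℕ → Polynomial ℂ) (δ : ℕ → ℂ) (R : ℝ) (s : ℕ → ℂ) : Prop where
  orb : ∀ n, s (n + 2) = (p n).eval (s (n + 1)) - δ n * s n
  W : ‖s 0‖ ≤ max ‖s 1‖ R

/-- Product of degrees. -/
def jl_D (p : ℕ → Polynomial ℂ) (n : ℕ) : ℝ := ∏ i ∈ Finset.range n, ((p i).natDegree : ℝ)

/-- Green function approximations. -/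
def jl_g (p : ℕ → Polynomial ℂ) (n : ℕ) (s : ℕ → ℂ) : ℝ := Real.posLog ‖s (n + 1)‖ / jl_D p n

/-- Green function. -/
def jl_G (p : ℕ → Polynomial ℂ) (s : ℕ → ℂ) : ℝ := limUnder atTop (fun n => jl_g p n s)

theorem jl_D_succ (p : ℕ → Polynomial ℂ) (n : ℕ) :
    jl_D p (n + 1) = jl_D p n * (p n).natDegree := Finset.prod_range_succ _ _

theorem jl_D_zero (p : ℕ → Polynomial ℂ) : jl_D p 0 = 1 := rfl

theorem jl_D_add (p : ℕ → Polynomial ℂ) (n m : ℕ) :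
    jl_D p (n + m) = jl_D p n * jl_D (fun i => p (n + i)) m := Finset.prod_range_add _ _ _

section
variable {p : ℕ → Polynomial ℂ} {δ : ℕ → ℂ} {R K : ℝ}

theorem jl_D_ge (hG : ∀ n, JlGood (p n) (δ n) R K) (n : ℕ) : (2:ℝ) ^ n ≤ jl_D p n := by
  induction n with
  | zero => simp [jl_D_zero]
  | succ n ih =>
    rw [jl_D_succ, pow_succ]
    have : (2:ℝ) ≤ (p n).natDegree := by exact_mod_cast (hG n).deg
    have h0 : 0 ≤ jl_D p n := le_trans (by positivity) ih
    gcongr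

theorem jl_D_pos (hG : ∀ n, JlGood (p n) (δ n) R K) (n : ℕ) : 0 < jl_D p n :=
  lt_of_lt_of_le (by positivity) (jl_D_ge hG n)

theorem JlOrb.W_succ (hG : ∀ n, JlGood (p n) (δ n) R K) {s : ℕ → ℂ} (h : JlOrb p δ R s) (n : ℕ) :
    ‖s n‖ ≤ max ‖s (n + 1)‖ R := by
  induction n with
  | zero => exact h.W
  | succ n ih =>
    rcases le_total R ‖s (n + 1)‖ with h1 | h1
    · rw [max_eq_left h1] at ih
      have := (hG n).grow h1 ih
      rw [← h.orb n] at this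
      refine le_max_of_le_left ?_
      linarith [norm_nonneg (s (n+1))]
    · exact le_max_of_le_right h1

theorem JlOrb.shift (hG : ∀ n, JlGood (p n) (δ n) R K) {s : ℕ → ℂ} (h : JlOrb p δ R s) (n : ℕ) :
    JlOrb (fun i => p (n + i)) (fun i => δ (n + i)) R (fun i => s (n + i)) :=
  ⟨fun m => h.orb (n + m), h.W_succ hG n⟩

theorem JlOrb.grow (hG : ∀ n, JlGood (p n) (δ n) R K) {s : ℕ → ℂ} (h : JlOrb p δ R s) {n : ℕ}
    (hn : R ≤ ‖s (n + 1)‖) : 2 * ‖s (n + 1)‖ ≤ ‖s (n + 2)‖ := by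
  have h1 := h.W_succ hG n
  rw [max_eq_left hn] at h1
  rw [h.orb n]
  exact (hG n).grow hn h1

theorem JlOrb.grow_pow (hG : ∀ n, JlGood (p n) (δ n) R K) {s : ℕ → ℂ} (h : JlOrb p δ R s) {n : ℕ}
    (hn : R ≤ ‖s (n + 1)‖) (m : ℕ) : 2 ^ m * ‖s (n + 1)‖ ≤ ‖s (n + m + 1)‖ := by
  induction m with
  | zero => simp
  | succ m ih =>
    have h1 : R ≤ ‖s (n + m + 1)‖ := by
      refine le_trans (hn.trans ?_) ih
      exact le_mul_of_one_le_left (norm_nonneg _) (one_le_pow₀ (by norm_num))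
    have := h.grow hG h1
    rw [pow_succ]
    have e : n + (m + 1) + 1 = n + m + 2 := by ring
    rw [e]
    linarith

theorem JlOrb.step (hG : ∀ n, JlGood (p n) (δ n) R K) {s : ℕ → ℂ} (h : JlOrb p δ R s) (n : ℕ) :
    |Real.posLog ‖s (n + 2)‖ - (p n).natDegree * Real.posLog ‖s (n + 1)‖| ≤ 2 * K := by
  have hK := (hG n).K0
  have hR := (hG n).R1
  have hW := h.W_succ hG n
  rcases le_total R ‖s (n + 1)‖ with h1 | h1
  · have hg := h.grow hG h1
    rw [Real.posLog_eq_log (by rw [abs_of_nonneg (norm_nonneg _)]; linarith),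
      Real.posLog_eq_log (by rw [abs_of_nonneg (norm_nonneg _)]; linarith)]
    rw [max_eq_left h1] at hW
    have h2 := (hG n).logx _ _ h1 hW
    rw [← h.orb n] at h2
    have h3 := (hG n).lead
    have h4 : K / ‖s (n+1)‖ ≤ K := div_le_self hK (hR.trans h1)
    rw [abs_le] at h2 h3 ⊢
    constructor <;> linarith
  · rw [max_eq_right h1] at hW
    have h2 := (hG n).small _ _ h1 hW
    rw [← h.orb n] at h2
    have h3 : (p n).natDegree * Real.posLog ‖s (n + 1)‖ ≤ K := by
      refine le_trans ?_ (hG n).dR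
      gcongr
      rw [← Real.posLog_eq_log (x := R) (by rw [abs_of_nonneg (by linarith)]; linarith)]
      exact Real.posLog_le_posLog (by simp) h1
    have h4 := Real.posLog_nonneg (x := ‖s (n+2)‖)
    have h5 : 0 ≤ (p n).natDegree * Real.posLog ‖s (n + 1)‖ :=
      mul_nonneg (by positivity) Real.posLog_nonneg
    rw [abs_le]
    constructor <;> linarith

theorem JlOrb.g_dist (hG : ∀ n, JlGood (p n) (δ n) R K) {s : ℕ → ℂ} (h : JlOrb p δ R s) (n : ℕ) :
    dist (jl_g p n s) (jl_g p (n + 1) s) ≤ (2 * K) / 2 / 2 ^ n := by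
  have hK := (hG n).K0
  have hD := jl_D_pos hG n
  have hD1 := jl_D_pos hG (n+1)
  have hd : (0:ℝ) < (p n).natDegree := by
    have := (hG n).deg
    exact_mod_cast (by omega : 0 < (p n).natDegree)
  have e : jl_g p (n+1) s - jl_g p n s =
    (Real.posLog ‖s (n + 2)‖ - (p n).natDegree * Real.posLog ‖s (n + 1)‖) / jl_D p (n+1) := by
    simp only [jl_g]
    rw [jl_D_succ]
    field_simp
  rw [dist_comm, Real.dist_eq, e, abs_div, abs_of_pos hD1]
  have h2 := jl_D_ge hG (n+1)
  calc _ ≤ 2 * K / 2 ^ (n+1) := by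
        gcongr
        exact h.step hG n
    _ = _ := by rw [pow_succ]; field_simp

theorem JlOrb.tendsto (hG : ∀ n, JlGood (p n) (δ n) R K) {s : ℕ → ℂ} (h : JlOrb p δ R s) :
    Tendsto (fun n => jl_g p n s) atTop (𝓝 (jl_G p s)) :=
  (cauchySeq_of_le_geometric_two (h.g_dist hG)).tendsto_limUnder

theorem JlOrb.G_dist (hG : ∀ n, JlGood (p n) (δ n) R K) {s : ℕ → ℂ} (h : JlOrb p δ R s) (n : ℕ) :
    |jl_g p n s - jl_G p s| ≤ 2 * K / 2 ^ n :=
  dist_le_of_le_geometric_two_of_tendsto (h.g_dist hG) (h.tendsto hG) n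

theorem JlOrb.G_dist0 (hG : ∀ n, JlGood (p n) (δ n) R K) {s : ℕ → ℂ} (h : JlOrb p δ R s) :
    |Real.posLog ‖s 1‖ - jl_G p s| ≤ 2 * K := by
  have := h.G_dist hG 0
  simpa [jl_g, jl_D_zero] using this

theorem JlOrb.G_nonneg (hG : ∀ n, JlGood (p n) (δ n) R K) {s : ℕ → ℂ} (h : JlOrb p δ R s) :
    0 ≤ jl_G p s :=
  ge_of_tendsto' (h.tendsto hG) fun n => div_nonneg Real.posLog_nonneg (jl_D_pos hG n).le

theorem JlOrb.G_shift (hG : ∀ n, JlGood (p n) (δ n) R K) {s : ℕ → ℂ} (h : JlOrb p δ R s) (n : ℕ) :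
    jl_G (fun i => p (n + i)) (fun i => s (n + i)) = jl_D p n * jl_G p s := by
  have h1 := (h.shift hG n).tendsto (K := K) (fun i => hG (n + i))
  have h2 : Tendsto (fun m => jl_D p n * jl_g p (n + m) s) atTop (𝓝 (jl_D p n * jl_G p s)) := by
    refine Tendsto.const_mul _ ?_
    have := (h.tendsto hG).comp (tendsto_add_atTop_nat n)
    refine this.congr fun m => ?_
    simp [add_comm]
  refine tendsto_nhds_unique h1 (h2.congr fun m => ?_)
  have hD := (jl_D_pos hG n).ne'
  have hD2 := (jl_D_pos hG (n+m)).ne'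
  simp only [jl_g]
  rw [jl_D_add] at hD2 ⊢
  have := right_ne_zero_of_mul hD2
  field_simp
  rfl

theorem JlOrb.norm_le (hG : ∀ n, JlGood (p n) (δ n) R K) {s : ℕ → ℂ} (h : JlOrb p δ R s) :
    ‖s 1‖ ≤ Real.exp (jl_G p s + 2 * K) := by
  have h1 := (abs_le.1 (h.G_dist0 hG)).2
  have h2 : Real.log ‖s 1‖ ≤ Real.posLog ‖s 1‖ := le_max_right _ _
  rcases (norm_nonneg (s 1)).eq_or_lt with h0 | h0
  · rw [← h0]; positivity
  · rw [← Real.log_le_iff_le_exp h0]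
    linarith

theorem JlOrb.G_pos (hG : ∀ n, JlGood (p n) (δ n) R K) {s : ℕ → ℂ} (h : JlOrb p δ R s) {n : ℕ}
    (hn : R < ‖s n‖) : 0 < jl_G p s := by
  have hR := (hG 0).R1
  have hn1 : R ≤ ‖s (n + 1)‖ := by
    have := h.W_succ hG n
    rcases le_max_iff.1 this with h1 | h1 <;> linarith
  by_contra hcon
  have h0 : jl_G p s = 0 := le_antisymm (not_lt.1 hcon) (h.G_nonneg hG)
  obtain ⟨m, hm⟩ := pow_unbounded_of_one_lt (Real.exp (2 * K)) (show (1:ℝ) < 2 by norm_num)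
  have h1 := (h.shift hG (n + m)).norm_le (K := K) (fun i => hG _)
  rw [h.G_shift hG, h0] at h1
  have h2 := h.grow_pow hG hn1 m
  have h3 : (2:ℝ)^m ≤ 2^m * ‖s (n+1)‖ := le_mul_of_one_le_right (by positivity) (hR.trans hn1)
  simp only [mul_zero, zero_add] at h1
  linarith

theorem JlOrb.G_zero (hG : ∀ n, JlGood (p n) (δ n) R K) {s : ℕ → ℂ} (h : JlOrb p δ R s)
    (hb : ∀ n, ‖s n‖ ≤ R) : jl_G p s = 0 := by
  have hR := (hG 0).R1
  refine le_antisymm ?_ (h.G_nonneg hG)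
  refine le_of_tendsto_of_tendsto (h.tendsto hG) (g := fun n : ℕ => Real.log R / 2 ^ n) ?_ ?_
  · have := (tendsto_pow_atTop_nhds_zero_of_lt_one (r := (1/2 : ℝ)) (by norm_num) (by norm_num)).const_mul (Real.log R)
    simp only [mul_zero] at this
    refine this.congr fun n => ?_
    rw [div_pow, one_pow]
    ring
  · refine Eventually.of_forall fun n => ?_
    simp only [jl_g]
    have h1 := jl_D_ge hG n
    have h2 : Real.posLog ‖s (n+1)‖ ≤ Real.log R := by
      rw [← Real.posLog_eq_log (x := R) (by rw [abs_of_nonneg (by linarith)]; linarith)]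
      exact Real.posLog_le_posLog (by simp) (hb _)
    have h3 : 0 ≤ Real.log R := Real.log_nonneg hR
    gcongr

theorem JlOrb.G_lim (hG : ∀ n, JlGood (p n) (δ n) R K) {ι : Type*} {l : Filter ι} {S : ι → ℕ → ℂ}
    {s : ℕ → ℂ} (hS : ∀ᶠ i in l, JlOrb p δ R (S i)) (hs : JlOrb p δ R s)
    (ht : ∀ n, Tendsto (fun i => S i n) l (𝓝 (s n))) :
    Tendsto (fun i => jl_G p (S i)) l (𝓝 (jl_G p s)) := by
  have hK := (hG 0).K0
  rw [Metric.tendsto_nhds]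
  intro ε hε
  obtain ⟨n, hn⟩ := pow_unbounded_of_one_lt (2 * K * 3 / ε) (show (1:ℝ) < 2 by norm_num)
  have hn' : 2 * K / 2^n < ε / 3 := by
    rw [div_lt_iff₀ hε] at hn
    rw [div_lt_iff₀ (by positivity)]
    linarith
  have hc : Tendsto (fun i => jl_g p n (S i)) l (𝓝 (jl_g p n s)) := by
    have : Continuous (fun z : ℂ => Real.posLog ‖z‖ / jl_D p n) := by fun_prop
    exact (this.tendsto _).comp (ht (n+1))
  filter_upwards [hS, Metric.tendsto_nhds.1 hc (ε/3) (by positivity)] with i h1 h2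
  have a1 := abs_le.1 (h1.G_dist hG n)
  have a2 := abs_le.1 (hs.G_dist hG n)
  rw [Real.dist_eq, abs_lt] at h2 ⊢
  constructor <;> linarith [a1.1, a1.2, a2.1, a2.2, h2.1, h2.2]

theorem jl_kappa (hG : ∀ n, JlGood (p n) (δ n) R K) : ∃ κ : ℝ, ∀ s, JlOrb p δ R s → R ≤ ‖s 1‖ →
    |Real.log ‖s 1‖ - (jl_G p s - κ)| ≤ K / ‖s 1‖ := by
  have hK := (hG 0).K0
  have hR := (hG 0).R1
  set k : ℕ → ℝ := fun m => ∑ i ∈ Finset.range m, Real.log ‖(p i).leadingCoeff‖ / jl_D p (i+1)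
    with hk
  have hks : ∀ m, k (m+1) = k m + Real.log ‖(p m).leadingCoeff‖ / jl_D p (m+1) := fun m =>
    Finset.sum_range_succ _ _
  have hkc : CauchySeq k := by
    apply cauchySeq_of_le_geometric_two (C := K)
    intro n
    rw [hks, dist_comm, Real.dist_eq, add_sub_cancel_left, abs_div, abs_of_pos (jl_D_pos hG (n+1))]
    have h2 := jl_D_ge hG (n+1)
    calc _ ≤ K / 2 ^ (n+1) := by
          gcongr
          exact (hG n).lead
      _ = _ := by rw [pow_succ]; field_simp
  obtain ⟨κ, hκ⟩ := cauchySeq_tendsto_of_complete hkc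
  refine ⟨κ, fun s hs h1 => ?_⟩
  have hg : ∀ m, 2 ^ m * ‖s 1‖ ≤ ‖s (m + 1)‖ := by
    intro m
    have := hs.grow_pow hG (n := 0) (by simpa using h1) m
    simpa using this
  have hg1 : ∀ m, ‖s 1‖ ≤ ‖s (m + 1)‖ := fun m =>
    (le_mul_of_one_le_left (norm_nonneg _) (one_le_pow₀ (by norm_num))).trans (hg m)
  have hpos : 0 < ‖s 1‖ := by linarith
  have hlim : Tendsto (fun m => jl_g p m s - k m) atTop (𝓝 (jl_G p s - κ)) :=
    (hs.tendsto hG).sub hκ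
  have hst : ∀ m, dist (jl_g p m s - k m) (jl_g p (m+1) s - k (m+1)) ≤ (K / ‖s 1‖) / 2 / 2 ^ m := by
    intro m
    have hD := jl_D_pos hG m
    have hD1 := jl_D_pos hG (m+1)
    have hd : (0:ℝ) < (p m).natDegree := by
      have := (hG m).deg
      exact_mod_cast (by omega : 0 < (p m).natDegree)
    have hp : ∀ j, Real.posLog ‖s (j+1)‖ = Real.log ‖s (j+1)‖ := fun j =>
      Real.posLog_eq_log (by rw [abs_of_nonneg (norm_nonneg _)]; linarith [hg1 j])
    have e : (jl_g p (m+1) s - k (m+1)) - (jl_g p m s - k m) =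
      (Real.log ‖s (m + 2)‖ - (p m).natDegree * Real.log ‖s (m + 1)‖
        - Real.log ‖(p m).leadingCoeff‖) / jl_D p (m+1) := by
      rw [hks]
      simp only [jl_g, hp]
      rw [jl_D_succ]
      field_simp
      ring_nf
    rw [dist_comm, Real.dist_eq, e, abs_div, abs_of_pos hD1]
    have hW := hs.W_succ hG m
    rw [max_eq_left (h1.trans (hg1 m))] at hW
    have h2 := (hG m).logx _ _ (h1.trans (hg1 m)) hW
    rw [← hs.orb m] at h2
    have h3 := jl_D_ge hG (m+1)
    calc _ ≤ (K / ‖s 1‖) / 2 ^ (m+1) := by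
          gcongr
          refine h2.trans ?_
          gcongr
          exact hg1 m
      _ = _ := by rw [pow_succ]; field_simp
  have := dist_le_of_le_geometric_two_of_tendsto₀ hst hlim
  rw [Real.dist_eq] at this
  have e0 : jl_g p 0 s - k 0 = Real.log ‖s 1‖ := by
    simp [jl_g, jl_D_zero, hk]
    exact Real.posLog_eq_log (by rw [abs_of_nonneg (norm_nonneg _)]; linarith)
  rwa [e0] at this

theorem jl_G_harm (hG : ∀ n, JlGood (p n) (δ n) R K) {S : ℕ → ℂ → ℂ} {z0 : ℂ} {r : ℝ} (hr : 0 < r)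
    (hS : ∀ n, DifferentiableOn ℂ (S n) (Metric.ball z0 r))
    (hO : ∀ z ∈ Metric.ball z0 r, JlOrb p δ R (fun n => S n z)) {m : ℕ} (hm : R < ‖S m z0‖) :
    HarmonicAt (fun z => jl_G p (fun n => S n z)) z0 := by
  have hR := (hG 0).R1
  have hz0 := Metric.mem_ball_self (x := z0) hr
  have hcont : ∀ n, ContinuousAt (S n) z0 := fun n =>
    ((hS n).differentiableAt (Metric.ball_mem_nhds z0 hr)).continuousAt
  have e1 : ∀ᶠ z in 𝓝 z0, R < ‖S m z‖ := (hcont m).norm.eventually_const_lt hm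
  have e2 : ∀ᶠ z in 𝓝 z0, ‖S 1 z‖ < ‖S 1 z0‖ + 1 :=
    (hcont 1).norm.eventually_lt_const (by linarith)
  obtain ⟨r', hr', hb⟩ := Metric.eventually_nhds_iff_ball.1
    (e1.and (e2.and (Metric.ball_mem_nhds z0 hr)))
  have hbig : ∀ z ∈ Metric.ball z0 r', ∀ n, m ≤ n → R ≤ ‖S (n+1) z‖ := by
    intro z hz n hn
    obtain ⟨h1, h2, h3⟩ := hb z hz
    have hO' := hO z h3
    have hm1 : R ≤ ‖S (m + 1) z‖ := by
      have := hO'.W_succ hG m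
      rcases le_max_iff.1 this with h1 | h1 <;> linarith
    have := hO'.grow_pow hG hm1 (n - m)
    rw [show m + (n - m) + 1 = n + 1 by omega] at this
    refine le_trans (hm1.trans ?_) this
    exact le_mul_of_one_le_left (norm_nonneg _) (one_le_pow₀ (by norm_num))
  refine jl_harm_lim (hyperfilter ℕ) (fun n z => jl_g p n (fun n => S n z)) _ z0 r'
    (Real.posLog (‖S 1 z0‖ + 1) + 2 * K + 2 * K) hr' ?_ ?_
  · have : ∀ᶠ n in atTop, m ≤ n := eventually_ge_atTop m
    have hle : ((hyperfilter ℕ : Ultrafilter ℕ) : Filter ℕ) ≤ atTop := Nat.hyperfilter_le_atTop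
    filter_upwards [hle this] with n hn
    have hK := (hG 0).K0
    constructor
    · intro z hz
      have hzr := (hb z hz).2.2
      have h1 : AnalyticAt ℂ (S (n+1)) z := (hS (n+1)).analyticAt (Metric.isOpen_ball.mem_nhds hzr)
      have h2 : S (n+1) z ≠ 0 := by
        rw [← norm_pos_iff]
        linarith [hbig z hz n hn]
      have h3 := (h1.harmonicAt_log_norm h2).const_smul (c := (jl_D p n)⁻¹)
      refine (harmonicAt_congr_nhds ?_).1 h3
      filter_upwards [Metric.isOpen_ball.mem_nhds hz] with w hw
      have := hbig w hw n hn
      simp only [jl_g]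
      rw [Real.posLog_eq_log (by rw [abs_of_nonneg (norm_nonneg _)]; linarith)]
      simp [div_eq_inv_mul]
    · intro z hz
      obtain ⟨h1, h2, h3⟩ := hb z hz
      have a1 := abs_le.1 ((hO z h3).G_dist hG n)
      have a2 := abs_le.1 ((hO z h3).G_dist0 hG)
      have a3 := (hO z h3).G_nonneg hG
      have a4 : 0 ≤ jl_g p n (fun n => S n z) := div_nonneg Real.posLog_nonneg (jl_D_pos hG n).le
      rw [abs_of_nonneg a4]
      have a5 : Real.posLog ‖S 1 z‖ ≤ Real.posLog (‖S 1 z0‖ + 1) :=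
        Real.posLog_le_posLog (by simp) h2.le
      have a6 : 2 * K / 2 ^ n ≤ 2 * K := div_le_self (by positivity) (one_le_pow₀ (by norm_num))
      linarith [a1.2, a2.1]
  · intro z hz
    exact ((hO z (hb z hz).2.2).tendsto hG).mono_left Nat.hyperfilter_le_atTop

end


theorem jl_asymp {p : ℕ → Polynomial ℂ} {δ : ℕ → ℂ} {R K : ℝ}
    (hG : ∀ n, JlGood (p n) (δ n) R K) {X : ℕ → ℂ → ℂ} (hX : ∀ n, Differentiable ℂ (X n))
    (hO : ∀ z, JlOrb p δ R (fun n => X n z)) {a : ℝ} (ha : 0 ≤ a)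
    (hU : ∀ z : ℂ, 0 ≤ z.im → jl_G p (fun n => X n z) = a * z.im) :
    ∃ (A : ℂ) (B : ℝ), (0 < a → A ≠ 0) ∧ ∀ z : ℂ, 0 ≤ z.im →
      ‖X 1 z - A * Complex.exp (-(Complex.I * a * z))‖ ≤ B := by
  have hK := (hG 0).K0
  have hR := (hG 0).R1
  have hnorm : ∀ z : ℂ, 0 ≤ z.im → ‖X 1 z‖ ≤ Real.exp (a * z.im + 2 * K) := by
    intro z hz
    have := (hO z).norm_le hG
    rwa [hU z hz] at this
  rcases ha.eq_or_lt with h0 | h0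
  · refine ⟨0, Real.exp (2 * K), fun h => absurd h0 h.ne, fun z hz => ?_⟩
    have := hnorm z hz
    rw [← h0] at this
    simpa using this
  obtain ⟨κ, hκ⟩ := jl_kappa hG
  set Q : ℂ → ℂ := fun z => X 1 z * Complex.exp (Complex.I * a * z) with hQ
  have hQd : Differentiable ℂ Q := (hX 1).mul (by fun_prop)
  have hen : ∀ z : ℂ, ‖Complex.exp (Complex.I * a * z)‖ = Real.exp (-(a * z.im)) := by
    intro z
    rw [Complex.norm_exp]
    congr 1
    simp
  have hen2 : ∀ z : ℂ, ‖Complex.exp (-(Complex.I * a * z))‖ = Real.exp (a * z.im) := by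
    intro z
    rw [Complex.norm_exp]
    congr 1
    simp
  set C := K * Real.exp (2 * K) with hC
  have hC0 : 0 ≤ C := by positivity
  obtain ⟨T', hT'0, hT'⟩ : ∃ T' : ℝ, 0 ≤ T' ∧ ∀ z : ℂ, T' ≤ z.im → X 1 z ≠ 0 ∧
      |Real.log ‖Q z‖ + κ| ≤ C * Real.exp (-(a * z.im)) := by
    refine ⟨(2 * K + Real.log R + 1) / a, ?_, ?_⟩
    · have := Real.log_nonneg hR
      positivity
    intro z hz
    rw [div_le_iff₀ h0] at hz
    have hlR := Real.log_nonneg hR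
    have hz0 : 0 ≤ z.im := by
      by_contra h
      push Not at h
      nlinarith
    have h1 := abs_le.1 ((hO z).G_dist0 hG)
    rw [hU z hz0] at h1
    have h2 : 0 < Real.posLog ‖X 1 z‖ := by nlinarith [h1.1]
    have h3 : Real.posLog ‖X 1 z‖ = Real.log ‖X 1 z‖ := by
      rw [Real.posLog_apply] at h2 ⊢
      rcases lt_max_iff.1 h2 with h | h
      · exact absurd h (lt_irrefl _)
      · exact max_eq_right h.le
    rw [h3] at h1 h2
    have hXp : 0 < ‖X 1 z‖ := by
      by_contra h
      have : ‖X 1 z‖ = 0 := le_antisymm (not_lt.1 h) (norm_nonneg _)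
      rw [this] at h2
      simp at h2
    have hXR : R ≤ ‖X 1 z‖ := by
      rw [← Real.log_le_log_iff (by linarith) hXp]
      nlinarith [h1.1]
    refine ⟨norm_pos_iff.1 hXp, ?_⟩
    have h4 := hκ _ (hO z) hXR
    rw [hU z hz0] at h4
    have h5 : Real.log ‖Q z‖ = Real.log ‖X 1 z‖ - a * z.im := by
      rw [hQ]
      simp only [norm_mul, hen]
      rw [Real.log_mul hXp.ne' (Real.exp_pos _).ne', Real.log_exp]
      ring
    rw [h5]
    have h6 : Real.exp (a * z.im - 2 * K) ≤ ‖X 1 z‖ := by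
      rw [← Real.le_log_iff_exp_le hXp]
      linarith [h1.1]
    have h7 : K / ‖X 1 z‖ ≤ C * Real.exp (-(a * z.im)) := by
      calc K / ‖X 1 z‖ ≤ K / Real.exp (a * z.im - 2 * K) := by gcongr
        _ = C * Real.exp (-(a * z.im)) := by
          rw [hC, div_eq_mul_inv, ← Real.exp_neg, mul_assoc, ← Real.exp_add]
          ring_nf
    refine le_trans (le_of_eq ?_) (h4.trans h7)
    congr 1
    ring
  set T := T' + 1 with hT
  have hQpos : ∀ z : ℂ, T' ≤ z.im → 0 < ‖Q z‖ := by
    intro z hz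
    rw [norm_pos_iff]
    exact mul_ne_zero (hT' z hz).1 (Complex.exp_ne_zero _)
  have hQb : ∀ z : ℂ, T' ≤ z.im → Real.exp (-κ - C) ≤ ‖Q z‖ ∧ ‖Q z‖ ≤ Real.exp (-κ + C) := by
    intro z hz
    have h1 := abs_le.1 (hT' z hz).2
    have h2 : C * Real.exp (-(a * z.im)) ≤ C := by
      apply mul_le_of_le_one_right hC0
      rw [Real.exp_le_one_iff]
      have : 0 ≤ a * z.im := mul_nonneg ha (hT'0.trans hz)
      linarith
    rw [← Real.le_log_iff_exp_le (hQpos z hz), ← Real.log_le_iff_le_exp (hQpos z hz)]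
    constructor <;> linarith [h1.1, h1.2]
  set ε0 := 2 * C * Real.exp a with hε0
  set C2 := 4 * (ε0 * Real.exp ε0) * Real.exp (-κ + C) with hC2
  have hder : ∀ z : ℂ, T ≤ z.im → ‖deriv Q z‖ ≤ C2 * Real.exp (-(a * z.im)) := by
    intro z hz
    have hzT : T' ≤ z.im := by linarith
    have hq := hQpos z hzT
    set ε := ε0 * Real.exp (-(a * z.im)) with hε
    have hε00 : 0 ≤ ε0 := by positivity
    have hε1 : 0 ≤ ε := by positivity
    have hεle : ε ≤ ε0 := by
      apply mul_le_of_le_one_right hε00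
      rw [Real.exp_le_one_iff]
      have : 0 ≤ a * z.im := mul_nonneg ha (by linarith)
      linarith
    have hd := jl_deriv_bound (F := fun w => Q w / Q z) (c := z) (r := 1) (M := ε * Real.exp ε0)
      one_pos (by positivity) (hQd.div_const _).differentiableOn (by
        intro w hw
        rw [Metric.mem_ball, dist_eq_norm] at hw
        have h1 := (Complex.abs_im_le_norm (w - z)).trans_lt hw
        rw [Complex.sub_im, abs_lt] at h1
        have hwT : T' ≤ w.im := by linarith
        have h2 := abs_le.1 (hT' w hwT).2
        have h3 := abs_le.1 (hT' z hzT).2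
        have h4 : C * Real.exp (-(a * w.im)) ≤ ε / 2 := by
          have : Real.exp (-(a * w.im)) ≤ Real.exp a * Real.exp (-(a * z.im)) := by
            rw [← Real.exp_add]
            apply Real.exp_le_exp.2
            nlinarith
          calc _ ≤ C * (Real.exp a * Real.exp (-(a * z.im))) := by gcongr
            _ = ε / 2 := by rw [hε, hε0]; ring
        have h5 : C * Real.exp (-(a * z.im)) ≤ ε / 2 := by
          have : 1 ≤ Real.exp a := by rw [Real.one_le_exp_iff]; exact ha
          have h6 : 0 ≤ C * Real.exp (-(a * z.im)) := by positivity
          have : ε / 2 = C * Real.exp (-(a * z.im)) * Real.exp a := by rw [hε, hε0]; ring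
          rw [this]
          exact le_mul_of_one_le_right h6 (by assumption)
        have h7 : ‖Q w / Q z‖ ≤ Real.exp ε := by
          rw [norm_div, ← Real.log_le_iff_le_exp (div_pos (hQpos w hwT) hq),
            Real.log_div (hQpos w hwT).ne' hq.ne']
          linarith [h2.2, h3.1]
        have h8 : (Q w / Q z).re ≤ Real.exp ε := (Complex.re_le_norm _).trans h7
        have h9 : (Q z / Q z).re = 1 := by rw [div_self (norm_pos_iff.1 hq)]; simp
        rw [h9]
        have h10 : Real.exp ε - 1 ≤ ε * Real.exp ε := by
          have := Real.one_sub_le_exp_neg ε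
          have e : Real.exp (-ε) * Real.exp ε = 1 := by rw [← Real.exp_add]; simp
          nlinarith [Real.exp_pos ε]
        have h11 : ε * Real.exp ε ≤ ε * Real.exp ε0 := by gcongr
        linarith)
    have e : deriv (fun w => Q w / Q z) z = deriv Q z / Q z := by
      exact deriv_div_const _
    rw [e, norm_div, div_one, div_le_iff₀ hq] at hd
    refine hd.trans ?_
    have := (hQb z hzT).2
    calc 4 * (ε * Real.exp ε0) * ‖Q z‖ ≤ 4 * (ε * Real.exp ε0) * Real.exp (-κ + C) := by gcongr
      _ = _ := by rw [hC2, hε]; ring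
  have hC20 : 0 ≤ C2 := by positivity
  have hmv : ∀ Y : ℝ, T ≤ Y → ∀ z w : ℂ, Y ≤ z.im → Y ≤ w.im →
      dist (Q z) (Q w) ≤ C2 * Real.exp (-(a * Y)) * dist z w := by
    intro Y hY z w hz hw
    rw [dist_eq_norm, dist_eq_norm]
    have hconv : Convex ℝ {z : ℂ | Y ≤ z.im} := convex_halfSpace_im_ge Y
    refine hconv.norm_image_sub_le_of_norm_deriv_le (𝕜 := ℂ) (fun x _ => hQd x) ?_ hw hz
    intro x hx
    have hx' : Y ≤ x.im := hx
    refine (hder x (hY.trans hx')).trans ?_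
    gcongr
  have hr1 : Real.exp (-a) < 1 := by rw [Real.exp_lt_one_iff]; linarith
  have hseq : ∀ z : ℂ, T ≤ z.im → ∀ n : ℕ, dist (Q (z + n * Complex.I)) (Q (z + (n+1 : ℕ) * Complex.I))
      ≤ C2 * Real.exp (-(a * z.im)) * Real.exp (-a) ^ n := by
    intro z hz n
    have hn : (0:ℝ) ≤ n := by positivity
    have := hmv (z.im + n) (by linarith) (z + n * Complex.I) (z + (n+1 : ℕ) * Complex.I)
      (by simp) (by simp)
    refine this.trans (le_of_eq ?_)
    have e1 : dist (z + n * Complex.I) (z + (n+1 : ℕ) * Complex.I) = 1 := by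
      rw [dist_eq_norm]
      push_cast
      have : z + n * Complex.I - (z + (n + 1) * Complex.I) = -Complex.I := by ring
      rw [this]; simp
    have e2 : Real.exp (-(a * (z.im + n))) = Real.exp (-(a * z.im)) * Real.exp (-a) ^ n := by
      rw [← Real.exp_nat_mul, ← Real.exp_add]
      ring_nf
    rw [e1, e2]
    ring
  obtain ⟨A, hA⟩ := cauchySeq_tendsto_of_complete
    (cauchySeq_of_le_geometric _ _ hr1 (hseq (T * Complex.I) (by simp)))
  have hA2 : ∀ z : ℂ, T ≤ z.im → Tendsto (fun n : ℕ => Q (z + n * Complex.I)) atTop (𝓝 A) := by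
    intro z hz
    have hdiff : Tendsto (fun n : ℕ => dist (Q (T * Complex.I + n * Complex.I)) (Q (z + n * Complex.I)))
        atTop (𝓝 0) := by
      have hb : Tendsto (fun n : ℕ => C2 * (Real.exp (-(a * T)) * Real.exp (-a) ^ n) * dist ((T:ℂ) * Complex.I) z)
          atTop (𝓝 (C2 * (Real.exp (-(a * T)) * 0) * dist ((T:ℂ) * Complex.I) z)) :=
        (((tendsto_pow_atTop_nhds_zero_of_lt_one (Real.exp_pos _).le hr1).const_mul _).const_mul
          _).mul_const _
      rw [mul_zero, mul_zero, zero_mul] at hb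
      refine squeeze_zero (fun _ => dist_nonneg) (fun n => ?_) hb
      have hn : (0:ℝ) ≤ n := by positivity
      have := hmv (T + n) (by linarith) (T * Complex.I + n * Complex.I) (z + n * Complex.I)
        (by simp) (by simp; linarith)
      refine this.trans (le_of_eq ?_)
      rw [dist_add_right]
      congr 2
      rw [← Real.exp_nat_mul, ← Real.exp_add]
      ring_nf
    exact (tendsto_iff_of_dist hdiff).1 hA
  have hQA : ∀ z : ℂ, T ≤ z.im →
      ‖Q z - A‖ ≤ C2 * Real.exp (-(a * z.im)) / (1 - Real.exp (-a)) := by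
    intro z hz
    have := dist_le_of_le_geometric_of_tendsto₀ _ _ hr1 (hseq z hz) (hA2 z hz)
    rw [dist_eq_norm] at this
    simpa using this
  have hA0 : A ≠ 0 := by
    have h1 : Real.exp (-κ - C) ≤ ‖A‖ := by
      refine ge_of_tendsto' hA.norm fun n => ?_
      refine (hQb _ ?_).1
      have hn : (0:ℝ) ≤ n := by positivity
      simp
      linarith
    rw [← norm_pos_iff]
    exact lt_of_lt_of_le (Real.exp_pos _) h1
  refine ⟨A, max (C2 / (1 - Real.exp (-a))) (Real.exp (a * T + 2 * K) + ‖A‖ * Real.exp (a * T)),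
    fun _ => hA0, fun z hz => ?_⟩
  rcases le_total T z.im with h | h
  · refine le_max_of_le_left ?_
    have e : X 1 z - A * Complex.exp (-(Complex.I * a * z)) =
        (Q z - A) * Complex.exp (-(Complex.I * a * z)) := by
      rw [hQ]
      simp only [sub_mul, mul_assoc]
      rw [← Complex.exp_add]
      simp
    rw [e, norm_mul, hen2]
    have := hQA z h
    calc _ ≤ C2 * Real.exp (-(a * z.im)) / (1 - Real.exp (-a)) * Real.exp (a * z.im) := by gcongr
      _ = C2 / (1 - Real.exp (-a)) * (Real.exp (-(a * z.im)) * Real.exp (a * z.im)) := by ring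
      _ = _ := by rw [← Real.exp_add]; simp
  · refine le_max_of_le_right ?_
    refine (norm_sub_le _ _).trans ?_
    rw [norm_mul, hen2]
    gcongr
    refine (hnorm z hz).trans ?_
    gcongr

theorem jl_struct {p : ℕ → Polynomial ℂ} {δ : ℕ → ℂ} {R K : ℝ}
    (hG : ∀ n, JlGood (p n) (δ n) R K) {X : ℕ → ℂ → ℂ} (hX : ∀ n, Differentiable ℂ (X n))
    (hO : ∀ z, JlOrb p δ R (fun n => X n z)) {a b : ℝ} (ha : 0 ≤ a) (hb : 0 ≤ b)
    (hU : ∀ z : ℂ, 0 ≤ z.im → jl_G p (fun n => X n z) = a * z.im)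
    (hU2 : ∀ z : ℂ, 0 ≤ z.im → jl_G p (fun n => X n (-z)) = b * z.im) :
    ∃ (A B C : ℂ), (0 < a → A ≠ 0) ∧ (0 < b → B ≠ 0) ∧ ∀ z : ℂ,
      X 1 z = A * Complex.exp (-(Complex.I * a * z)) + B * Complex.exp (Complex.I * b * z) + C := by
  obtain ⟨A, M1, hA0, hA⟩ := jl_asymp hG hX hO ha hU
  obtain ⟨B, M2, hB0, hB⟩ := jl_asymp hG (X := fun n z => X n (-z))
    (fun n => (hX n).comp differentiable_neg) (fun z => hO (-z)) hb hU2
  have hd : Differentiable ℂ (fun z => X 1 z - A * Complex.exp (-(Complex.I * a * z))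
      - B * Complex.exp (Complex.I * b * z)) := by
    have := hX 1
    fun_prop
  have hbd : Bornology.IsBounded (range (fun z => X 1 z - A * Complex.exp (-(Complex.I * a * z))
      - B * Complex.exp (Complex.I * b * z))) := by
    rw [isBounded_iff_forall_norm_le]
    refine ⟨max (M1 + ‖B‖) (M2 + ‖A‖), ?_⟩
    rintro _ ⟨z, rfl⟩
    rcases le_total 0 z.im with h | h
    · refine le_max_of_le_left ?_
      refine (norm_sub_le _ _).trans ?_
      gcongr
      · exact hA z h
      · rw [norm_mul, Complex.norm_exp]
        apply mul_le_of_le_one_right (norm_nonneg _)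
        rw [Real.exp_le_one_iff]
        simp
        positivity
    · refine le_max_of_le_right ?_
      have e : X 1 z - A * Complex.exp (-(Complex.I * a * z)) - B * Complex.exp (Complex.I * b * z)
        = (X 1 z - B * Complex.exp (Complex.I * b * z)) - A * Complex.exp (-(Complex.I * a * z)) := by
        ring
      simp only
      rw [e]
      refine (norm_sub_le _ _).trans ?_
      gcongr
      · have := hB (-z) (by simpa using h)
        simpa using this
      · rw [norm_mul, Complex.norm_exp]
        apply mul_le_of_le_one_right (norm_nonneg _)
        rw [Real.exp_le_one_iff]
        simp
        nlinarith
  obtain ⟨C, hC⟩ := hd.exists_eq_const_of_bounded hbd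
  refine ⟨A, B, C, hA0, hB0, fun z => ?_⟩
  have := congrFun hC z
  simp only [const_apply] at this
  rw [← this]
  ring


/-- Exponentials. -/
def jl_E (lam : ℝ) : ℂ → ℂ := fun z => Complex.exp (Complex.I * lam * z)

theorem jl_E_add (x y : ℝ) : jl_E (x + y) = jl_E x * jl_E y := by
  funext z
  simp only [jl_E, Pi.mul_apply, ← Complex.exp_add]
  push_cast
  ring_nf

theorem jl_E_zero : jl_E 0 = 1 := by
  funext z
  simp [jl_E]

theorem jl_E_inj : Injective jl_E := by
  intro x y h
  have := congrArg norm (congrFun h (-Complex.I))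
  simp only [jl_E, Complex.norm_exp] at this
  have := Real.exp_injective this
  simpa using this

/-- Exponential as a character. -/
def jl_char (lam : ℝ) : Multiplicative ℂ →* ℂ where
  toFun z := jl_E lam (Multiplicative.toAdd z)
  map_one' := by simp [jl_E]
  map_mul' x y := by
    simp only [jl_E, toAdd_mul, ← Complex.exp_add]
    ring_nf

theorem jl_E_li : LinearIndependent ℂ jl_E := by
  have h := (linearIndependent_monoidHom (Multiplicative ℂ) ℂ).comp jl_char (by
    intro x y hxy
    apply jl_E_inj
    funext z
    exact DFunLike.congr_fun hxy (Multiplicative.ofAdd z))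
  exact h

theorem jl_no_model {p : ℕ → Polynomial ℂ} {δ : ℕ → ℂ} {R K : ℝ}
    (hG : ∀ n, JlGood (p n) (δ n) R K) {X : ℕ → ℂ → ℂ} (hX : ∀ n, Differentiable ℂ (X n))
    (hO : ∀ z, JlOrb p δ R (fun n => X n z)) {a b : ℝ} (ha : 0 ≤ a) (hb : 0 ≤ b)
    (hab : 0 < a ∨ 0 < b)
    (hU : ∀ z : ℂ, 0 ≤ z.im → jl_G p (fun n => X n z) = a * z.im)
    (hU2 : ∀ z : ℂ, 0 ≤ z.im → jl_G p (fun n => X n (-z)) = b * z.im) : False := by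
  have key : ∀ n : ℕ, ∃ (A B C : ℂ), (0 < a → A ≠ 0) ∧ (0 < b → B ≠ 0) ∧
      X (n+1) = A • jl_E (-(jl_D p n * a)) + B • jl_E (jl_D p n * b) + C • jl_E 0 := by
    intro n
    have hD := jl_D_pos hG n
    obtain ⟨A, B, C, h1, h2, h3⟩ := jl_struct (p := fun i => p (n+i)) (δ := fun i => δ (n+i))
      (fun i => hG (n+i)) (X := fun i => X (n+i)) (fun i => hX _)
      (fun z => (hO z).shift hG n) (a := jl_D p n * a) (b := jl_D p n * b) (by positivity)
      (by positivity)
      (fun z hz => by rw [(hO z).G_shift hG n, hU z hz, mul_assoc])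
      (fun z hz => by rw [(hO (-z)).G_shift hG n, hU2 z hz, mul_assoc])
    refine ⟨A, B, C, fun h => h1 (by positivity), fun h => h2 (by positivity), ?_⟩
    funext z
    rw [h3 z]
    simp [jl_E]
  obtain ⟨A0, B0, C0, hA0, hB0, h0⟩ := key 0
  obtain ⟨A1, B1, C1, -, -, h1⟩ := key 1
  obtain ⟨A2, B2, C2, -, -, h2⟩ := key 2
  have hD1 : jl_D p 1 = (p 0).natDegree := by rw [jl_D_succ, jl_D_zero, one_mul]
  have hD2 : jl_D p 2 = (p 0).natDegree * (p 1).natDegree := by rw [jl_D_succ, hD1]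
  rw [jl_D_zero, one_mul, one_mul] at h0
  rw [hD1] at h1
  rw [hD2] at h2
  set d := (p 0).natDegree with hd
  have hd2 : 2 ≤ d := (hG 0).deg
  set L : Set ℝ := {x | ∃ j k : ℤ, x = d * (j * a + k * b)} with hL
  let M : Submonoid (ℂ → ℂ) :=
    { carrier := jl_E '' L
      one_mem' := ⟨0, ⟨0, 0, by simp⟩, jl_E_zero⟩
      mul_mem' := by
        rintro _ _ ⟨x, ⟨j, k, rfl⟩, rfl⟩ ⟨y, ⟨j', k', rfl⟩, rfl⟩
        refine ⟨_, ⟨j + j', k + k', rfl⟩, ?_⟩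
        rw [← jl_E_add]
        congr 1
        push_cast
        ring }
  set S := Algebra.adjoin ℂ (jl_E '' L) with hS
  have hSspan : ∀ F, F ∈ S → F ∈ Submodule.span ℂ (jl_E '' L) := by
    intro F hF
    have h3 : F ∈ Subalgebra.toSubmodule S := hF
    rw [hS, Algebra.adjoin_eq_span] at h3
    have : Submonoid.closure (jl_E '' L) = M := Submonoid.closure_eq M
    rw [this] at h3
    exact h3
  have hmem : ∀ x ∈ L, jl_E x ∈ S := fun x hx => Algebra.subset_adjoin ⟨x, hx, rfl⟩
  have hL0 : (0:ℝ) ∈ L := ⟨0, 0, by simp⟩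
  have hX2 : X 2 ∈ S := by
    show X (1+1) ∈ S
    rw [h1]
    refine S.add_mem (S.add_mem (S.smul_mem (hmem _ ⟨-1, 0, by push_cast; ring⟩) _)
      (S.smul_mem (hmem _ ⟨0, 1, by push_cast; ring⟩) _)) (S.smul_mem (hmem _ hL0) _)
  have hX3 : X 3 ∈ S := by
    show X (2+1) ∈ S
    rw [h2]
    refine S.add_mem (S.add_mem (S.smul_mem (hmem _ ⟨-(p 1).natDegree, 0, by push_cast; ring⟩) _)
      (S.smul_mem (hmem _ ⟨0, (p 1).natDegree, by push_cast; ring⟩) _)) (S.smul_mem (hmem _ hL0) _)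
  have hX1 : X 1 ∈ S := by
    have e : X 1 = (δ 1)⁻¹ • (Polynomial.aeval (X 2) (p 1) - X 3) := by
      funext z
      have h3 := (hO z).orb 1
      have h4 : (Polynomial.aeval (X 2) (p 1)) z = (p 1).eval (X 2 z) := by
        rw [Polynomial.aeval_eq_sum_range, Polynomial.eval_eq_sum_range]
        simp
      have h5 := (hG 1).δ0
      simp only [Pi.smul_apply, Pi.sub_apply, h4, smul_eq_mul]
      show X 1 z = (δ 1)⁻¹ * ((p 1).eval (X 2 z) - X (1+2) z)
      rw [h3]
      field_simp
      simp
    rw [e]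
    refine S.smul_mem (S.sub_mem ?_ hX3) _
    exact Polynomial.aeval_mem_adjoin_singleton ℂ (X 2) |> fun h =>
      Algebra.adjoin_le (by simpa using hX2) h
  have hsp := hSspan _ hX1
  have hX1e : X 1 = A0 • jl_E (-a) + B0 • jl_E b + C0 • jl_E 0 := h0
  rw [hX1e] at hsp
  have hsub : ∀ c : ℝ, Submodule.span ℂ (jl_E '' L) ≤ Submodule.span ℂ (jl_E '' (L ∪ {c})) :=
    fun c => Submodule.span_mono (image_mono subset_union_left)
  have hin : ∀ c : ℝ, jl_E c ∈ Submodule.span ℂ (jl_E '' (L ∪ {c})) := fun c =>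
    Submodule.subset_span ⟨c, Or.inr rfl, rfl⟩
  have hin0 : ∀ c : ℝ, jl_E 0 ∈ Submodule.span ℂ (jl_E '' (L ∪ {c})) := fun c =>
    Submodule.subset_span ⟨0, Or.inl hL0, rfl⟩
  have e1 : 0 < a → ∃ j k : ℤ, a = d * (j * a + k * b) := by
    intro h
    have h3 : jl_E (-a) ∈ Submodule.span ℂ (jl_E '' (L ∪ {b})) := by
      have h4 := Submodule.sub_mem _ (Submodule.sub_mem _ (hsub b hsp)
        (Submodule.smul_mem _ C0 (hin0 b))) (Submodule.smul_mem _ B0 (hin b))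
      have h5 := Submodule.smul_mem _ A0⁻¹ h4
      have e : A0⁻¹ • (A0 • jl_E (-a) + B0 • jl_E b + C0 • jl_E 0 - C0 • jl_E 0 - B0 • jl_E b)
        = jl_E (-a) := by
        have : A0 • jl_E (-a) + B0 • jl_E b + C0 • jl_E 0 - C0 • jl_E 0 - B0 • jl_E b
          = A0 • jl_E (-a) := by abel
        rw [this, inv_smul_smul₀ (hA0 h)]
      rwa [e] at h5
    have h6 : -a ∈ L ∪ {b} := by
      by_contra hn
      exact jl_E_li.notMem_span_image hn h3
    rcases h6 with ⟨j, k, hjk⟩ | h6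
    · refine ⟨-j, -k, ?_⟩
      push_cast
      linarith
    · have h6' : -a = b := h6
      linarith
  have e2 : 0 < b → ∃ j k : ℤ, b = d * (j * a + k * b) := by
    intro h
    have h3 : jl_E b ∈ Submodule.span ℂ (jl_E '' (L ∪ {-a})) := by
      have h4 := Submodule.sub_mem _ (Submodule.sub_mem _ (hsub (-a) hsp)
        (Submodule.smul_mem _ C0 (hin0 (-a)))) (Submodule.smul_mem _ A0 (hin (-a)))
      have h5 := Submodule.smul_mem _ B0⁻¹ h4
      have e : B0⁻¹ • (A0 • jl_E (-a) + B0 • jl_E b + C0 • jl_E 0 - C0 • jl_E 0 - A0 • jl_E (-a))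
        = jl_E b := by
        have : A0 • jl_E (-a) + B0 • jl_E b + C0 • jl_E 0 - C0 • jl_E 0 - A0 • jl_E (-a)
          = B0 • jl_E b := by abel
        rw [this, inv_smul_smul₀ (hB0 h)]
      rwa [e] at h5
    have h6 : b ∈ L ∪ {-a} := by
      by_contra hn
      exact jl_E_li.notMem_span_image hn h3
    rcases h6 with h6 | h6
    · exact h6
    · have h6' : b = -a := h6
      linarith
  have hfin : ∀ q : ℤ, (d : ℤ) * q ≠ 1 := by
    intro q hq
    have := Int.eq_one_of_mul_eq_one_right (by positivity) hq
    omega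
  rcases ha.eq_or_lt with ha0 | ha0
  · have hb0 : 0 < b := by
      rcases hab with h | h
      · exact absurd ha0 h.ne
      · exact h
    obtain ⟨j, k, hjk⟩ := e2 hb0
    rw [← ha0] at hjk
    have h5 : b * ((d:ℝ) * k) = b * 1 := by linarith
    have h6 := mul_left_cancel₀ hb0.ne' h5
    exact hfin k (by exact_mod_cast h6)
  · obtain ⟨j, k, hjk⟩ := e1 ha0
    rcases hb.eq_or_lt with hb0 | hb0
    · rw [← hb0] at hjk
      have h5 : a * ((d:ℝ) * j) = a * 1 := by linarith
      have h6 := mul_left_cancel₀ ha0.ne' h5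
      exact hfin j (by exact_mod_cast h6)
    · obtain ⟨j', k', hjk'⟩ := e2 hb0
      have f1 : a * (1 - d * j) = d * k * b := by linarith
      have f2 : b * (1 - d * k') = d * j' * a := by linarith
      have f3 : (a * b) * ((1 - d * j) * (1 - d * k')) = (a * b) * (d * k * (d * j')) := by
        calc _ = (a * (1 - d * j)) * (b * (1 - d * k')) := by ring
          _ = _ := by rw [f1, f2]; ring
      have f4 := mul_left_cancel₀ (mul_pos ha0 hb0).ne' f3
      have f5 : (1 - (d:ℤ) * j) * (1 - d * k') = d * k * (d * j') := by exact_mod_cast f4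
      refine hfin (j + k' - d * j * k' + d * k * j') ?_
      linarith


theorem jl_sector_convex (ε : ℝ) (hε : 0 ≤ ε) : Convex ℝ {z : ℂ | ε * ‖z‖ < z.im} := by
  intro x hx y hy a b ha hb hab
  simp only [mem_ofPred_eq] at hx hy ⊢
  have h1 : ‖a • x + b • y‖ ≤ a * ‖x‖ + b * ‖y‖ := by
    refine (norm_add_le _ _).trans ?_
    rw [norm_smul, norm_smul, Real.norm_of_nonneg ha, Real.norm_of_nonneg hb]
  have h2 : (a • x + b • y).im = a * x.im + b * y.im := by simp
  rw [h2]
  have h3 : ε * ‖a • x + b • y‖ ≤ ε * (a * ‖x‖ + b * ‖y‖) := by gcongr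
  refine h3.trans_lt ?_
  rcases ha.eq_or_lt with h | h
  · have : b = 1 := by linarith
    subst h; subst this; simpa using hy
  · nlinarith [mul_lt_mul_of_pos_left hx h, mul_le_mul_of_nonneg_left hy.le hb]

theorem jl_lower {u : ℂ → ℝ} {ρ : ℝ} (hρ : 0 < ρ) (huc : ContinuousOn u (Metric.ball 0 ρ))
    (hu0 : ∀ z ∈ Metric.ball (0:ℂ) ρ, 0 ≤ u z) {E : Set ℂ}
    (huh : ∀ z ∈ Metric.ball (0:ℂ) ρ, z ∉ E → HarmonicAt u z)
    (hE : ∀ z ∈ Metric.ball (0:ℂ) ρ, z ∉ E → u z = 0 → ∀ᶠ w in 𝓝 z, u w = 0)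
    (T1 : ∀ ε > 0, ∃ r0 > 0, ∀ ζ ∈ E, ‖ζ‖ < r0 → |ζ.im| ≤ ε * ‖ζ‖)
    (T3 : ∃ w : ℂ, 0 < w.im ∧ ∃ τ0 > 0, ∀ τ : ℝ, 0 < τ → τ < τ0 → 0 < u (τ * w)) :
    ∃ c > 0, ∃ r2 > 0, r2 < ρ ∧ ∀ τ : ℝ, 0 < τ → τ < r2 → c * τ ^ (4/3 : ℝ) ≤ u (τ * Complex.I) := by
  obtain ⟨w, hw, τ0, hτ0, hw2⟩ := T3
  set c0 : ℝ := Real.cos (3/8 * Real.pi) with hc0def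
  have hc0 : 0 < c0 := Real.cos_pos_of_mem_Ioo ⟨by linarith [Real.pi_pos], by linarith [Real.pi_pos]⟩
  have hc01 : c0 < 1 := by
    rw [hc0def, ← Real.cos_zero]
    exact Real.cos_lt_cos_of_nonneg_of_le_pi le_rfl (by linarith [Real.pi_pos])
      (by linarith [Real.pi_pos])
  have hwn : 0 < ‖w‖ := by
    rw [norm_pos_iff]; rintro rfl; simp at hw
  obtain ⟨ε, hε, hε1, hε2⟩ : ∃ ε : ℝ, 0 < ε ∧ ε < c0 ∧ ε * ‖w‖ < w.im := by
    refine ⟨min c0 (w.im / ‖w‖) / 2, by positivity, ?_, ?_⟩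
    · have : min c0 (w.im / ‖w‖) ≤ c0 := min_le_left _ _
      linarith
    · have h1 : min c0 (w.im / ‖w‖) ≤ w.im / ‖w‖ := min_le_right _ _
      have h2 : 0 < w.im / ‖w‖ := by positivity
      calc min c0 (w.im / ‖w‖) / 2 * ‖w‖ < (w.im / ‖w‖) * ‖w‖ := mul_lt_mul_of_pos_right (by linarith) hwn
        _ = w.im := by field_simp
  obtain ⟨r0, hr0, hr0E⟩ := T1 ε hε
  set r1 := min r0 ρ with hr1
  have hr1p : 0 < r1 := lt_min hr0 hρ
  set Sg : Set ℂ := {z : ℂ | ε * ‖z‖ < z.im} ∩ Metric.ball 0 r1 with hSg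
  have hSgρ : Sg ⊆ Metric.ball 0 ρ := fun z hz => Metric.ball_subset_ball (min_le_right _ _) hz.2
  have hSgE : ∀ z ∈ Sg, z ∉ E := by
    intro z hz hzE
    have h1 : ‖z‖ < r1 := by simpa using hz.2
    have h2 := hr0E z hzE (h1.trans_le (min_le_left _ _))
    have h3 : ε * ‖z‖ < z.im := hz.1
    linarith [le_abs_self z.im]
  have hSgo : IsOpen Sg := (isOpen_lt (by fun_prop) Complex.continuous_im).inter Metric.isOpen_ball
  have hSgconn : IsPreconnected Sg :=
    ((jl_sector_convex ε hε.le).inter (convex_ball 0 r1)).isPreconnected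
  have hpos : ∀ z ∈ Sg, 0 < u z := by
    have hP : IsOpen (Sg ∩ {z | 0 < u z}) := by
      have := (huc.mono hSgρ).isOpen_inter_preimage hSgo (isOpen_Ioi (a := (0:ℝ)))
      exact this
    have hQ : IsOpen (Sg ∩ {z | u z = 0}) := by
      rw [isOpen_iff_mem_nhds]
      rintro z ⟨h1, h2⟩
      exact inter_mem (hSgo.mem_nhds h1) (hE z (hSgρ h1) (hSgE z h1) h2)
    have hcov : Sg ⊆ (Sg ∩ {z | 0 < u z}) ∪ (Sg ∩ {z | u z = 0}) := by
      intro z hz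
      rcases (hu0 z (hSgρ hz)).eq_or_lt with h | h
      · exact Or.inr ⟨hz, h.symm⟩
      · exact Or.inl ⟨hz, h⟩
    have hdis : Disjoint (Sg ∩ {z | 0 < u z}) (Sg ∩ {z | u z = 0}) := by
      rw [Set.disjoint_left]
      rintro z ⟨_, h1⟩ ⟨_, h2⟩
      have h1' : 0 < u z := h1
      have h2' : u z = 0 := h2
      linarith
    have hne : (Sg ∩ (Sg ∩ {z | 0 < u z})).Nonempty := by
      set τ := min (τ0 / 2) (r1 / (2 * ‖w‖)) with hτ
      have hτp : 0 < τ := by positivity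
      have hτ1 : τ < τ0 := (min_le_left _ _).trans_lt (by linarith)
      have hτ2 : τ * ‖w‖ < r1 := by
        calc τ * ‖w‖ ≤ r1 / (2 * ‖w‖) * ‖w‖ := by gcongr; exact min_le_right _ _
          _ = r1 / 2 := by field_simp
          _ < r1 := by linarith
      have hm : (τ * w : ℂ) ∈ Sg := by
        constructor
        · simp only [mem_ofPred_eq, norm_mul, Complex.norm_real, Real.norm_of_nonneg hτp.le]
          simp
          nlinarith
        · simpa [abs_of_pos hτp] using hτ2
      exact ⟨τ * w, hm, hm, hw2 τ hτp hτ1⟩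
    have := hSgconn.subset_left_of_subset_union hP hQ hdis hcov hne
    exact fun z hz => (this hz).2
  set r2 := r1 / 2 with hr2
  have hr2p : 0 < r2 := by positivity
  have hr21 : r2 < r1 := by linarith
  have hr2ρ : r2 < ρ := hr21.trans_le (min_le_right _ _)
  -- minimum on the arc
  set A : Set ℂ := {z : ℂ | c0 * ‖z‖ ≤ z.im} ∩ Metric.sphere 0 r2 with hA
  have hAc : IsCompact A :=
    (isCompact_sphere 0 r2).inter_left (isClosed_le (by fun_prop) Complex.continuous_im)
  have hASg : A ⊆ Sg := by
    rintro z ⟨h1, h2⟩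
    have h2' : ‖z‖ = r2 := by simpa using h2
    have h1' : c0 * ‖z‖ ≤ z.im := h1
    refine ⟨?_, by simpa [h2'] using hr21⟩
    show ε * ‖z‖ < z.im
    have : 0 < ‖z‖ := by rw [h2']; exact hr2p
    nlinarith
  have hAne : A.Nonempty := by
    refine ⟨r2 * Complex.I, ?_, ?_⟩
    · simp [abs_of_pos hr2p]
      nlinarith
    · simp [abs_of_pos hr2p]
  obtain ⟨z1, hz1, hz1m⟩ := hAc.exists_isMinOn hAne (huc.mono (hASg.trans hSgρ))
  set m := u z1 with hm
  have hm0 : 0 < m := hpos z1 (hASg hz1)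
  set b : ℂ → ℝ := fun z => ‖z‖ ^ (4/3 : ℝ) * Real.cos (4/3 * (0 + (-Complex.I) * z).arg) with hb
  have hbe : ∀ z : ℂ, z ≠ 0 → b z = jl_pw (4/3) (0 + (-Complex.I) * z) := by
    intro z hz
    rw [jl_pw_eq _ (by simp [hz])]
    simp [hb]
  have hble : ∀ z : ℂ, b z ≤ ‖z‖ ^ (4/3 : ℝ) := fun z =>
    mul_le_of_le_one_right (by positivity) (Real.cos_le_one _)
  have hbabs : ∀ z : ℂ, |b z| ≤ ‖z‖ ^ (4/3 : ℝ) := fun z => by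
    rw [hb]
    simp only
    rw [abs_mul, abs_of_nonneg (by positivity)]
    exact mul_le_of_le_one_right (by positivity) (Real.abs_cos_le_one _)
  have hbh : ∀ z : ℂ, 0 < z.im → HarmonicAt b z := by
    intro z hz
    have h1 : HarmonicAt (fun z => jl_pw (4/3) (0 + (-Complex.I) * z)) z :=
      jl_pw_harm _ _ _ (Or.inl (by simpa using hz))
    refine (harmonicAt_congr_nhds ?_).1 h1
    have hz0 : z ≠ 0 := by rintro rfl; simp at hz
    filter_upwards [isOpen_ne.mem_nhds hz0] with y hy
    exact (hbe y hy).symm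
  have hbc0 : ContinuousAt b 0 := by
    have hb0 : b 0 = 0 := by simp [hb]
    rw [ContinuousAt, hb0]
    refine squeeze_zero_norm (a := fun z : ℂ => ‖z‖ ^ (4/3 : ℝ)) hbabs ?_
    have : Continuous (fun z : ℂ => ‖z‖ ^ (4/3 : ℝ)) :=
      continuous_norm.rpow_const (fun _ => Or.inr (by norm_num))
    have h2 := this.tendsto 0
    simpa using h2
  set S0 : Set ℂ := {z : ℂ | c0 * ‖z‖ < z.im} ∩ Metric.ball 0 r2 with hS0
  have hS0o : IsOpen S0 := (isOpen_lt (by fun_prop) Complex.continuous_im).inter Metric.isOpen_ball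
  have hS0cl : ∀ z ∈ closure S0, c0 * ‖z‖ ≤ z.im ∧ ‖z‖ ≤ r2 := by
    have hcl : IsClosed {z : ℂ | c0 * ‖z‖ ≤ z.im ∧ ‖z‖ ≤ r2} :=
      (isClosed_le (f := fun z : ℂ => c0 * ‖z‖) (by fun_prop) Complex.continuous_im).inter
        (isClosed_le continuous_norm continuous_const)
    have hsub : S0 ⊆ {z : ℂ | c0 * ‖z‖ ≤ z.im ∧ ‖z‖ ≤ r2} := by
      rintro z ⟨h1, h2⟩
      exact ⟨le_of_lt h1, by have : ‖z‖ < r2 := by simpa using h2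
                             exact this.le⟩
    exact fun z hz => closure_minimal hsub hcl hz
  have hclpos : ∀ z ∈ closure S0, z ≠ 0 → 0 < z.im := by
    intro z hz hz0
    have := (hS0cl z hz).1
    have h2 : 0 < ‖z‖ := norm_pos_iff.2 hz0
    nlinarith
  set c := m / r2 ^ (4/3 : ℝ) with hc
  have hcp : 0 < c := by positivity
  have hmain := jl_harm_max hS0o (Metric.isBounded_ball.subset inter_subset_right)
    (w := fun z => c * b z - u z) ?_ ?_ 0 ?_
  · refine ⟨c, hcp, r2, hr2p, hr2ρ, fun τ hτ hτ2 => ?_⟩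
    have := hmain (τ * Complex.I) ⟨by simp [abs_of_pos hτ]; nlinarith, by simp [abs_of_pos hτ, hτ2]⟩
    have e : b (τ * Complex.I) = τ ^ (4/3 : ℝ) := by
      simp only [hb]
      have : (0 + -Complex.I * (τ * Complex.I) : ℂ) = (τ : ℂ) := by
        linear_combination (-(τ:ℂ)) * Complex.I_mul_I
      rw [this, Complex.arg_ofReal_of_nonneg hτ.le]
      simp [abs_of_pos hτ]
    simp only [e] at this
    linarith
  · intro z hz
    have h1 : ContinuousAt b z := by
      by_cases h0 : z = 0
      · rw [h0]; exact hbc0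
      · exact jl_harm_cont (hbh z (hclpos z hz h0))
    have h2 : ContinuousAt u z := by
      apply huc.continuousAt
      apply Metric.isOpen_ball.mem_nhds
      have := (hS0cl z hz).2
      simp
      linarith
    exact ((h1.const_mul c).sub h2).continuousWithinAt
  · intro z hz
    have hz' : z ∈ Sg := by
      refine ⟨?_, Metric.ball_subset_ball hr21.le hz.2⟩
      have h1 : c0 * ‖z‖ < z.im := hz.1
      show ε * ‖z‖ < z.im
      nlinarith [norm_nonneg z]
    have hzi : 0 < z.im := by
      have h1 : c0 * ‖z‖ < z.im := hz.1
      nlinarith [norm_nonneg z]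
    exact ((hbh z hzi).const_smul (c := c)).sub (huh z (hSgρ hz') (hSgE z hz'))
  · intro z hz
    rw [hS0o.frontier_eq] at hz
    obtain ⟨h1, h2⟩ := hS0cl z hz.1
    have huz : 0 ≤ u z := hu0 z (by simp; linarith)
    by_cases h0 : z = 0
    · have : b z = 0 := by rw [h0]; simp [hb]
      rw [this]
      linarith
    by_cases h3 : ‖z‖ = r2
    · have h4 : m ≤ u z := hz1m (show z ∈ A from ⟨h1, by simpa using h3⟩)
      have h5 := hble z
      rw [h3] at h5
      have h6 : c * b z ≤ m := by
        calc c * b z ≤ c * r2 ^ (4/3 : ℝ) := by gcongr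
          _ = m := by rw [hc]; field_simp
      linarith
    · have h4 : ‖z‖ < r2 := lt_of_le_of_ne h2 h3
      have h5 : z.im = c0 * ‖z‖ := by
        refine le_antisymm (not_lt.1 fun h => hz.2 ⟨h, by simpa using h4⟩) h1
      have hzn : 0 < ‖z‖ := norm_pos_iff.2 h0
      have h6 : Real.cos |(0 + (-Complex.I) * z).arg| = Real.cos (3/8 * Real.pi) := by
        rw [Real.cos_abs, Complex.cos_arg (by simp [h0])]
        simp [h5]
        field_simp
        rw [hc0def]; ring_nf
      have h7 := Real.injOn_cos ⟨abs_nonneg _, Complex.abs_arg_le_pi _⟩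
        ⟨by positivity, by linarith [Real.pi_pos]⟩ h6
      have h8 : b z = 0 := by
        simp only [hb]
        rw [← Real.cos_abs, abs_mul, h7, abs_of_pos (by norm_num : (0:ℝ) < 4/3)]
        have : (4/3 * (3/8 * Real.pi) : ℝ) = Real.pi / 2 := by ring
        rw [this]
        simp
      rw [h8]
      linarith


theorem jl_scale {M : ℝ → ℝ} {r3 c : ℝ} (hr3 : 0 < r3) (hc : 0 < c)
    (hmono : ∀ r r', 0 < r → r ≤ r' → r' ≤ r3 → M r ≤ M r')
    (hlow : ∀ r, 0 < r → r ≤ r3 → c * r ^ (4/3 : ℝ) ≤ M r) (η : ℝ) (hη : 0 < η) :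
    ∃ r, 0 < r ∧ r < η ∧ r ≤ r3 ∧
      ∀ r', r ≤ r' → r' ≤ r3 → M r' ≤ 2 * (r' / r) ^ (3/2 : ℝ) * M r := by
  wlog hη3 : η ≤ r3 generalizing η
  · obtain ⟨r, h1, h2, h3, h4⟩ := this r3 hr3 le_rfl
    exact ⟨r, h1, h2.trans (not_le.1 hη3), h3, h4⟩
  have hMpos : ∀ r, 0 < r → r ≤ r3 → 0 < M r := fun r h1 h2 =>
    lt_of_lt_of_le (by positivity) (hlow r h1 h2)
  set Φ : ℝ → ℝ := fun r => M r / r ^ (3/2 : ℝ) with hΦ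
  set B : ℝ := M r3 / η ^ (3/2 : ℝ) with hB
  have hM3 := hMpos r3 hr3 le_rfl
  have hBp : 0 < B := by positivity
  have hup : ∀ a r, 0 < a → a ≤ r → r ≤ r3 → Φ r ≤ M r3 / a ^ (3/2 : ℝ) := by
    intro a r ha har hr
    have h1 := hmono r r3 (ha.trans_le har) hr le_rfl
    simp only [hΦ]
    gcongr
  obtain ⟨r1, hr1, hr1η, hΦ1⟩ : ∃ r1, 0 < r1 ∧ r1 < η ∧ 2 * B < Φ r1 := by
    have h1 := (tendsto_rpow_neg_nhdsGT_zero (y := (-1/6 : ℝ)) (by norm_num)).eventually_gt_atTop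
      (2 * B / c)
    have h2 : ∀ᶠ x : ℝ in 𝓝[>] 0, x < η := by
      filter_upwards [nhdsWithin_le_nhds (Iio_mem_nhds hη)] with x hx using hx
    have h3 : ∀ᶠ x : ℝ in 𝓝[>] 0, 0 < x := self_mem_nhdsWithin
    obtain ⟨x, hx1, hx2, hx3⟩ := (h1.and (h2.and h3)).exists
    refine ⟨x, hx3, hx2, ?_⟩
    rw [div_lt_iff₀ hc] at hx1
    refine hx1.trans_le ?_
    simp only [hΦ]
    rw [le_div_iff₀ (by positivity)]
    refine le_trans (le_of_eq ?_) (hlow x hx3 (hx2.le.trans hη3))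
    rw [mul_right_comm, ← Real.rpow_add hx3, mul_comm]
    norm_num
  set A : Set ℝ := Φ '' Icc r1 r3 with hA
  have hAb : BddAbove A := by
    refine ⟨M r3 / r1 ^ (3/2 : ℝ), ?_⟩
    rintro _ ⟨r, hr, rfl⟩
    exact hup r1 r hr1 hr.1 hr.2
  have h1A : Φ r1 ∈ A := ⟨r1, ⟨le_rfl, (hr1η.le.trans hη3)⟩, rfl⟩
  have hs1 : Φ r1 ≤ sSup A := le_csSup hAb h1A
  obtain ⟨_, ⟨r, hr, rfl⟩, hrs⟩ := exists_lt_of_lt_csSup ⟨_, h1A⟩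
    (show sSup A / 2 < sSup A by linarith)
  have hrp : 0 < r := hr1.trans_le hr.1
  refine ⟨r, hrp, ?_, hr.2, ?_⟩
  · by_contra hcon
    have := hup η r hη (not_lt.1 hcon) hr.2
    linarith
  · intro r' h1 h2
    have h3 : Φ r' ≤ sSup A := le_csSup hAb ⟨r', ⟨hr.1.trans h1, h2⟩, rfl⟩
    have h4 : Φ r' ≤ 2 * Φ r := by linarith
    simp only [hΦ] at h4
    have hr'p : 0 < r' := hrp.trans_le h1
    rw [div_le_iff₀ (by positivity)] at h4
    refine h4.trans (le_of_eq ?_)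
    rw [Real.div_rpow hr'p.le hrp.le]
    ring

section
variable {p : ℕ → Polynomial ℂ} {δ : ℕ → ℂ} {R K : ℝ}

theorem jl_per_shift {α : Type*} {q : ℕ → α} {k : ℕ} (h : ∀ n, q (n + k) = q n) (n : ℕ) :
    (fun i => q (n * k + i)) = q := by
  funext i
  have := (show Function.Periodic q k from h).nsmul n i
  rw [add_comm]
  simpa using this

theorem jl_D_per {k : ℕ} (h : ∀ n, p (n + k) = p n) (n : ℕ) : jl_D p (n * k) = jl_D p k ^ n := by
  induction n with
  | zero => simp [jl_D_zero]
  | succ n ih => rw [Nat.succ_mul, jl_D_add, jl_per_shift h, ih, pow_succ]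

/-- Abstract data for a slice near a tangent point. -/
structure JlSlice (p : ℕ → Polynomial ℂ) (δ : ℕ → ℂ) (R : ℝ) (k : ℕ) (S : ℕ → ℂ → ℂ) (ρ : ℝ)
    (E : Set ℂ) : Prop where
  k1 : 1 ≤ k
  pp : ∀ n, p (n + k) = p n
  pδ : ∀ n, δ (n + k) = δ n
  ρ0 : 0 < ρ
  diff : ∀ n, DifferentiableOn ℂ (S n) (Metric.ball 0 ρ)
  orb : ∀ z ∈ Metric.ball (0:ℂ) ρ, JlOrb p δ R (fun n => S n z)
  hE1 : ∀ z ∈ Metric.ball (0:ℂ) ρ, z ∉ E → (∃ n, R < ‖S n z‖) ∨ ∀ᶠ w in 𝓝 z, ∀ n, ‖S n w‖ ≤ R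
  hE2 : ∀ z ∈ Metric.ball (0:ℂ) ρ, z ∈ E → ∀ n, ‖S n z‖ ≤ R

theorem JlSlice.cont (hG : ∀ n, JlGood (p n) (δ n) R K) {k : ℕ} {S : ℕ → ℂ → ℂ} {ρ : ℝ}
    {E : Set ℂ} (h : JlSlice p δ R k S ρ E) :
    ContinuousOn (fun z => jl_G p (fun n => S n z)) (Metric.ball 0 ρ) := by
  intro z hz
  refine ContinuousAt.continuousWithinAt ?_
  have hz' : Metric.ball (0:ℂ) ρ ∈ 𝓝 z := Metric.isOpen_ball.mem_nhds hz
  refine JlOrb.G_lim hG ?_ (h.orb z hz) fun n => ?_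
  · filter_upwards [hz'] with w hw using h.orb w hw
  · exact ((h.diff n).continuousOn.continuousAt hz')

theorem JlSlice.zero_near (hG : ∀ n, JlGood (p n) (δ n) R K) {k : ℕ} {S : ℕ → ℂ → ℂ} {ρ : ℝ}
    {E : Set ℂ} (h : JlSlice p δ R k S ρ E) {z : ℂ} (hz : z ∈ Metric.ball (0:ℂ) ρ)
    (hw : ∀ᶠ w in 𝓝 z, ∀ n, ‖S n w‖ ≤ R) : ∀ᶠ w in 𝓝 z, jl_G p (fun n => S n w) = 0 := by
  filter_upwards [hw, Metric.isOpen_ball.mem_nhds hz] with w h1 h2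
  exact (h.orb w h2).G_zero hG h1

theorem JlSlice.harm (hG : ∀ n, JlGood (p n) (δ n) R K) {k : ℕ} {S : ℕ → ℂ → ℂ} {ρ : ℝ}
    {E : Set ℂ} (h : JlSlice p δ R k S ρ E) {z : ℂ} (hz : z ∈ Metric.ball (0:ℂ) ρ) (hzE : z ∉ E) :
    HarmonicAt (fun z => jl_G p (fun n => S n z)) z := by
  rcases h.hE1 z hz hzE with ⟨m, hm⟩ | hw
  · obtain ⟨r, hr, hrb⟩ := Metric.isOpen_iff.1 Metric.isOpen_ball z hz
    exact jl_G_harm hG hr (fun n => (h.diff n).mono hrb) (fun w hw => h.orb w (hrb hw)) hm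
  · have h1 : HarmonicAt (fun _ : ℂ => (0:ℝ)) z := by
      have := (analyticAt_const (𝕜 := ℂ) (v := (0:ℂ)) (x := z)).harmonicAt_re
      simpa using this
    refine (harmonicAt_congr_nhds ?_).1 h1
    filter_upwards [h.zero_near hG hz hw] with w hw using hw.symm

end


section
variable {p : ℕ → Polynomial ℂ} {δ : ℕ → ℂ} {R K : ℝ}

theorem jl_blow_scales {u : ℂ → ℝ} {ρ : ℝ} (huc : ContinuousOn u (Metric.ball 0 ρ))
    (hu0 : u 0 = 0) {c r2 : ℝ} (hc : 0 < c) (hr2 : 0 < r2) (hr2ρ : r2 < ρ)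
    (hlow : ∀ τ : ℝ, 0 < τ → τ < r2 → c * τ ^ (4/3 : ℝ) ≤ u (τ * Complex.I))
    {D : ℝ} (hD : 1 < D) :
    ∃ r3 > 0, r3 < ρ ∧ ∃ (r : ℕ → ℝ) (n : ℕ → ℕ), ∀ j : ℕ, 0 < r j ∧ r j < r3 / (j + 1) ∧
      (∃ z, ‖z‖ ≤ r j ∧ D⁻¹ ≤ D ^ n j * u z) ∧
      ∀ B : ℝ, 1 ≤ B → B * r j ≤ r3 → ∀ z, ‖z‖ ≤ B * r j → D ^ n j * u z ≤ 2 * B ^ (3/2 : ℝ) := by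
  set r3 := r2 / 2 with hr3
  have hr3p : 0 < r3 := by positivity
  have hr32 : r3 < r2 := by linarith
  have hM : ∀ r, ∃ m, 0 < r → r ≤ r3 → (∃ z : ℂ, ‖z‖ ≤ r ∧ u z = m) ∧ ∀ z, ‖z‖ ≤ r → u z ≤ m := by
    intro r
    by_cases h : 0 < r ∧ r ≤ r3
    · obtain ⟨z, hz, hzm⟩ := (isCompact_closedBall (0:ℂ) r).exists_isMaxOn
        ⟨0, by simpa using h.1.le⟩ (huc.mono (Metric.closedBall_subset_ball (by linarith)))
      refine ⟨u z, fun _ _ => ⟨⟨z, by simpa using hz, rfl⟩, fun w hw => hzm (by simpa using hw)⟩⟩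
    · exact ⟨0, fun h1 h2 => absurd ⟨h1, h2⟩ h⟩
  choose M hM using hM
  have hmono : ∀ r r', 0 < r → r ≤ r' → r' ≤ r3 → M r ≤ M r' := by
    intro r r' h1 h2 h3
    obtain ⟨z, hz, hz2⟩ := (hM r h1 (h2.trans h3)).1
    rw [← hz2]
    exact (hM r' (h1.trans_le h2) h3).2 z (hz.trans h2)
  have hlow' : ∀ r, 0 < r → r ≤ r3 → c * r ^ (4/3 : ℝ) ≤ M r := by
    intro r h1 h2
    refine (hlow r h1 (by linarith)).trans ((hM r h1 h2).2 _ ?_)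
    simp [abs_of_pos h1]
  obtain ⟨η1, hη1, hη1u⟩ : ∃ η1 > 0, ∀ z : ℂ, ‖z‖ < η1 → u z < 1 := by
    have h1 : ContinuousAt u 0 :=
      huc.continuousAt (Metric.ball_mem_nhds 0 (by linarith))
    have h2 : ∀ᶠ z in 𝓝 (0:ℂ), u z < 1 := h1.eventually (Iio_mem_nhds (by rw [hu0]; norm_num))
    obtain ⟨e, he, h3⟩ := Metric.eventually_nhds_iff.1 h2
    exact ⟨e, he, fun z hz => h3 (by simpa using hz)⟩
  have key : ∀ j : ℕ, ∃ (r : ℝ) (n : ℕ), 0 < r ∧ r < r3 / (j + 1) ∧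
      (∃ z, ‖z‖ ≤ r ∧ D⁻¹ ≤ D ^ n * u z) ∧
      ∀ B : ℝ, 1 ≤ B → B * r ≤ r3 → ∀ z, ‖z‖ ≤ B * r → D ^ n * u z ≤ 2 * B ^ (3/2 : ℝ) := by
    intro j
    obtain ⟨r, h1, h2, h3, h4⟩ := jl_scale hr3p hc hmono hlow' (min η1 (r3 / (j+1)))
      (by positivity)
    obtain ⟨⟨z, hz, hz2⟩, hmax⟩ := hM r h1 h3
    have hMp : 0 < M r := lt_of_lt_of_le (by positivity) (hlow' r h1 h3)
    have hM1 : M r < 1 := by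
      rw [← hz2]; exact hη1u z (hz.trans_lt (h2.trans_le (min_le_left _ _)))
    obtain ⟨n, hn1, hn2⟩ := exists_nat_pow_near (x := (M r)⁻¹) (y := D)
      ((one_le_inv₀ hMp).2 hM1.le) hD
    have hDp : 0 < D := by linarith
    refine ⟨r, n, h1, h2.trans_le (min_le_right _ _), ⟨z, hz, ?_⟩, ?_⟩
    · rw [hz2]
      rw [inv_lt_iff_one_lt_mul₀ hMp] at hn2
      rw [inv_le_iff_one_le_mul₀ hDp]
      rw [pow_succ] at hn2
      nlinarith
    · intro B hB hBr z hz
      have h5 := (hM (B * r) (by positivity) hBr).2 z hz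
      have h6 := h4 (B * r) (by nlinarith) hBr
      rw [mul_div_cancel_right₀ _ h1.ne'] at h6
      have h7 : D ^ n * M r ≤ 1 := by
        calc D ^ n * M r ≤ (M r)⁻¹ * M r := by gcongr
          _ = 1 := by field_simp
      calc D ^ n * u z ≤ D ^ n * (2 * B ^ (3/2 : ℝ) * M r) := by gcongr; linarith
        _ = 2 * B ^ (3/2 : ℝ) * (D ^ n * M r) := by ring
        _ ≤ 2 * B ^ (3/2 : ℝ) * 1 := by gcongr
        _ = _ := by ring
  choose r n h using key
  exact ⟨r3, hr3p, by linarith, r, n, h⟩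

theorem jl_core (hG : ∀ n, JlGood (p n) (δ n) R K) {k : ℕ} {S : ℕ → ℂ → ℂ} {ρ : ℝ}
    {E : Set ℂ} (h : JlSlice p δ R k S ρ E)
    (T1 : ∀ ε > 0, ∃ r0 > 0, ∀ ζ ∈ E, ‖ζ‖ < r0 → |ζ.im| ≤ ε * ‖ζ‖)
    (T2 : ∀ t : ℝ, ∀ ε > 0, ∃ r0 > 0, ∀ r : ℝ, 0 < r → r < r0 → ∃ e ∈ E, ‖e - r * t‖ ≤ ε * r)
    (T3 : ∃ w : ℂ, 0 < w.im ∧ ∃ τ0 > 0, ∀ τ : ℝ, 0 < τ → τ < τ0 → ∃ n, R < ‖S n (τ * w)‖) :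
    False := by
  have hρ := h.ρ0
  set u : ℂ → ℝ := fun z => jl_G p (fun n => S n z) with hu
  have huc : ContinuousOn u (Metric.ball 0 ρ) := h.cont hG
  have hunn : ∀ z ∈ Metric.ball (0:ℂ) ρ, 0 ≤ u z := fun z hz => (h.orb z hz).G_nonneg hG
  have huE : ∀ z ∈ Metric.ball (0:ℂ) ρ, z ∈ E → u z = 0 := fun z hz hzE =>
    (h.orb z hz).G_zero hG (h.hE2 z hz hzE)
  have hu0 : u 0 = 0 := by
    by_contra hcon
    have h1 : ContinuousAt u 0 := huc.continuousAt (Metric.ball_mem_nhds 0 hρ)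
    have h2 : ∀ᶠ z in 𝓝 (0:ℂ), u z ≠ 0 := h1.eventually_ne hcon
    obtain ⟨e, he, h3⟩ := Metric.eventually_nhds_iff.1 (h2.and (Metric.ball_mem_nhds 0 hρ))
    obtain ⟨r0, hr0, h4⟩ := T2 0 1 one_pos
    obtain ⟨x, hxE, hx⟩ := h4 (min r0 e / 2) (by positivity)
      (by have := min_le_left r0 e; have : 0 < min r0 e := by positivity
          linarith)
    have h5 : dist x 0 < e := by
      have := min_le_right r0 e
      have : 0 < min r0 e := by positivity
      simp at hx
      simp
      linarith
    obtain ⟨h6, h7⟩ := h3 h5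
    exact h6 (huE x h7 hxE)
  obtain ⟨c, hc, r2, hr2, hr2ρ, hlow⟩ := jl_lower hρ huc hunn
    (fun z hz hzE => h.harm hG hz hzE)
    (fun z hz hzE h0 => by
      rcases h.hE1 z hz hzE with ⟨m, hm⟩ | hw
      · exact absurd h0 ((h.orb z hz).G_pos hG hm).ne'
      · exact h.zero_near hG hz hw) T1 (by
      obtain ⟨w, hw, τ0, hτ0, hτ⟩ := T3
      have hwn : 0 < ‖w‖ := by
        rw [norm_pos_iff]; rintro rfl; simp at hw
      refine ⟨w, hw, min τ0 (ρ / ‖w‖), by positivity, fun τ h1 h2 => ?_⟩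
      obtain ⟨n, hn⟩ := hτ τ h1 (h2.trans_le (min_le_left _ _))
      refine (h.orb _ ?_).G_pos hG hn
      have := (lt_div_iff₀ hwn).1 (h2.trans_le (min_le_right _ _))
      simpa [abs_of_pos h1] using this)
  set D := jl_D p k with hDdef
  have hD : 1 < D := by
    have h1 := jl_D_ge hG k
    have h2 : (2:ℝ) ^ 1 ≤ 2 ^ k := pow_le_pow_right₀ (by norm_num) h.k1
    linarith
  have hDp : 0 < D := by linarith
  obtain ⟨r3, hr3, hr3ρ, r, n, hrn⟩ := jl_blow_scales huc hu0 hc hr2 hr2ρ hlow hD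
  have hrp : ∀ j, 0 < r j := fun j => (hrn j).1
  have hrlim : Tendsto r atTop (𝓝 0) := by
    refine squeeze_zero (fun j => (hrp j).le) (fun j => (hrn j).2.1.le) ?_
    exact tendsto_const_div_atTop_nhds_zero_nat r3 |>.comp (tendsto_add_atTop_nat 1) |>.congr
      (fun j => by simp)
  have hsmall : ∀ B : ℝ, 0 ≤ B → ∀ e > 0, ∀ᶠ j in atTop, B * r j < e := by
    intro B hB e he
    have := hrlim.const_mul B
    rw [mul_zero] at this
    exact this.eventually_lt_const he
  set 𝓕 : Ultrafilter ℕ := hyperfilter ℕ with h𝓕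
  have hle : (𝓕 : Filter ℕ) ≤ atTop := Nat.hyperfilter_le_atTop
  set Y : ℕ → ℕ → ℂ → ℂ := fun j m ζ => S (n j * k + m) (r j * ζ) with hY
  set V : ℕ → ℂ → ℝ := fun j ζ => D ^ n j * u (r j * ζ) with hV
  have hball : ∀ j B (ζ : ℂ), B * r j < r3 → ‖ζ‖ ≤ B → (r j * ζ : ℂ) ∈ Metric.ball (0:ℂ) ρ := by
    intro j B ζ h1 h2
    have := hrp j
    simp [abs_of_pos this]
    nlinarith
  have hYorb : ∀ j ζ, (r j * ζ : ℂ) ∈ Metric.ball (0:ℂ) ρ → JlOrb p δ R (fun m => Y j m ζ) := by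
    intro j ζ hz
    have := (h.orb _ hz).shift hG (n j * k)
    rw [jl_per_shift h.pp, jl_per_shift h.pδ] at this
    exact this
  have hYV : ∀ j ζ, (r j * ζ : ℂ) ∈ Metric.ball (0:ℂ) ρ → jl_G p (fun m => Y j m ζ) = V j ζ := by
    intro j ζ hz
    have := (h.orb _ hz).G_shift hG (n j * k)
    rw [jl_per_shift h.pp, jl_D_per h.pp] at this
    exact this
  have hVB : ∀ B : ℝ, 1 ≤ B → ∀ᶠ j in atTop, ∀ ζ : ℂ, ‖ζ‖ ≤ B →
      (r j * ζ : ℂ) ∈ Metric.ball (0:ℂ) ρ ∧ 0 ≤ V j ζ ∧ V j ζ ≤ 2 * B ^ (3/2 : ℝ) := by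
    intro B hB
    filter_upwards [hsmall B (by linarith) r3 hr3] with j hj ζ hζ
    have hb := hball j B ζ hj hζ
    refine ⟨hb, mul_nonneg (by positivity) (hunn _ hb), ?_⟩
    refine (hrn j).2.2.2 B hB hj.le _ ?_
    have := hrp j
    simp [abs_of_pos this]
    nlinarith
  have hYB : ∀ (m : ℕ) (B : ℝ), 1 ≤ B → ∃ C, ∀ᶠ j in atTop, ∀ ζ : ℂ, ‖ζ‖ ≤ B → ‖Y j m ζ‖ ≤ C := by
    intro m B hB
    have hsucc : ∀ m : ℕ, ∃ C, ∀ᶠ j in atTop, ∀ ζ : ℂ, ‖ζ‖ ≤ B → ‖Y j (m+1) ζ‖ ≤ C := by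
      intro m
      refine ⟨Real.exp (jl_D p m * (2 * B ^ (3/2 : ℝ)) + 2 * K), ?_⟩
      filter_upwards [hVB B hB] with j hj ζ hζ
      obtain ⟨h1, h2, h3⟩ := hj ζ hζ
      have h4 := ((hYorb j ζ h1).shift hG m).norm_le (K := K) (fun i => hG (m + i))
      rw [(hYorb j ζ h1).G_shift hG m, hYV j ζ h1] at h4
      refine h4.trans (Real.exp_le_exp.2 ?_)
      have := jl_D_pos hG m
      gcongr
    cases m with
    | succ m => exact hsucc m
    | zero =>
      obtain ⟨C, hC⟩ := hsucc 0
      refine ⟨max C R, ?_⟩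
      filter_upwards [hC, hVB B hB] with j hj hj2 ζ hζ
      have h4 := (hYorb j ζ (hj2 ζ hζ).1).W
      exact h4.trans (max_le_max_right _ (hj ζ hζ))
  have hX : ∀ m ζ, ∃ a, Tendsto (fun j => Y j m ζ) 𝓕 (𝓝 a) := by
    intro m ζ
    obtain ⟨C, hC⟩ := hYB m (max 1 ‖ζ‖) (le_max_left _ _)
    refine jl_ultra_lim 𝓕 _ C ?_
    filter_upwards [hle hC] with j hj using hj ζ (le_max_right _ _)
  choose X hX using hX
  have hmon : ∀ m (B : ℝ), 1 ≤ B →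
      TendstoLocallyUniformlyOn (fun j => Y j m) (X m) 𝓕 (Metric.ball 0 B) ∧
      DifferentiableOn ℂ (X m) (Metric.ball 0 B) := by
    intro m B hB
    obtain ⟨C, hC⟩ := hYB m (2 * B) (by linarith)
    have := jl_montel 𝓕 (fun j => Y j m) (X m) 0 (2 * B) C (by linarith) (by
      filter_upwards [hle hC, hle (hVB (2*B) (by linarith))] with j h1 h2
      constructor
      · refine (h.diff _).comp (t := Metric.ball 0 ρ) (by fun_prop) ?_
        intro ζ hζ
        exact (h2 ζ (by simpa using (Metric.mem_ball.1 hζ).le)).1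
      · intro ζ hζ
        exact h1 ζ (by simpa using (Metric.mem_ball.1 hζ).le)) (fun ζ _ => hX m ζ)
    rwa [mul_div_cancel_left₀ _ (two_ne_zero)] at this
  have hXd : ∀ m, Differentiable ℂ (X m) := by
    intro m ζ
    refine (hmon m (‖ζ‖ + 1) (by linarith [norm_nonneg ζ])).2.differentiableAt ?_
    exact Metric.isOpen_ball.mem_nhds (by simp)
  have hev : ∀ (ζs : ℕ → ℂ) (ζ : ℂ), Tendsto ζs 𝓕 (𝓝 ζ) →
      ∀ᶠ j in (𝓕 : Filter ℕ), (r j * ζs j : ℂ) ∈ Metric.ball (0:ℂ) ρ := by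
    intro ζs ζ hζ
    have h1 : ∀ᶠ j in (𝓕 : Filter ℕ), ‖ζs j‖ < ‖ζ‖ + 1 :=
      (hζ.norm).eventually_lt_const (by linarith)
    filter_upwards [h1, hle (hVB (‖ζ‖ + 1) (by linarith [norm_nonneg ζ]))] with j h1 h2
    exact (h2 _ h1.le).1
  have hXorb : ∀ ζ, JlOrb p δ R (fun m => X m ζ) := by
    intro ζ
    have h1 : ∀ᶠ j in (𝓕 : Filter ℕ), JlOrb p δ R (fun m => Y j m ζ) := by
      filter_upwards [hev (fun _ => ζ) ζ tendsto_const_nhds] with j hj using hYorb j ζ hj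
    constructor
    · intro m
      refine tendsto_nhds_unique_of_eventuallyEq (hX (m+2) ζ)
        ((((p m).continuous.tendsto _).comp (hX (m+1) ζ)).sub ((hX m ζ).const_mul (δ m))) ?_
      filter_upwards [h1] with j hj using hj.orb m
    · refine le_of_tendsto_of_tendsto (hX 0 ζ).norm ((hX 1 ζ).norm.max tendsto_const_nhds) ?_
      filter_upwards [h1] with j hj using hj.W
  set U : ℂ → ℝ := fun ζ => jl_G p (fun m => X m ζ) with hU
  have hVU : ∀ (ζs : ℕ → ℂ) (ζ : ℂ), Tendsto ζs 𝓕 (𝓝 ζ) →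
      Tendsto (fun j => V j (ζs j)) 𝓕 (𝓝 (U ζ)) := by
    intro ζs ζ hζ
    have h1 : Tendsto (fun j => jl_G p (fun m => Y j m (ζs j))) 𝓕 (𝓝 (U ζ)) := by
      refine JlOrb.G_lim hG ?_ (hXorb ζ) fun m => ?_
      · filter_upwards [hev ζs ζ hζ] with j hj using hYorb j _ hj
      · have hm : ζ ∈ Metric.ball (0:ℂ) (‖ζ‖ + 1) := by simp
        refine (hmon m (‖ζ‖ + 1) (by linarith [norm_nonneg ζ])).1.tendsto_comp
          (hXd m).continuous.continuousWithinAt hm ?_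
        rw [Metric.isOpen_ball.nhdsWithin_eq hm]
        exact hζ
    refine h1.congr' ?_
    filter_upwards [hev ζs ζ hζ] with j hj using hYV j _ hj
  have hVU' : ∀ ζ, Tendsto (fun j => V j ζ) 𝓕 (𝓝 (U ζ)) := fun ζ =>
    hVU (fun _ => ζ) ζ tendsto_const_nhds
  have hUnn : ∀ ζ, 0 ≤ U ζ := fun ζ => (hXorb ζ).G_nonneg hG
  have hUc : Continuous U := by
    rw [continuous_iff_continuousAt]
    intro ζ
    exact JlOrb.G_lim hG (Eventually.of_forall hXorb) (hXorb ζ)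
      fun m => (hXd m).continuous.continuousAt
  have hUgrow : ∀ ζ, U ζ ≤ 2 * ((1 + ‖ζ‖) * √(1 + ‖ζ‖)) := by
    intro ζ
    have h1 : (0:ℝ) < 1 + ‖ζ‖ := by positivity
    have h2 : (1 + ‖ζ‖) * √(1 + ‖ζ‖) = (1 + ‖ζ‖) ^ (3/2 : ℝ) := by
      rw [Real.sqrt_eq_rpow]
      nth_rewrite 1 [← Real.rpow_one (1 + ‖ζ‖)]
      rw [← Real.rpow_add h1]
      norm_num
    rw [h2]
    refine le_of_tendsto (hVU' ζ) ?_
    filter_upwards [hle (hVB (1 + ‖ζ‖) (by linarith [norm_nonneg ζ]))] with j hj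
    exact (hj ζ (by linarith)).2.2
  have hUreal : ∀ t : ℝ, U t = 0 := by
    intro t
    have hcl : IsClosed {ζ | U ζ = 0} := isClosed_eq hUc continuous_const
    have : (t : ℂ) ∈ closure {ζ | U ζ = 0} := by
      rw [Metric.mem_closure_iff]
      intro ε hε
      obtain ⟨r0, hr0, hr0E⟩ := T2 t (ε/2) (by positivity)
      have : ∀ j, ∃ e, r j < r0 → e ∈ E ∧ ‖e - r j * t‖ ≤ ε/2 * r j := by
        intro j
        by_cases hj : r j < r0
        · obtain ⟨e, he⟩ := hr0E (r j) (hrp j) hj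
          exact ⟨e, fun _ => he⟩
        · exact ⟨0, fun h => absurd h hj⟩
      choose e he using this
      have hev1 : ∀ᶠ j in (𝓕 : Filter ℕ), r j < r0 :=
        hle (hrlim.eventually_lt_const hr0)
      have hd : ∀ᶠ j in (𝓕 : Filter ℕ), ‖e j / r j - t‖ ≤ ε/2 := by
        filter_upwards [hev1] with j hj
        have h1 := (he j hj).2
        have hne : (r j : ℂ) ≠ 0 := by exact_mod_cast (hrp j).ne'
        have h2 : e j / r j - t = (e j - r j * t) / r j := by field_simp
        rw [h2, norm_div, Complex.norm_real, Real.norm_of_nonneg (hrp j).le, div_le_iff₀ (hrp j)]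
        exact h1
      obtain ⟨a, ha⟩ := jl_ultra_lim 𝓕 (fun j => e j / r j) (|t| + ε/2) (by
        filter_upwards [hd] with j hj
        have := norm_sub_norm_le (e j / r j) (t:ℂ)
        rw [Complex.norm_real, Real.norm_eq_abs] at this
        linarith)
      refine ⟨a, ?_, ?_⟩
      · refine tendsto_nhds_unique (hVU _ a ha) ?_
        refine tendsto_const_nhds.congr' ?_
        filter_upwards [hev _ a ha, hev1] with j h1 h2
        have hne : (r j : ℂ) ≠ 0 := by exact_mod_cast (hrp j).ne'
        have h3 : (r j * (e j / r j) : ℂ) = e j := by field_simp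
        simp only [hV]
        rw [h3] at h1 ⊢
        rw [huE _ h1 (he j h2).1, mul_zero]
      · rw [dist_comm, dist_eq_norm]
        have h1 : ‖a - t‖ ≤ ε/2 := le_of_tendsto (ha.sub_const (t:ℂ)).norm hd
        linarith
    rw [hcl.closure_eq] at this
    exact this
  have hUh : ∀ ζ : ℂ, ζ.im ≠ 0 → HarmonicAt U ζ := by
    intro ζ hζ
    set q := |ζ.im| / 2 with hq
    have hqp : 0 < q := by positivity
    set B := 1 + ‖ζ‖ + q with hB
    have hB1 : 1 ≤ B := by rw [hB]; linarith [norm_nonneg ζ]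
    have hBp : 0 < B := by linarith
    obtain ⟨r0, hr0, hr0E⟩ := T1 (q / B) (by positivity)
    refine jl_harm_lim 𝓕 V U ζ q (2 * B ^ (3/2 : ℝ)) hqp ?_ (fun z _ => hVU' z)
    filter_upwards [hle (hVB B hB1), hle (hsmall B hBp.le r0 hr0)] with j h1 h2
    have hin : ∀ w ∈ Metric.ball ζ q, ‖w‖ < B ∧ q < |w.im| := by
      intro w hw
      have h3 : ‖w - ζ‖ < q := by simpa [dist_eq_norm] using hw
      have h4 := norm_sub_norm_le w ζ
      have h5 := Complex.abs_im_le_norm (w - ζ)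
      have h6 := abs_sub_abs_le_abs_sub ζ.im w.im
      rw [abs_sub_comm, ← Complex.sub_im] at h6
      constructor
      · rw [hB]; linarith
      · have : |ζ.im| = 2 * q := by rw [hq]; ring
        linarith
    constructor
    · intro w hw
      obtain ⟨h3, h4⟩ := hin w hw
      have hrj := hrp j
      have hnE : (r j * w : ℂ) ∉ E := by
        intro hE
        have h5 : ‖(r j * w : ℂ)‖ = r j * ‖w‖ := by simp [abs_of_pos hrj]
        have h6 := hr0E _ hE (by rw [h5]; nlinarith)
        rw [h5] at h6
        have h7 : |(r j * w : ℂ).im| = r j * |w.im| := by simp [abs_mul, abs_of_pos hrj]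
        rw [h7] at h6
        have h8 : q / B * (r j * ‖w‖) ≤ r j * q := by
          calc q / B * (r j * ‖w‖) ≤ q / B * (r j * B) := by gcongr
            _ = r j * q := by field_simp
        have h9 : r j * |w.im| ≤ r j * q := h6.trans h8
        have := le_of_mul_le_mul_left h9 hrj
        linarith
      have h10 := h.harm hG (h1 w h3.le).1 hnE
      have h11 : HarmonicAt (fun ζ => u (r j * ζ)) w :=
        jl_harm_comp (U := u) (g := fun ζ => r j * ζ) h10 (by fun_prop)
      exact h11.const_smul (c := D ^ n j)
    · intro w hw
      obtain ⟨-, h3, h4⟩ := h1 w (hin w hw).1.le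
      rwa [abs_of_nonneg h3]
  obtain ⟨ζ1, hζ1⟩ : ∃ ζ, 0 < U ζ := by
    have : ∀ j, ∃ z, ‖z‖ ≤ r j ∧ D⁻¹ ≤ D ^ n j * u z := fun j => (hrn j).2.2.1
    choose z hz hz2 using this
    obtain ⟨a, ha⟩ := jl_ultra_lim 𝓕 (fun j => z j / r j) 1 (Eventually.of_forall fun j => by
      rw [norm_div, Complex.norm_real, Real.norm_of_nonneg (hrp j).le, div_le_one (hrp j)]
      exact hz j)
    refine ⟨a, lt_of_lt_of_le (inv_pos.2 hDp) (ge_of_tendsto' (hVU _ a ha) fun j => ?_)⟩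
    have hne : (r j : ℂ) ≠ 0 := by exact_mod_cast (hrp j).ne'
    have h3 : (r j * (z j / r j) : ℂ) = z j := by field_simp
    simp only [hV]
    rw [h3]
    exact hz2 j
  obtain ⟨a, ha, hUa⟩ := jl_linear hUc hUnn (fun z hz => hUh z hz.ne') hUreal 2 hUgrow
  obtain ⟨b, hb, hUb⟩ := jl_linear (U := fun ζ => U (-ζ)) (by fun_prop) (fun ζ => hUnn _)
    (fun z hz => jl_harm_comp (U := U) (g := fun ζ => -ζ) (hUh (-z) (by simpa using hz.ne'))
      (by fun_prop)) (fun t => by simpa using hUreal (-t)) 2 (fun ζ => by simpa using hUgrow (-ζ))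
  refine jl_no_model hG hXd hXorb ha hb ?_ hUa hUb
  by_contra hcon
  push Not at hcon
  have ha0 : a = 0 := le_antisymm hcon.1 ha
  have hb0 : b = 0 := le_antisymm hcon.2 hb
  rcases le_total 0 ζ1.im with h1 | h1
  · rw [hUa ζ1 h1, ha0] at hζ1
    simp at hζ1
  · have := hUb (-ζ1) (by simpa using h1)
    simp only [neg_neg] at this
    rw [this, hb0] at hζ1
    simp at hζ1

end


theorem jl_len_ge {η : ℝ → ℂ} {s t : ℝ} (hst : s ≤ t) (hc : ContinuousOn η (Icc s t)) :
    ENNReal.ofReal (dist (η s) (η t)) ≤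
      (MeasureTheory.Measure.hausdorffMeasure 1 : MeasureTheory.Measure ℂ) (η '' Icc s t) := by
  have hl : LipschitzWith 1 (fun z : ℂ => dist z (η s)) := LipschitzWith.dist_left _
  have h1 := hl.hausdorffMeasure_image_le (d := 1) zero_le_one (η '' Icc s t)
  simp only [ENNReal.coe_one, ENNReal.one_rpow, one_mul] at h1
  refine le_trans ?_ h1
  rw [MeasureTheory.hausdorffMeasure_real, image_image]
  have h2 : Icc (dist (η s) (η s)) (dist (η t) (η s)) ⊆ (fun x => dist (η x) (η s)) '' Icc s t :=
    intermediate_value_Icc (f := fun x => dist (η x) (η s)) hst (by fun_prop)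
  refine le_trans ?_ (MeasureTheory.measure_mono h2)
  rw [Real.volume_Icc, dist_self, sub_zero, dist_comm]

theorem jl_arc_param {η : ℝ → ℂ} (hinj : InjOn η (Icc 0 1)) (hc : ContinuousOn η (Icc 0 1))
    (hfin : (MeasureTheory.Measure.hausdorffMeasure 1 : MeasureTheory.Measure ℂ)
      (η '' Icc 0 1) ≠ ⊤) :
    ∃ L > 0, ∃ ξ : ℝ → ℂ, LipschitzOnWith 1 ξ (Icc 0 L) ∧ InjOn ξ (Icc 0 L) ∧
      ξ '' Icc 0 L = η '' Icc 0 1 := by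
  set μ : MeasureTheory.Measure ℂ := MeasureTheory.Measure.hausdorffMeasure 1 with hμ
  have hat : MeasureTheory.NullSingletonClass μ :=
    MeasureTheory.Measure.nullSingletonClass_hausdorff ℂ one_pos
  have hemb := hc.measurableEmbedding measurableSet_Icc hinj
  set ν : MeasureTheory.Measure ℝ :=
    (MeasureTheory.Measure.comap ((Icc (0:ℝ) 1).domRestrict η) μ).map Subtype.val with hν
  have hνA : ∀ A, MeasurableSet A → ν A = μ (η '' (A ∩ Icc 0 1)) := by
    intro A hA
    rw [hν, MeasureTheory.Measure.map_apply measurable_subtype_coe hA, hemb.comap_apply]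
    congr 1
    ext z
    constructor
    · rintro ⟨x, hx, rfl⟩
      exact ⟨x, ⟨hx, x.2⟩, rfl⟩
    · rintro ⟨x, ⟨hx, hx2⟩, rfl⟩
      exact ⟨⟨x, hx2⟩, hx, rfl⟩
  have hνf : MeasureTheory.IsFiniteMeasure ν := by
    constructor
    rw [hνA _ MeasurableSet.univ, univ_inter]
    exact hfin.lt_top
  have hν0 : ∀ t, ν {t} = 0 := by
    intro t
    rw [hνA _ (measurableSet_singleton t)]
    refine MeasureTheory.measure_mono_null (t := {η t}) ?_ (MeasureTheory.measure_singleton _)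
    rintro _ ⟨x, ⟨hx, -⟩, rfl⟩
    rw [mem_singleton_iff.1 hx]
    rfl
  set m : ℝ → ℝ := fun t => ν.real (Iic t) with hm
  have hmd : ∀ s t, s ≤ t → m t - m s = ν.real (Ioc s t) := by
    intro s t hst
    rw [← Iic_sdiff_Iic, MeasureTheory.measureReal_sdiff (Iic_subset_Iic.2 hst) measurableSet_Iic]
  have hmono : Monotone m := fun s t hst => by
    have := hmd s t hst
    have h2 : 0 ≤ ν.real (Ioc s t) := MeasureTheory.measureReal_nonneg
    linarith
  have hdist : ∀ s t, 0 ≤ s → s ≤ t → t ≤ 1 → dist (η s) (η t) ≤ m t - m s := by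
    intro s t hs hst ht
    rw [hmd s t hst, MeasureTheory.measureReal_def, ← ENNReal.ofReal_le_iff_le_toReal
      (MeasureTheory.measure_ne_top _ _)]
    have h1 : ν (Icc s t) ≤ ν (Ioc s t) := by
      have : Icc s t ⊆ Ioc s t ∪ {s} := by
        intro x hx
        rcases hx.1.eq_or_lt with h | h
        · right; exact h.symm
        · left; exact ⟨h, hx.2⟩
      refine (MeasureTheory.measure_mono this).trans ((MeasureTheory.measure_union_le _ _).trans ?_)
      rw [hν0, add_zero]
    refine le_trans ?_ h1
    have hsub : Icc s t ⊆ Icc 0 1 := Icc_subset_Icc hs ht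
    rw [hνA _ measurableSet_Icc, inter_eq_left.2 hsub]
    exact jl_len_ge hst (hc.mono hsub)
  have hmc : Continuous m := by
    rw [continuous_iff_continuousAt]
    intro t
    rw [ContinuousAt, tendsto_iff_dist_tendsto_zero]
    have h1 : Tendsto (fun r => ν (Metric.cthickening r {t})) (𝓝 0) (𝓝 (ν {t})) :=
      tendsto_measure_cthickening_of_isClosed
        ⟨1, one_pos, MeasureTheory.measure_ne_top _ _⟩ isClosed_singleton
    rw [hν0] at h1
    have h2 : Tendsto (fun r => ν.real (Metric.cthickening r {t})) (𝓝 0) (𝓝 0) := by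
      have := (ENNReal.tendsto_toReal ENNReal.zero_ne_top).comp h1
      exact this
    have h3 : Tendsto (fun s => |s - t|) (𝓝 t) (𝓝 0) := by
      have : Continuous (fun s => |s - t|) := by fun_prop
      simpa using this.tendsto t
    refine squeeze_zero (fun _ => dist_nonneg) (fun s => ?_) (h2.comp h3)
    simp only [comp]
    rw [Metric.cthickening_singleton _ (abs_nonneg _), Real.dist_eq]
    have key : ∀ a b, a ≤ b → Ioc a b ⊆ Metric.closedBall t |s - t| →
        |m b - m a| ≤ ν.real (Metric.closedBall t |s - t|) := by
      intro a b hab hsub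
      rw [hmd a b hab, abs_of_nonneg MeasureTheory.measureReal_nonneg]
      exact MeasureTheory.measureReal_mono hsub
    rcases le_total s t with h | h
    · rw [abs_sub_comm]
      refine key s t h fun x hx => ?_
      rw [Metric.mem_closedBall, Real.dist_eq, abs_sub_comm, abs_sub_comm s]
      rw [abs_of_nonneg (by linarith [hx.2]), abs_of_nonneg (by linarith)]
      linarith [hx.1]
    · refine key t s h fun x hx => ?_
      rw [Metric.mem_closedBall, Real.dist_eq]
      rw [abs_of_nonneg (by linarith [hx.1]), abs_of_nonneg (by linarith)]
      linarith [hx.2]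
  have hsm : ∀ s t, 0 ≤ s → s < t → t ≤ 1 → m s < m t := by
    intro s t hs hst ht
    have h1 := hdist s t hs hst.le ht
    have h2 : 0 < dist (η s) (η t) := by
      rw [dist_pos]
      intro h
      exact hst.ne (hinj ⟨hs, hst.le.trans ht⟩ ⟨hs.trans hst.le, ht⟩ h)
    linarith
  have hσ : ∀ x, ∃ t, x ∈ Icc 0 (m 1 - m 0) → t ∈ Icc (0:ℝ) 1 ∧ m t - m 0 = x := by
    intro x
    by_cases hx : x ∈ Icc 0 (m 1 - m 0)
    · obtain ⟨t, ht, ht2⟩ := intermediate_value_Icc (f := m) zero_le_one hmc.continuousOn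
        (show x + m 0 ∈ Icc (m 0) (m 1) from ⟨by linarith [hx.1], by linarith [hx.2]⟩)
      exact ⟨t, fun _ => ⟨ht, by rw [ht2]; ring⟩⟩
    · exact ⟨0, fun h => absurd h hx⟩
  choose σ hσ using hσ
  have hσm : ∀ t ∈ Icc (0:ℝ) 1, m t - m 0 ∈ Icc 0 (m 1 - m 0) ∧ σ (m t - m 0) = t := by
    intro t ht
    have h1 : m t - m 0 ∈ Icc 0 (m 1 - m 0) :=
      ⟨by linarith [hmono ht.1], by linarith [hmono ht.2]⟩
    refine ⟨h1, ?_⟩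
    obtain ⟨h2, h3⟩ := hσ _ h1
    rcases lt_trichotomy (σ (m t - m 0)) t with h | h | h
    · have := hsm _ _ h2.1 h ht.2
      linarith
    · exact h
    · have := hsm _ _ ht.1 h h2.2
      linarith
  refine ⟨m 1 - m 0, by linarith [hsm 0 1 le_rfl one_pos le_rfl], fun x => η (σ x), ?_, ?_, ?_⟩
  · refine LipschitzOnWith.of_dist_le_mul ?_
    intro x hx y hy
    obtain ⟨h1, h2⟩ := hσ x hx
    obtain ⟨h3, h4⟩ := hσ y hy
    simp only [NNReal.coe_one, one_mul]
    rcases le_total (σ x) (σ y) with h | h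
    · refine (hdist _ _ h1.1 h h3.2).trans ?_
      rw [Real.dist_eq, abs_sub_comm]
      exact le_trans (by linarith) (le_abs_self _)
    · rw [dist_comm]
      refine (hdist _ _ h3.1 h h1.2).trans ?_
      rw [Real.dist_eq]
      exact le_trans (by linarith) (le_abs_self _)
  · intro x hx y hy hxy
    obtain ⟨h1, h2⟩ := hσ x hx
    obtain ⟨h3, h4⟩ := hσ y hy
    have := hinj h1 h3 hxy
    rw [← h2, ← h4, this]
  · ext z
    constructor
    · rintro ⟨x, hx, rfl⟩
      exact ⟨σ x, (hσ x hx).1, rfl⟩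
    · rintro ⟨t, ht, rfl⟩
      obtain ⟨h1, h2⟩ := hσm t ht
      exact ⟨_, h1, by simp only [h2]⟩

/-- The set `E` has a tangent line at `x` of direction `v`, and is approached from above. -/
structure JlTangent (E : Set ℂ) (x v : ℂ) : Prop where
  mem : x ∈ E
  v0 : v ≠ 0
  T1 : ∀ ε > 0, ∃ r0 > 0, ∀ ζ : ℂ, x + v * ζ ∈ E → ‖ζ‖ < r0 → |ζ.im| ≤ ε * ‖ζ‖
  T2 : ∀ t : ℝ, ∀ ε > 0, ∃ r0 > 0, ∀ r : ℝ, 0 < r → r < r0 →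
    ∃ e : ℂ, x + v * e ∈ E ∧ ‖e - r * t‖ ≤ ε * r

theorem JlTangent.neg {E : Set ℂ} {x v : ℂ} (h : JlTangent E x v) : JlTangent E x (-v) := by
  refine ⟨h.mem, neg_ne_zero.2 h.v0, fun ε hε => ?_, fun t ε hε => ?_⟩
  · obtain ⟨r0, hr0, h1⟩ := h.T1 ε hε
    refine ⟨r0, hr0, fun ζ hζ hn => ?_⟩
    have := h1 (-ζ) (by rwa [mul_neg, ← neg_mul]) (by simpa using hn)
    simpa using this
  · obtain ⟨r0, hr0, h1⟩ := h.T2 (-t) ε hε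
    refine ⟨r0, hr0, fun r hr hn => ?_⟩
    obtain ⟨e, he, he2⟩ := h1 r hr hn
    refine ⟨-e, by rwa [neg_mul_neg], ?_⟩
    rw [← norm_neg]
    have e1 : -(-e - (r:ℂ) * (t:ℂ)) = e - (r:ℂ) * ((-t : ℝ) : ℂ) := by
      push_cast
      ring
    rwa [e1]

theorem JlTangent.of_deriv {L : ℝ} {ξ : ℝ → ℂ} (hc : ContinuousOn ξ (Icc 0 L))
    (hinj : InjOn ξ (Icc 0 L)) {s0 : ℝ} (hs0 : s0 ∈ Ioo 0 L) {v : ℂ} (hv : v ≠ 0)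
    (hd : HasDerivAt ξ v s0) : JlTangent (ξ '' Icc 0 L) (ξ s0) v := by
  have hd' : ∀ ε > 0, ∃ δ > 0, ∀ s, |s - s0| < δ → s ∈ Icc 0 L ∧
      ‖(ξ s - ξ s0) / v - ((s - s0 : ℝ) : ℂ)‖ ≤ ε * |s - s0| := by
    intro ε hε
    have h1 := (hasDerivAt_iff_isLittleO.1 hd).def (c := ε * ‖v‖) (by positivity)
    have h2 : ∀ᶠ s in 𝓝 s0, s ∈ Icc 0 L := Icc_mem_nhds hs0.1 hs0.2
    obtain ⟨d, hd, h3⟩ := Metric.eventually_nhds_iff.1 (h1.and h2)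
    refine ⟨d, hd, fun s hs => ?_⟩
    obtain ⟨h4, h5⟩ := h3 (y := s) (by rwa [Real.dist_eq])
    refine ⟨h5, ?_⟩
    have h6 : (ξ s - ξ s0) / v - ((s - s0 : ℝ) : ℂ) = (ξ s - ξ s0 - (s - s0) • v) / v := by
      rw [Complex.real_smul]
      field_simp
    rw [h6, norm_div, div_le_iff₀ (by positivity)]
    rw [Real.norm_eq_abs] at h4
    linarith
  refine ⟨⟨s0, ⟨hs0.1.le, hs0.2.le⟩, rfl⟩, hv, fun ε hε => ?_, fun t ε hε => ?_⟩
  · obtain ⟨δ, hδ, h1⟩ := hd' (min (ε/2) (1/2)) (by positivity)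
    set F : Set ℂ := ξ '' (Icc 0 L \ Metric.ball s0 δ) with hF
    have hFc : IsCompact F := (isCompact_Icc.diff Metric.isOpen_ball).image_of_continuousOn
      (hc.mono sdiff_subset)
    have hx : ξ s0 ∉ F := by
      rintro ⟨s, hs, hs2⟩
      have := hinj hs.1 ⟨hs0.1.le, hs0.2.le⟩ hs2
      rw [this] at hs
      exact hs.2 (Metric.mem_ball_self hδ)
    obtain ⟨d, hd0, hd1⟩ := Metric.isOpen_iff.1 hFc.isClosed.isOpen_compl (ξ s0) hx
    refine ⟨d / ‖v‖, by positivity, ?_⟩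
    rintro ζ ⟨s, hs, hs2⟩ hζ
    rw [lt_div_iff₀ (by positivity)] at hζ
    have h2 : |s - s0| < δ := by
      by_contra hcon
      refine hd1 (a := ξ s) ?_ ⟨s, ⟨hs, by rwa [Metric.mem_ball, Real.dist_eq]⟩, rfl⟩
      rw [hs2, Metric.mem_ball, dist_eq_norm]
      simp only [add_sub_cancel_left, norm_mul]
      linarith
    have h3 := (h1 s h2).2
    have h4 : (ξ s - ξ s0) / v = ζ := by rw [hs2]; field_simp; ring
    rw [h4] at h3
    have h5 : |ζ.im| ≤ ‖ζ - ((s - s0 : ℝ) : ℂ)‖ := by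
      have := Complex.abs_im_le_norm (ζ - ((s - s0 : ℝ) : ℂ))
      rwa [Complex.sub_im, Complex.ofReal_im, sub_zero] at this
    have h6 : |s - s0| - ‖ζ - ((s - s0 : ℝ) : ℂ)‖ ≤ ‖ζ‖ := by
      have := norm_sub_norm_le ((s - s0 : ℝ) : ℂ) ζ
      rw [norm_sub_rev, Complex.norm_real, Real.norm_eq_abs] at this
      linarith
    have h7 : min (ε/2) (1/2) * |s - s0| ≤ 1/2 * |s - s0| := by gcongr; exact min_le_right _ _
    have h8 : min (ε/2) (1/2) * |s - s0| ≤ ε/2 * |s - s0| := by gcongr; exact min_le_left _ _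
    nlinarith
  · obtain ⟨δ, hδ, h1⟩ := hd' (ε / (|t| + 1)) (by positivity)
    refine ⟨δ / (|t| + 1), by positivity, fun r hr hr2 => ?_⟩
    rw [lt_div_iff₀ (by positivity)] at hr2
    have h2 : |s0 + r * t - s0| = r * |t| := by rw [add_sub_cancel_left, abs_mul, abs_of_pos hr]
    obtain ⟨h3, h4⟩ := h1 (s0 + r * t) (by rw [h2]; linarith)
    refine ⟨(ξ (s0 + r * t) - ξ s0) / v, ⟨_, h3, by field_simp; ring⟩, ?_⟩
    rw [h2] at h4
    rw [add_sub_cancel_left] at h4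
    push_cast at h4
    refine h4.trans ?_
    rw [div_mul_eq_mul_div, div_le_iff₀ (by positivity)]
    have : ε * r * (|t| + 1) = ε * (r * |t|) + ε * r := by ring
    rw [this]
    have : 0 < ε * r := by positivity
    linarith


theorem jl_good_point {L : ℝ} (hL : 0 < L) {ξ : ℝ → ℂ} (hl : LipschitzOnWith 1 ξ (Icc 0 L))
    (hinj : InjOn ξ (Icc 0 L)) (hne : (ξ 0).re ≠ (ξ L).re) :
    ∃ x v, JlTangent (ξ '' Icc 0 L) x v ∧ ∃ w : ℂ, 0 < w.im ∧
      ∀ τ : ℝ, 0 < τ → x + v * (τ * w) ∉ ξ '' Icc 0 L := by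
  set g : ℝ → ℝ := fun s => (ξ s).re with hg
  have hξc : ContinuousOn ξ (Icc 0 L) := hl.continuousOn
  have hgc : ContinuousOn g (Icc 0 L) := Complex.continuous_re.comp_continuousOn hξc
  have hgl : LipschitzOnWith 1 g (Icc 0 L) := by
    refine LipschitzOnWith.of_dist_le_mul fun x hx y hy => ?_
    refine le_trans ?_ (hl.dist_le_mul x hx y hy)
    rw [Real.dist_eq, dist_eq_norm, hg]
    simp only
    rw [← Complex.sub_re]
    exact Complex.abs_re_le_norm _
  set B1 : Set ℝ := {s ∈ Icc 0 L | ¬ DifferentiableWithinAt ℝ ξ (Icc 0 L) s} with hB1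
  set B2 : Set ℝ := {s ∈ Ioo 0 L | HasDerivAt g 0 s} with hB2
  have hB1n : MeasureTheory.volume (g '' B1) = 0 := by
    have h1 : MeasureTheory.volume B1 = 0 := by
      have := hl.ae_differentiableWithinAt_real measurableSet_Icc
      rw [MeasureTheory.ae_restrict_iff' measurableSet_Icc, MeasureTheory.ae_iff] at this
      refine MeasureTheory.measure_mono_null ?_ this
      rintro s ⟨h1, h2⟩
      simp only [mem_ofPred_eq, not_forall]
      exact ⟨h1, h2⟩
    have h2 := (hgl.mono (show B1 ⊆ Icc 0 L from fun s hs => hs.1)).hausdorffMeasure_image_le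
      (d := 1) zero_le_one
    rw [MeasureTheory.hausdorffMeasure_real, h1, mul_zero] at h2
    exact le_antisymm h2 bot_le
  have hB2n : MeasureTheory.volume (g '' B2) = 0 := by
    refine MeasureTheory.addHaar_image_eq_zero_of_det_fderivWithin_eq_zero MeasureTheory.volume
      (f' := fun _ => 0) ?_ ?_
    · intro s hs
      have := hs.2.hasFDerivAt.hasFDerivWithinAt (s := B2)
      rwa [ContinuousLinearMap.toSpanSingleton_zero] at this
    · intro s hs
      simp [ContinuousLinearMap.det]
  have hB3n : MeasureTheory.volume (g '' {0, L}) = 0 :=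
    ((Set.toFinite {0, L}).image g).measure_zero _
  obtain ⟨t, ht, htB⟩ : ∃ t ∈ g '' Icc 0 L, t ∉ g '' B1 ∪ g '' B2 ∪ g '' {0, L} := by
    by_contra hcon
    push Not at hcon
    have h1 : MeasureTheory.volume (g '' Icc 0 L) = 0 :=
      MeasureTheory.measure_mono_null hcon (MeasureTheory.measure_union_null
        (MeasureTheory.measure_union_null hB1n hB2n) hB3n)
    have h2 : uIcc (g 0) (g L) ⊆ g '' Icc 0 L := by
      have := intermediate_value_uIcc (a := 0) (b := L) (f := g) (by rwa [uIcc_of_le hL.le])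
      rwa [uIcc_of_le hL.le] at this
    have h3 := MeasureTheory.measure_mono_null h2 h1
    rw [Real.volume_interval] at h3
    simp [sub_eq_zero] at h3
    exact hne h3.symm
  have hFc : IsCompact (Icc 0 L ∩ g ⁻¹' {t}) :=
    isCompact_Icc.of_isClosed_subset (hgc.preimage_isClosed_of_isClosed isClosed_Icc
      isClosed_singleton) inter_subset_left
  obtain ⟨s1, hs1, hs1t⟩ := ht
  obtain ⟨s0, ⟨hs0, hs0t⟩, hmax⟩ := hFc.exists_isMaxOn ⟨s1, hs1, hs1t⟩
    (f := fun s => (ξ s).im) (Complex.continuous_im.comp_continuousOn (hξc.mono inter_subset_left))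
  have hs0t' : g s0 = t := hs0t
  simp only [mem_union, not_or] at htB
  obtain ⟨⟨hb1, hb2⟩, hb3⟩ := htB
  have hs0' : s0 ∈ Ioo 0 L := by
    constructor
    · refine lt_of_le_of_ne hs0.1 fun h => hb3 ⟨s0, Or.inl h.symm, hs0t'⟩
    · refine lt_of_le_of_ne hs0.2 fun h => hb3 ⟨s0, Or.inr h, hs0t'⟩
  have hdiff : DifferentiableAt ℝ ξ s0 := by
    by_contra hcon
    refine hb1 ⟨s0, ⟨hs0, fun h => hcon ?_⟩, hs0t'⟩
    exact h.differentiableAt (Icc_mem_nhds hs0'.1 hs0'.2)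
  set v := deriv ξ s0 with hv
  have hd : HasDerivAt ξ v s0 := hdiff.hasDerivAt
  have hgd : HasDerivAt g v.re s0 := by
    have := Complex.reCLM.hasFDerivAt.comp_hasDerivAt s0 hd
    exact this
  have hvre : v.re ≠ 0 := by
    intro h
    rw [h] at hgd
    exact hb2 ⟨s0, ⟨hs0', hgd⟩, hs0t'⟩
  have hv0 : v ≠ 0 := by
    intro h; rw [h] at hvre; simp at hvre
  have hT := JlTangent.of_deriv hξc hinj hs0' hv0 hd
  have hray : ∀ τ : ℝ, 0 < τ → ξ s0 + τ * Complex.I ∉ ξ '' Icc 0 L := by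
    rintro τ hτ ⟨s, hs, hs2⟩
    have h1 : g s = t := by
      rw [hg]
      simp only
      rw [hs2, ← hs0t', hg]
      simp
    have h2 : (ξ s).im ≤ (ξ s0).im := hmax ⟨hs, h1⟩
    rw [hs2] at h2
    simp at h2
    linarith
  have hwim : (Complex.I / v).im = v.re / Complex.normSq v := by
    rw [Complex.div_im]
    simp
  have hns : 0 < Complex.normSq v := Complex.normSq_pos.2 hv0
  rcases lt_or_gt_of_ne hvre with h | h
  · refine ⟨ξ s0, -v, hT.neg, -(Complex.I / v), ?_, fun τ hτ => ?_⟩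
    · rw [Complex.neg_im, hwim, ← neg_div]
      exact div_pos (by linarith) hns
    · have : -v * (τ * -(Complex.I / v)) = τ * Complex.I := by field_simp
      rw [this]
      exact hray τ hτ
  · refine ⟨ξ s0, v, hT, (Complex.I / v), ?_, fun τ hτ => ?_⟩
    · rw [hwim]
      exact div_pos (by linarith) hns
    · have : v * (τ * (Complex.I / v)) = τ * Complex.I := by field_simp
      rw [this]
      exact hray τ hτ

theorem jl_arc_point {η : ℝ → ℂ} (hinj : InjOn η (Icc 0 1)) (hc : ContinuousOn η (Icc 0 1))
    (hfin : (MeasureTheory.Measure.hausdorffMeasure 1 : MeasureTheory.Measure ℂ)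
      (η '' Icc 0 1) ≠ ⊤) :
    ∃ x v, JlTangent (η '' Icc 0 1) x v ∧ ∃ w : ℂ, 0 < w.im ∧
      ∀ τ : ℝ, 0 < τ → x + v * (τ * w) ∉ η '' Icc 0 1 := by
  obtain ⟨L, hL, ξ, hl, hi, he⟩ := jl_arc_param hinj hc hfin
  rw [← he]
  by_cases hre : (ξ 0).re = (ξ L).re
  · have him : (ξ 0).im ≠ (ξ L).im := by
      intro h
      have := hi ⟨le_rfl, hL.le⟩ ⟨hL.le, le_rfl⟩ (Complex.ext hre h)
      exact hL.ne this
    set ξr : ℝ → ℂ := fun s => -Complex.I * ξ s with hξr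
    have hmemiff : ∀ z, z ∈ ξ '' Icc 0 L ↔ -Complex.I * z ∈ ξr '' Icc 0 L := by
      intro z
      constructor
      · rintro ⟨s, hs, rfl⟩
        exact ⟨s, hs, rfl⟩
      · rintro ⟨s, hs, h⟩
        exact ⟨s, hs, mul_left_cancel₀ (by simp) h⟩
    obtain ⟨x, v, hT, w, hw, hray⟩ := jl_good_point (ξ := ξr) hL (by
        refine LipschitzOnWith.of_dist_le_mul fun x hx y hy => ?_
        refine le_trans (le_of_eq ?_) (hl.dist_le_mul x hx y hy)
        rw [dist_eq_norm, dist_eq_norm]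
        simp only [hξr]
        rw [← mul_sub, norm_mul]
        simp)
      (fun s hs t ht h => hi hs ht (mul_left_cancel₀ (by simp) h)) (by simpa [hξr] using him)
    have e : ∀ ζ, -Complex.I * (Complex.I * x + Complex.I * v * ζ) = x + v * ζ := by
      intro ζ
      linear_combination (-(x + v * ζ)) * Complex.I_mul_I
    refine ⟨Complex.I * x, Complex.I * v, ⟨?_, ?_, ?_, ?_⟩, w, hw, ?_⟩
    · rw [hmemiff]
      have := hT.mem
      have e0 := e 0
      simp only [mul_zero, add_zero] at e0
      rwa [e0]
    · simpa using hT.v0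
    · simp only [hmemiff, e]
      exact hT.T1
    · simp only [hmemiff, e]
      exact hT.T2
    · simp only [hmemiff, e]
      exact hray
  · exact jl_good_point hL hl hi hre


theorem jl_enter {p : ℕ → Polynomial ℂ} {δ : ℕ → ℂ} {R K : ℝ}
    (hG : ∀ n, JlGood (p n) (δ n) R K) {s : ℕ → ℂ}
    (horb : ∀ n, s (n + 2) = (p n).eval (s (n + 1)) - δ n * s n) (N : ℕ)
    (hN : max ‖s (N + 1)‖ R < ‖s N‖) : (2:ℝ) ^ N ≤ ‖s 0‖ := by
  have hR := (hG 0).R1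
  have key : ∀ i ≤ N, max ‖s (N - i + 1)‖ R < ‖s (N - i)‖ ∧ 2 ^ i * ‖s N‖ ≤ ‖s (N - i)‖ := by
    intro i
    induction i with
    | zero => intro _; simpa using hN
    | succ i ih =>
      intro hi
      obtain ⟨h1, h2⟩ := ih (by omega)
      obtain ⟨n, hn⟩ : ∃ n, N - i = n + 1 := ⟨N - i - 1, by omega⟩
      have hn' : N - (i + 1) = n := by omega
      rw [hn] at h1 h2
      rw [hn']
      obtain ⟨h3, h4⟩ := max_lt_iff.1 h1
      have h5 := (hG n).back _ h4.le
      have h6 : ‖(p n).eval (s (n + 1))‖ ≤ ‖s (n + 2)‖ + ‖δ n‖ * ‖s n‖ := by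
        have : (p n).eval (s (n + 1)) = s (n + 2) + δ n * s n := by rw [horb n]; ring
        rw [this, ← norm_mul]
        exact norm_add_le _ _
      have hδ : 0 < ‖δ n‖ := norm_pos_iff.2 (hG n).δ0
      have h7 : ‖δ n‖ * (2 * ‖s (n + 1)‖) ≤ ‖δ n‖ * ‖s n‖ := by
        have : ‖s (n + 1 + 1)‖ = ‖s (n + 2)‖ := rfl
        nlinarith [norm_nonneg (s (n+1))]
      have h8 := le_of_mul_le_mul_left h7 hδ
      refine ⟨max_lt ?_ ?_, ?_⟩
      · linarith
      · linarith
      · rw [pow_succ]; linarith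
  have := (key N le_rfl).2
  rw [Nat.sub_self] at this
  refine le_trans ?_ this
  have h1 := (max_lt_iff.1 hN).2
  exact le_mul_of_one_le_right (by positivity) (by linarith)

theorem jl_frontier {t s : Set ℂ} (ht : IsPreconnected t) (h1 : (t ∩ s).Nonempty)
    (h2 : (t ∩ sᶜ).Nonempty) : (t ∩ frontier s).Nonempty := by
  by_contra hcon
  rw [Set.not_nonempty_iff_eq_empty] at hcon
  have hno : ∀ z ∈ t, z ∉ frontier s := fun z hz hz2 => by
    have : z ∈ t ∩ frontier s := ⟨hz, hz2⟩
    rw [hcon] at this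
    exact this
  obtain ⟨a, hat, has⟩ := h1
  obtain ⟨b, hbt, hbs⟩ := h2
  have ha : a ∈ interior s := by
    by_contra h
    exact hno a hat ⟨subset_closure has, h⟩
  have hb : b ∈ (closure s)ᶜ := fun h => hno b hbt ⟨h, fun h' => hbs (interior_subset h')⟩
  obtain ⟨c, -, hc1, hc2⟩ := ht _ _ isOpen_interior isClosed_closure.isOpen_compl (fun z hz => by
    by_cases hz2 : z ∈ closure s
    · left
      by_contra h
      exact hno z hz ⟨hz2, h⟩
    · right; exact hz2) ⟨a, hat, ha⟩ ⟨b, hbt, hb⟩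
  exact hc2 (subset_closure (interior_subset hc1))

theorem jl_slice_main {p : ℕ → Polynomial ℂ} {δ : ℕ → ℂ} {R K : ℝ}
    (hG : ∀ n, JlGood (p n) (δ n) R K) {k : ℕ} (hk : 1 ≤ k) (pp : ∀ n, p (n + k) = p n)
    (pδ : ∀ n, δ (n + k) = δ n) {s : ℕ → ℂ → ℂ}
    (hd : ∀ n, DifferentiableOn ℂ (s n) (Metric.ball 0 1))
    (horb : ∀ n, ∀ z ∈ Metric.ball (0:ℂ) 1,
      s (n + 2) z = (p n).eval (s (n + 1) z) - δ n * s n z)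
    {Q : Set ℂ}
    (hQ : ∀ z ∈ Metric.ball (0:ℂ) 1,
      z ∈ Q ↔ ∃ C : ℝ, ∀ m : ℕ, ‖s (m * k + 1) z‖ ≤ C ∧ ‖s (m * k) z‖ ≤ C)
    {η : ℝ → ℂ} (hinj : InjOn η (Icc 0 1)) (hcont : ContinuousOn η (Icc 0 1))
    (himg : η '' Icc 0 1 = Metric.ball 0 1 ∩ frontier Q)
    (hfin : (MeasureTheory.Measure.hausdorffMeasure 1 : MeasureTheory.Measure ℂ)
      (η '' Icc 0 1) ≠ ⊤) : False := by
  have hR := (hG 0).R1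
  obtain ⟨x, v, hT, w, hw, hray⟩ := jl_arc_point hinj hcont hfin
  have hv := hT.v0
  have hEc : IsCompact (η '' Icc 0 1) := isCompact_Icc.image_of_continuousOn hcont
  set E := η '' Icc 0 1 with hE
  have hwn : w ≠ 0 := by rintro rfl; simp at hw
  -- a smaller ball
  obtain ⟨ρ, hρ1, hρE⟩ : ∃ ρ < 1, ∀ z ∈ E, ‖z‖ < ρ := by
    obtain ⟨z, hz, hzm⟩ := hEc.exists_isMaxOn ⟨x, hT.mem⟩ continuous_norm.continuousOn
    have h1 : ‖z‖ < 1 := by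
      rw [himg] at hz; simpa using hz.1
    refine ⟨(‖z‖ + 1) / 2, by linarith, fun y hy => ?_⟩
    have : ‖y‖ ≤ ‖z‖ := hzm hy
    linarith
  have hρ0 : 0 < ρ := lt_of_le_of_lt (norm_nonneg x) (hρE x hT.mem)
  have hsub : Metric.closedBall (0:ℂ) ρ ⊆ Metric.ball 0 1 := Metric.closedBall_subset_ball hρ1
  -- entering time
  obtain ⟨M, hM⟩ : ∃ M : ℕ, ∀ z ∈ Metric.closedBall (0:ℂ) ρ,
      ‖s (M * k) z‖ ≤ max ‖s (M * k + 1) z‖ R := by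
    obtain ⟨C, hC⟩ := (isCompact_closedBall (0:ℂ) ρ).exists_bound_of_continuousOn
      ((hd 0).continuousOn.mono hsub)
    obtain ⟨M, hM⟩ := pow_unbounded_of_one_lt C (show (1:ℝ) < 2 by norm_num)
    refine ⟨M, fun z hz => ?_⟩
    by_contra hcon
    have h1 := jl_enter hG (s := fun n => s n z) (fun n => horb n z (hsub hz)) (M * k)
      (not_le.1 hcon)
    have h2 : (2:ℝ) ^ M ≤ 2 ^ (M * k) :=
      pow_le_pow_right₀ (by norm_num) (Nat.le_mul_of_pos_right M hk)
    have h3 := hC z hz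
    linarith
  set S : ℕ → ℂ → ℂ := fun n z => s (M * k + n) z with hS
  have hSorb : ∀ z ∈ Metric.closedBall (0:ℂ) ρ, JlOrb p δ R (fun n => S n z) := by
    intro z hz
    refine ⟨fun n => ?_, hM z hz⟩
    have := horb (M * k + n) z (hsub hz)
    have e1 := congrFun (jl_per_shift pp M) n
    have e2 := congrFun (jl_per_shift pδ M) n
    rw [e1, e2] at this
    exact this
  have hSd : ∀ n, DifferentiableOn ℂ (S n) (Metric.ball 0 1) := fun n => hd _
  have hSQ : ∀ z ∈ Metric.closedBall (0:ℂ) ρ, z ∈ Q ↔ ∀ n, ‖S n z‖ ≤ R := by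
    intro z hz
    rw [hQ z (hsub hz)]
    constructor
    · rintro ⟨C, hC⟩ n
      by_contra hcon
      push Not at hcon
      have h1 : R ≤ ‖S (n + 1) z‖ := by
        rcases le_max_iff.1 ((hSorb z hz).W_succ hG n) with h1 | h1
        · exact hcon.le.trans h1
        · exact absurd h1 (not_le.2 hcon)
      obtain ⟨m0, hm0⟩ := pow_unbounded_of_one_lt C (show (1:ℝ) < 2 by norm_num)
      have h2 : n + 1 + m0 ≤ (n + 1 + m0) * k := Nat.le_mul_of_pos_right _ hk
      obtain ⟨m, hm⟩ := Nat.exists_eq_add_of_le h2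
      have h3 := (hSorb z hz).grow_pow hG h1 (m0 + m)
      have h4 : S (n + (m0 + m) + 1) z = s ((M + (n + 1 + m0)) * k) z := by
        simp only [hS]
        congr 1
        rw [add_mul, hm]
        ring
      simp only [h4] at h3
      have h5 := (hC (M + (n + 1 + m0))).2
      have h6 : (2:ℝ) ^ m0 ≤ 2 ^ (m0 + m) := pow_le_pow_right₀ (by norm_num) (by omega)
      have h7 : (2:ℝ) ^ (m0 + m) ≤ 2 ^ (m0 + m) * ‖S (n + 1) z‖ :=
        le_mul_of_one_le_right (by positivity) (by linarith)
      linarith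
    · intro h
      have key : ∀ i, ‖s i z‖ ≤ R + ∑ i ∈ Finset.range (M * k), ‖s i z‖ := by
        intro i
        rcases lt_or_ge i (M * k) with hi | hi
        · have := Finset.single_le_sum (f := fun i => ‖s i z‖) (fun i _ => norm_nonneg _)
            (Finset.mem_range.2 hi)
          linarith
        · obtain ⟨m, rfl⟩ := Nat.exists_eq_add_of_le hi
          have h1 := h m
          have h2 : 0 ≤ ∑ i ∈ Finset.range (M * k), ‖s i z‖ :=
            Finset.sum_nonneg fun i _ => norm_nonneg _
          simp only [hS] at h1
          linarith
      exact ⟨_, fun m => ⟨key _, key _⟩⟩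
  -- the sphere is disjoint from Q
  have hxρ : ‖x‖ < ρ := hρE x hT.mem
  have hsphere : ∀ z : ℂ, ‖z‖ = ρ → z ∉ Q := by
    intro z hz hzQ
    have hpre : IsPreconnected (Metric.sphere (0:ℂ) ρ) :=
      isPreconnected_sphere (by rw [Complex.rank_real_complex]; norm_num) 0 ρ
    have hall : ∀ y : ℂ, ‖y‖ = ρ → y ∈ Q := by
      intro y hy
      by_contra hyQ
      obtain ⟨a, ha1, ha2⟩ := jl_frontier hpre ⟨z, by simpa using hz, hzQ⟩
        ⟨y, by simpa using hy, hyQ⟩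
      have ha : ‖a‖ = ρ := by simpa using ha1
      have haE : a ∈ E := by rw [himg]; exact ⟨by simpa [ha] using hρ1, ha2⟩
      exact (hρE a haE).ne ha
    have hball : Metric.ball (0:ℂ) ρ ⊆ Q := by
      intro y hy
      have hy' : y ∈ Metric.closedBall (0:ℂ) ρ := Metric.ball_subset_closedBall hy
      rw [hSQ y hy']
      intro n
      refine Complex.norm_le_of_forall_mem_frontier_norm_le (U := Metric.ball (0:ℂ) ρ)
        (f := S n) Metric.isBounded_ball ?_ ?_ (subset_closure hy)
      · refine DifferentiableOn.diffContOnCl ((hSd n).mono ?_)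
        rw [closure_ball _ hρ0.ne']
        exact hsub
      · intro a ha
        rw [frontier_ball _ hρ0.ne'] at ha
        have ha' : ‖a‖ = ρ := by simpa using ha
        exact (hSQ a (by simp [ha'])).1 (hall a ha') n
    have hxE := hT.mem
    rw [himg] at hxE
    have : x ∈ interior Q := mem_interior.2 ⟨_, hball, Metric.isOpen_ball, by simpa using hxρ⟩
    exact hxE.2.2 this
  set ρ' := (ρ - ‖x‖) / ‖v‖ with hρ'
  have hvn : 0 < ‖v‖ := norm_pos_iff.2 hv
  have hρ'0 : 0 < ρ' := div_pos (by linarith) hvn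
  have hmap : ∀ z ∈ Metric.ball (0:ℂ) ρ', x + v * z ∈ Metric.ball (0:ℂ) ρ := by
    intro z hz
    have h1 : ‖z‖ < ρ' := by simpa using hz
    rw [hρ', lt_div_iff₀ hvn] at h1
    have h2 := norm_add_le x (v * z)
    rw [norm_mul] at h2
    simp only [mem_ball_zero_iff]
    linarith
  have hbc := Metric.ball_subset_closedBall (x := (0:ℂ)) (ε := ρ)
  have hcontmap : Continuous (fun z => x + v * z) := by fun_prop
  refine jl_core hG (k := k) (S := fun n z => S n (x + v * z)) (ρ := ρ')
    (E := {ζ | x + v * ζ ∈ E}) ?_ hT.T1 hT.T2 ?_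
  · refine ⟨hk, pp, pδ, hρ'0, fun n => ?_, fun z hz => hSorb _ (hbc (hmap z hz)), ?_, ?_⟩
    · exact (hSd n).comp (t := Metric.ball 0 1) (by fun_prop) fun z hz => hsub (hbc (hmap z hz))
    · intro z hz hzE
      have hy := hbc (hmap z hz)
      by_cases hyQ : x + v * z ∈ Q
      · right
        have h1 : x + v * z ∈ interior Q := by
          by_contra h2
          apply hzE
          show x + v * z ∈ E
          rw [himg]
          exact ⟨hsub hy, subset_closure hyQ, h2⟩
        have h2 : ∀ᶠ y in 𝓝 (x + v * z), y ∈ Q ∧ y ∈ Metric.ball (0:ℂ) ρ :=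
          Filter.Eventually.and (mem_interior_iff_mem_nhds.1 h1)
            (Metric.isOpen_ball.mem_nhds (hmap z hz))
        filter_upwards [hcontmap.continuousAt.eventually h2] with y hy2
        exact (hSQ _ (hbc hy2.2)).1 hy2.1
      · left
        rw [hSQ _ hy] at hyQ
        push Not at hyQ
        exact hyQ
    · intro z hz hzE n
      by_contra hcon
      push Not at hcon
      have hy := hmap z hz
      have hzE' : x + v * z ∈ E := hzE
      rw [himg] at hzE'
      have h1 : ∀ᶠ y in 𝓝 (x + v * z), R < ‖S n y‖ := by
        have : ContinuousAt (S n) (x + v * z) :=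
          (hSd n).continuousOn.continuousAt (Metric.isOpen_ball.mem_nhds hzE'.1)
        exact this.norm.eventually (lt_mem_nhds hcon)
      have h2 : ∃ᶠ y in 𝓝 (x + v * z), y ∈ Q := mem_closure_iff_frequently.1 hzE'.2.1
      obtain ⟨y, hyQ, hyR, hyb⟩ := (h2.and_eventually
        (h1.and (Metric.isOpen_ball.mem_nhds hy))).exists
      have := (hSQ y (hbc hyb)).1 hyQ n
      linarith
  · -- escaping ray
    refine ⟨w, hw, ?_⟩
    set F : ℝ → ℂ := fun τ => x + v * (τ * w) with hF
    have hFc : Continuous F := by fun_prop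
    have hvw : 0 < ‖v * w‖ := norm_pos_iff.2 (mul_ne_zero hv hwn)
    obtain ⟨τ1, hτ1, hτ1ρ⟩ : ∃ τ1 > 0, ‖F τ1‖ = ρ := by
      set T := (ρ + ‖x‖) / ‖v * w‖ with hTd
      have hT0 : 0 ≤ T := by positivity
      have hTρ : ρ ≤ ‖F T‖ := by
        have h1 : ‖v * (T * w)‖ = ρ + ‖x‖ := by
          have : v * (T * w) = T * (v * w) := by ring
          rw [this, norm_mul, Complex.norm_real, Real.norm_of_nonneg hT0, hTd]
          field_simp
        have h2 := norm_sub_norm_le (v * (T * w)) (-x)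
        rw [norm_neg, sub_neg_eq_add, add_comm _ x] at h2
        simp only [hF]
        linarith
      have h0 : ‖F 0‖ < ρ := by simpa [hF] using hxρ
      obtain ⟨τ1, hτ1, h1⟩ := intermediate_value_Icc (f := fun τ => ‖F τ‖) hT0
        (hFc.norm.continuousOn) ⟨h0.le, hTρ⟩
      refine ⟨τ1, lt_of_le_of_ne hτ1.1 ?_, h1⟩
      rintro rfl
      simp only at h1
      linarith
    refine ⟨τ1, hτ1, fun τ hτ hτ2 => ?_⟩
    have hin : ∀ t, 0 < t → t ≤ τ1 → F t ∈ Metric.closedBall (0:ℂ) ρ := by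
      intro t ht ht2
      have h1 := (convex_closedBall (0:ℂ) ρ) (x := x) (by simpa using hxρ.le) (y := F τ1)
        (by simpa using hτ1ρ.le) (a := 1 - t / τ1) (b := t / τ1)
        (by rw [sub_nonneg, div_le_one hτ1]; exact ht2) (by positivity) (by ring)
      convert h1 using 1
      simp only [hF, Complex.real_smul]
      have : (τ1 : ℂ) ≠ 0 := by exact_mod_cast hτ1.ne'
      push_cast
      field_simp
      ring
    have hnQ : F τ ∉ Q := by
      intro hFQ
      have hpre : IsPreconnected (F '' Ioc 0 τ1) := isPreconnected_Ioc.image _ hFc.continuousOn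
      obtain ⟨a, ⟨t, ht, rfl⟩, ha2⟩ := jl_frontier hpre
        ⟨F τ, ⟨τ, ⟨hτ, hτ2.le⟩, rfl⟩, hFQ⟩ ⟨F τ1, ⟨τ1, ⟨hτ1, le_rfl⟩, rfl⟩, hsphere _ hτ1ρ⟩
      refine hray t ht.1 ?_
      rw [himg]
      exact ⟨hsub (hin t ht.1 ht.2), ha2⟩
    rw [hSQ _ (hin τ hτ hτ2.le)] at hnQ
    push Not at hnQ
    exact hnQ


theorem jl_mv_diff (P : MvPolynomial (Fin 2) ℂ) :
    Differentiable ℂ (fun z : ℂ × ℂ => MvPolynomial.eval ![z.1, z.2] P) := by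
  induction P using MvPolynomial.induction_on with
  | C a => simp
  | add P Q hP hQ => simp only [map_add]; exact hP.add hQ
  | mul_X P i hP =>
    simp only [map_mul, MvPolynomial.eval_X]
    refine hP.mul ?_
    fin_cases i
    · simpa using differentiable_fst
    · simpa using differentiable_snd

theorem jl_polymap_diff {F : ℂ × ℂ → ℂ × ℂ} (hF : IsPolyMap F) : Differentiable ℂ F := by
  obtain ⟨P, Q, h⟩ := hF
  have : F = fun z => (MvPolynomial.eval ![z.1, z.2] P, MvPolynomial.eval ![z.1, z.2] Q) :=
    funext h
  rw [this]
  exact (jl_mv_diff P).prodMk (jl_mv_diff Q)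

theorem jl_bdd_image {F : ℂ × ℂ → ℂ × ℂ} (hF : Continuous F) (C : ℝ) :
    ∃ C' : ℝ, ∀ z, ‖z‖ ≤ C → ‖F z‖ ≤ C' := by
  obtain ⟨C', h⟩ := (isCompact_closedBall (0 : ℂ × ℂ) C).exists_bound_of_continuousOn
    hF.continuousOn
  exact ⟨C', fun z hz => h z (by simpa using hz)⟩

theorem jl_Kplus_conj {f H u v : ℂ × ℂ → ℂ × ℂ} (hu : Continuous u) (hv : Continuous v)
    (huv : ∀ z, u (v z) = z) (hvu : ∀ z, v (u z) = z) (hf : ∀ z, f z = v (H (u z)))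
    (z : ℂ × ℂ) : z ∈ Kplus f ↔ u z ∈ Kplus H := by
  have hit : ∀ n, u (f^[n] z) = H^[n] (u z) := by
    intro n
    induction n with
    | zero => rfl
    | succ n ih => rw [iterate_succ_apply', iterate_succ_apply', hf, huv, ih]
  constructor
  · rintro ⟨C, hC⟩
    obtain ⟨C', h⟩ := jl_bdd_image hu C
    exact ⟨C', fun n => by rw [← hit]; exact h _ (hC n)⟩
  · rintro ⟨C, hC⟩
    obtain ⟨C', h⟩ := jl_bdd_image hv C
    refine ⟨C', fun n => ?_⟩
    rw [← hvu (f^[n] z), hit]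
    exact h _ (hC n)

/-- Nonautonomous orbit. -/
def jlSt (h : ℕ → ℂ × ℂ → ℂ × ℂ) (z : ℂ × ℂ) : ℕ → ℂ × ℂ
  | 0 => z
  | n + 1 => h n (jlSt h z n)

theorem jl_St_block (h : ℕ → ℂ × ℂ → ℂ × ℂ) (z : ℂ × ℂ) (l : List (ℂ × ℂ → ℂ × ℂ)) :
    ∀ N, (∀ i (hi : i < l.length), h (N + i) = l[i]) →
      jlSt h z (N + l.length) = l.foldl (fun z h => h z) (jlSt h z N) := by
  induction l with
  | nil => intro N _; rfl
  | cons a l ih =>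
    intro N hN
    have h1 := ih (N + 1) (fun i hi => by
      have := hN (i + 1) (by simpa using hi)
      rw [add_assoc, add_comm 1 i]
      simpa using this)
    have h0 : h N = a := hN 0 (Nat.succ_pos _)
    have e : N + (a :: l).length = N + 1 + l.length := by simp; omega
    rw [e, h1, List.foldl_cons]
    simp only [jlSt, h0]

theorem jl_foldr_comp (l : List (ℂ × ℂ → ℂ × ℂ)) (z : ℂ × ℂ) :
    l.foldr (fun h acc => h ∘ acc) id z = l.foldr (fun h z => h z) z := by
  induction l with
  | nil => rfl
  | cons a l ih => simp [ih]

/-- if the Julia slice of a transversal to `J⁺` is a Jordan arc, then its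
1-dimensional Hausdorff measure is infinite. -/
theorem julia_slice_jordan_arc_infinite_length (f : ℂ × ℂ → ℂ × ℂ) (γ : ℂ → ℂ × ℂ)
    (hf : IsLoxodromic f) (hγ : IsTransversal f γ)
    (η : ℝ → ℂ) (hinj : Set.InjOn η (Set.Icc 0 1))
    (hcont : ContinuousOn η (Set.Icc 0 1))
    (himg : η '' Set.Icc 0 1 = juliaSlice f γ) :
    (MeasureTheory.Measure.hausdorffMeasure 1 : MeasureTheory.Measure ℂ)
      (juliaSlice f γ) = ⊤ := by
  by_contra hne
  rw [← himg] at hne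
  obtain ⟨-, u, uinv, hs, hu, hvu, huv, hs0, hH, hfu⟩ := hf
  obtain ⟨hup, G, hG, hGu, huG⟩ := hu
  have huinv : uinv = G := by
    funext z
    rw [← hGu (uinv z), huv]
  subst huinv
  have hud := jl_polymap_diff hup
  have hvd := jl_polymap_diff hG
  set H : ℂ × ℂ → ℂ × ℂ := hs.foldr (fun h acc => h ∘ acc) id with hHdef
  choose! cp ca hca hcd hch using hH
  set l := hs.reverse with hl
  set k := l.length with hk
  have hk1 : 0 < k := by
    rw [hk, hl, List.length_reverse]
    exact List.length_pos_iff.2 hs0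
  set h : ℕ → ℂ × ℂ → ℂ × ℂ := fun n => l[n % k]'(Nat.mod_lt _ hk1) with hh
  have hmem : ∀ n, h n ∈ hs := fun n => by
    have : h n ∈ l := List.getElem_mem _
    simpa [hl] using this
  have hper : ∀ n, h (n + k) = h n := fun n => by simp [hh]
  have hblock : ∀ z m, jlSt h z (m * k) = H^[m] z := by
    intro z m
    induction m with
    | zero => simp [jlSt]
    | succ m ih =>
      rw [Nat.succ_mul, iterate_succ_apply', ← ih, hHdef, jl_foldr_comp,
        jl_St_block h z l (m * k) (fun i hi => by
          have e : (m * k + i) % k = i := by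
            rw [Nat.mul_comm, Nat.mul_add_mod]; exact Nat.mod_eq_of_lt hi
          simp only [hh, e]), hl, List.foldl_reverse]
  have hst : ∀ n z, jlSt h z (n + 1) =
      ((cp (h n)).eval (jlSt h z n).1 - ca (h n) * (jlSt h z n).2, (jlSt h z n).1) :=
    fun n z => hch (h n) (hmem n) _
  have hgood : ∀ᶠ R in (atTop : Filter ℝ), ∀ᶠ K in (atTop : Filter ℝ),
      ∀ g ∈ {g | g ∈ hs}, JlGood (cp g) (ca g) R K := by
    have h1 : ∀ᶠ R in (atTop : Filter ℝ), ∀ g ∈ {g | g ∈ hs},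
        ∀ᶠ K in (atTop : Filter ℝ), JlGood (cp g) (ca g) R K :=
      (eventually_all_finite hs.finite_toSet).2
        fun g hg => jl_good_exists _ _ (hcd g hg) (hca g hg)
    filter_upwards [h1] with R hR
    exact (eventually_all_finite hs.finite_toSet).2 hR
  obtain ⟨R, hR⟩ := hgood.exists
  obtain ⟨K, hRK⟩ := hR.exists
  have hSd : ∀ n, DifferentiableOn ℂ (fun z => jlSt h (u (γ z)) n) (Metric.ball 0 1) := by
    intro n
    induction n with
    | zero => exact hud.comp_differentiableOn hγ.2.1
    | succ n ih =>
      simp only [hst]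
      have hp : Differentiable ℂ (fun z => (cp (h n)).eval z) := Polynomial.differentiable _
      exact ((hp.comp_differentiableOn ih.fst).sub (ih.snd.const_mul _)).prodMk ih.fst
  refine jl_slice_main (p := fun n => cp (h n)) (δ := fun n => ca (h n)) (R := R) (K := K)
    (fun n => hRK _ (hmem n)) (k := k) hk1 (fun n => by simp only [hper])
    (fun n => by simp only [hper]) (s := fun n z => (jlSt h (u (γ z)) n).2)
    (fun n => (hSd n).snd) ?_ (Q := {z | z ∈ unitDisk ∧ γ z ∈ Kplus f}) ?_ hinj hcont himg hne
  · intro n z _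
    simp only [hst]
  · intro z hz
    have h1 : z ∈ {z | z ∈ unitDisk ∧ γ z ∈ Kplus f} ↔ γ z ∈ Kplus f :=
      ⟨fun h => h.2, fun h => ⟨hz, h⟩⟩
    rw [h1, jl_Kplus_conj hud.continuous hvd.continuous huG hGu hfu]
    refine exists_congr fun C => forall_congr' fun m => ?_
    rw [← hblock, Prod.norm_def, max_le_iff]
    simp only [hst]
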